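/- Let U be a convex open subset of M(Σ_D), let γ ∈ {α,β}, and let μ⁺, μ⁻ ∈ U ∩ (M^e_0(Σ_D) ∪ M^e_γ(Σ_D)) be distinct measures. Then there exists a high complexity path that lies in U ∩ (M^e_0(Σ_D) ∪ M^e_γ(Σ_D)) and joins μ⁺ and μ⁻. -/

import Mathlib

open MeasureTheory Topology Filter
open scoped ENNReal NNReal


/-! ### The alphabet of the (M,N) Dyck–Motzkin shift -/

/-- The alphabet `D = D_α ∪ D_0 ∪ D_β` of the `(M,N)` Dyck–Motzkin shift:
`la k` is the left bracket `α_k`, `u k` is the unit `1_k`, `ra k` is the right bracket `β_k`. -/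
inductive DMSym (M N : ℕ) : Type where
  | la : Fin M → DMSym M N
  | u  : Fin N → DMSym M N
  | ra : Fin M → DMSym M N
deriving DecidableEq

namespace DMSym

def equivSum (M N : ℕ) : DMSym M N ≃ (Fin M ⊕ Fin N ⊕ Fin M) where
  toFun s := match s with
    | .la k => Sum.inl k
    | .u k => Sum.inr (Sum.inl k)
    | .ra k => Sum.inr (Sum.inr k)
  invFun s := match s with
    | Sum.inl k => .la k
    | Sum.inr (Sum.inl k) => .u k
    | Sum.inr (Sum.inr k) => .ra k
  left_inv s := by cases s <;> rfl
  right_inv s := by rcases s with k | k | k <;> rfl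

instance (M N : ℕ) : Fintype (DMSym M N) := Fintype.ofEquiv _ (equivSum M N).symm
instance (M N : ℕ) : TopologicalSpace (DMSym M N) := ⊥
instance (M N : ℕ) : DiscreteTopology (DMSym M N) := ⟨rfl⟩
instance (M N : ℕ) : MeasurableSpace (DMSym M N) := ⊤
instance (M N : ℕ) : BorelSpace (DMSym M N) := ⟨borel_eq_top_of_discrete.symm⟩

end DMSym

/-- Nonzero elements of the Dyck–Motzkin monoid with zero are represented in normal form:
`some (bs, as)` is the reduced word `β_{bs(0)} ⋯ β_{bs(r)} α_{as(0)} ⋯ α_{as(s)}`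
(in particular `some ([], [])` is the unit element `1`); `none` is the zero element `0`. -/
abbrev DyckElem (M : ℕ) := Option (List (Fin M) × List (Fin M))

/-- Multiplication, in the Dyck–Motzkin monoid with zero, of an element in normal form on
the right by a generator: units are absorbed, a left bracket is appended, and a right bracket
either closes the last left bracket (if the indices match), is appended (if there is no left
bracket to close), or produces the zero element (if the indices do not match). -/
def dyckStep {M N : ℕ} : DyckElem M → DMSym M N → DyckElem M
  | none, _ => none
  | some (bs, as), .la k => some (bs, as ++ [k])
  | some (bs, as), .u _ => some (bs, as)
  | some (bs, as), .ra k =>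
      match as.getLast? with
      | none => some (bs ++ [k], [])
      | some j => if j = k then some (bs, as.dropLast) else none

/-- `red w` is the image of the word `w` in the Dyck–Motzkin monoid with zero. -/
def red {M N : ℕ} (w : List (DMSym M N)) : DyckElem M :=
  w.foldl dyckStep (some ([], []))

/-- The word `x_j x_{j+1} ⋯ x_k` read off a bi-infinite sequence `x`. -/
def wordAt {M N : ℕ} (x : ℤ → DMSym M N) (j k : ℤ) : List (DMSym M N) :=
  (List.range (k + 1 - j).toNat).map fun n => x (j + n)

/-- The `(M,N)` Dyck–Motzkin shift `Σ_D`. -/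
def SigmaD (M N : ℕ) : Set (ℤ → DMSym M N) :=
  {x | ∀ j k : ℤ, j < k → red (wordAt x j k) ≠ none}

/-- The left shift `σ`. -/
def shift {A : Type*} : (ℤ → A) → (ℤ → A) := fun x i => x (i + 1)

/-- The inverse `σ⁻¹` of the left shift. -/
def shiftInv {A : Type*} : (ℤ → A) → (ℤ → A) := fun x i => x (i - 1)

lemma wordAt_shift {M N : ℕ} (x : ℤ → DMSym M N) (j k : ℤ) :
    wordAt (shift x) j k = wordAt x (j + 1) (k + 1) := by
  simp only [wordAt, shift]
  rw [show (k + 1 + 1 - (j + 1) : ℤ) = k + 1 - j by ring]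
  exact List.map_congr_left fun n _ => by rw [show (j + n + 1 : ℤ) = j + 1 + n by ring]

lemma shift_mem_SigmaD {M N : ℕ} {x : ℤ → DMSym M N} (hx : x ∈ SigmaD M N) :
    shift x ∈ SigmaD M N := by
  intro j k hjk
  rw [wordAt_shift]
  exact hx (j + 1) (k + 1) (by omega)

/-- The left shift acting on `Σ_D`. -/
def shiftD (M N : ℕ) : ↥(SigmaD M N) → ↥(SigmaD M N) :=
  fun x => ⟨shift x.val, shift_mem_SigmaD x.property⟩

section Generic
variable {X : Type*} [MeasurableSpace X]

/-- The set of `T`-invariant Borel probability measures. -/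
def InvMeas (T : X → X) : Set (ProbabilityMeasure X) :=
  {μ | MeasurePreserving T μ.toMeasure μ.toMeasure}

/-- The set of `T`-invariant ergodic Borel probability measures. -/
def ErgMeas (T : X → X) : Set (ProbabilityMeasure X) :=
  {μ | Ergodic T μ.toMeasure}

/-- A `CO`-measure: an invariant ergodic probability measure supported on the orbit of a
single periodic point. -/
def IsCOMeas (T : X → X) (μ : ProbabilityMeasure X) : Prop :=
  Ergodic T μ.toMeasure ∧
    ∃ (x : X) (n : ℕ), 0 < n ∧ T^[n] x = x ∧
      μ.toMeasure {y | ∃ k : ℕ, y = T^[k] x} = 1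

/-- Convexity for a set of probability measures: it is stable under taking the convex
combination `t•μ + (1-t)•ν` of any two of its members. -/
def ConvexMeasSet (U : Set (ProbabilityMeasure X)) : Prop :=
  ∀ μ ∈ U, ∀ ν ∈ U, ∀ t : ℝ≥0∞, t ≤ 1 → ∀ ρ : ProbabilityMeasure X,
    ρ.toMeasure = t • μ.toMeasure + (1 - t) • ν.toMeasure → ρ ∈ U

/-- A measure is fully supported if it gives positive measure to every non-empty open set. -/
def FullSupp [TopologicalSpace X] (μ : ProbabilityMeasure X) : Prop :=
  ∀ U : Set X, IsOpen U → U.Nonempty → 0 < μ.toMeasure U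

/-- Measure-theoretic isomorphism of the measure-preserving systems `(X,T,μ)` and `(Y,S,ν)`. -/
def MeasureIso {Y : Type*} [MeasurableSpace Y] (T : X → X) (S : Y → Y)
    (μ : Measure X) (ν : Measure Y) : Prop :=
  ∃ (φ : X → Y) (ψ : Y → X), Measurable φ ∧ Measurable ψ ∧
    Measure.map φ μ = ν ∧ Measure.map ψ ν = μ ∧
    (∀ᵐ x ∂μ, ψ (φ x) = x) ∧ (∀ᵐ y ∂ν, φ (ψ y) = y) ∧
    (∀ᵐ x ∂μ, φ (T x) = S (φ x))

/-- The system `(X,T,μ)` is Bernoulli: it is measure-theoretically isomorphic to a two-sided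
Bernoulli shift, i.e. the left shift on `ℤ → ℕ` equipped with an i.i.d. product measure
(determined by requiring that the measures of all cylinder sets factorize according to a
fixed distribution `p`). -/
def IsBernoulli (T : X → X) (μ : Measure X) : Prop :=
  ∃ (p : ℕ → ℝ≥0∞) (ν : Measure (ℤ → ℕ)), (∑' n, p n) = 1 ∧
    IsProbabilityMeasure ν ∧
    (∀ (n : ℕ) (w : Fin n → ℕ) (j : ℤ),
      ν {y | ∀ i : Fin n, y (j + (i : ℕ)) = w i} = ∏ i, p (w i)) ∧
    MeasureIso T shift μ ν

end Generic

/-- `M(Σ_D)`: the space of shift-invariant Borel probability measures on `Σ_D`,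
endowed with the weak* topology. -/
def MinvD (M N : ℕ) : Set (ProbabilityMeasure ↥(SigmaD M N)) := InvMeas (shiftD M N)

/-- `M^e(Σ_D)`: the shift-invariant ergodic Borel probability measures on `Σ_D`. -/
def MergD (M N : ℕ) : Set (ProbabilityMeasure ↥(SigmaD M N)) := ErgMeas (shiftD M N)

/-- The integral `∫ f dμ`. -/
noncomputable def intCf {M N : ℕ} (f : C(↥(SigmaD M N), ℝ))
    (μ : ProbabilityMeasure ↥(SigmaD M N)) : ℝ := ∫ x, f x ∂μ.toMeasure

/-- `M_max(f)`: the set of `f`-maximizing measures, i.e. the shift-invariant measures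
attaining `sup { ∫ f dν : ν ∈ M(Σ_D) }`. -/
def Mmax (M N : ℕ) (f : C(↥(SigmaD M N), ℝ)) : Set (ProbabilityMeasure ↥(SigmaD M N)) :=
  {μ ∈ MinvD M N | ∀ ν ∈ MinvD M N, intCf f ν ≤ intCf f μ}

/-- `G_j(x)`: `1` on left brackets, `-1` on right brackets, `0` on units. -/
def Gfun {M N : ℕ} (x : ℤ → DMSym M N) (j : ℤ) : ℤ :=
  match x j with
  | .la _ => 1
  | .u _ => 0
  | .ra _ => -1

/-- `H_i(x) = Σ_{j=0}^{i-1} G_j(x)` for `i ≥ 1`, `H_i(x) = -Σ_{j=i}^{-1} G_j(x)` for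
`i ≤ -1`, and `H_0(x) = 0`. -/
def Hfun {M N : ℕ} (x : ℤ → DMSym M N) (i : ℤ) : ℤ :=
  if 0 ≤ i then ∑ j ∈ Finset.range i.toNat, Gfun x (j : ℤ)
  else -∑ j ∈ Finset.range (-i).toNat, Gfun x (i + (j : ℤ))

/-- The set `A_0`. -/
def A0set (M N : ℕ) : Set (ℤ → DMSym M N) :=
  SigmaD M N ∩ {x | ∀ i : ℤ,
    (∃ j : ℕ, 1 ≤ j ∧ Hfun x (i + (j : ℤ)) = Hfun x i) ∧
    (∃ j : ℕ, 1 ≤ j ∧ Hfun x (i - (j : ℤ)) = Hfun x i)}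

/-- The set `A_α`. -/
def AalphaSet (M N : ℕ) : Set (ℤ → DMSym M N) :=
  SigmaD M N ∩ {x | Tendsto (Hfun x) atTop atTop ∧ Tendsto (Hfun x) atBot atBot}

/-- The set `A_β`. -/
def AbetaSet (M N : ℕ) : Set (ℤ → DMSym M N) :=
  SigmaD M N ∩ {x | Tendsto (Hfun x) atTop atBot ∧ Tendsto (Hfun x) atBot atTop}

/-- `M^{CO}(Σ_D)`: the set of `CO`-measures on `Σ_D`. -/
def MCO (M N : ℕ) : Set (ProbabilityMeasure ↥(SigmaD M N)) :=
  {μ | IsCOMeas (shiftD M N) μ}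

/-- `M^e_0(Σ_D) = { μ ∈ M^e(Σ_D) : μ(A_0) = 1 }`. -/
def Me0 (M N : ℕ) : Set (ProbabilityMeasure ↥(SigmaD M N)) :=
  {μ ∈ MergD M N | μ.toMeasure (Subtype.val ⁻¹' A0set M N) = 1}

/-- `M^e_α(Σ_D) = { μ ∈ M^e(Σ_D) : μ(A_α) = 1 }`. -/
def MeAl (M N : ℕ) : Set (ProbabilityMeasure ↥(SigmaD M N)) :=
  {μ ∈ MergD M N | μ.toMeasure (Subtype.val ⁻¹' AalphaSet M N) = 1}

/-- `M^e_β(Σ_D) = { μ ∈ M^e(Σ_D) : μ(A_β) = 1 }`. -/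
def MeBe (M N : ℕ) : Set (ProbabilityMeasure ↥(SigmaD M N)) :=
  {μ ∈ MergD M N | μ.toMeasure (Subtype.val ⁻¹' AbetaSet M N) = 1}

/-- A high complexity path: a path of ergodic measures such that (A1) all but countably
many of its points are fully supported and Bernoulli, and (A2) every value is attained
only countably often. -/
def HCPath (M N : ℕ) (p : unitInterval → ProbabilityMeasure ↥(SigmaD M N)) : Prop :=
  Continuous p ∧ (∀ t, p t ∈ MergD M N) ∧
  Set.Countable {t : unitInterval |
    ¬(FullSupp (p t) ∧ IsBernoulli (shiftD M N) (p t).toMeasure)} ∧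
  ∀ t : unitInterval, Set.Countable {s : unitInterval | p s = p t}

/-! ### Part A: ergodic sums -/

noncomputable def minSum {X : Type*} (T : X → X) (h : X → ℝ) : ℕ → X → ℝ
  | 0, _ => 0
  | n + 1, x => min 0 (h x + minSum T h n (T x))

lemma minSum_le_birk {X : Type*} (T : X → X) (h : X → ℝ) (n : ℕ) :
    ∀ x, ∀ k ≤ n, minSum T h n x ≤ birkhoffSum T h k x := by
  induction n with
  | zero => intro x k hk; obtain rfl : k = 0 := by omega
            simp [minSum]
  | succ n ih =>
    intro x k hk
    rcases k with _ | k
    · simp [minSum]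
    · rw [birkhoffSum_succ']
      exact (min_le_right _ _).trans (by have := ih (T x) k (by omega); linarith)

lemma minSum_nonpos {X : Type*} (T : X → X) (h : X → ℝ) (n : ℕ) (x : X) :
    minSum T h n x ≤ 0 := by
  cases n <;> simp [minSum]

lemma minSum_antitone {X : Type*} (T : X → X) (h : X → ℝ) (n : ℕ) :
    ∀ x, minSum T h (n + 1) x ≤ minSum T h n x := by
  induction n with
  | zero => intro x; exact minSum_nonpos _ _ _ _
  | succ n ih =>
    intro x
    have := ih (T x)
    change min 0 (h x + minSum T h (n + 1) (T x)) ≤ min 0 (h x + minSum T h n (T x))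
    exact min_le_min le_rfl (by linarith)

lemma minSum_measurable {X : Type*} [MeasurableSpace X] {T : X → X} (hT : Measurable T)
    {h : X → ℝ} (hh : Measurable h) (n : ℕ) : Measurable (minSum T h n) := by
  induction n with
  | zero => exact measurable_const
  | succ n ih => exact measurable_const.min (hh.add (ih.comp hT))

lemma minSum_lower {X : Type*} (T : X → X) {h : X → ℝ} {C : ℝ} (hC : ∀ x, |h x| ≤ C) (n : ℕ) :
    ∀ x, -(n * C) ≤ minSum T h n x := by
  induction n with
  | zero => intro x; simp [minSum]
  | succ n ih =>
    intro x
    have h1 := ih (T x)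
    have h2 := abs_le.mp (hC x)
    have h3 : 0 ≤ C := (abs_nonneg _).trans (hC x)
    refine le_min ?_ ?_
    · have : 0 ≤ ((n + 1 : ℕ) : ℝ) * C := by positivity
      linarith
    · push_cast; linarith

lemma minSum_diff {X : Type*} (T : X → X) (h : X → ℝ) (n : ℕ) (x : X) :
    minSum T h (n + 1) x - minSum T h n (T x) = min (- minSum T h n (T x)) (h x) := by
  change min 0 (h x + minSum T h n (T x)) - minSum T h n (T x) = _
  rcases le_total 0 (h x + minSum T h n (T x)) with H | H
  · rw [min_eq_left H, min_eq_left (by linarith)]; ring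
  · rw [min_eq_right H, min_eq_right (by linarith)]; ring

lemma birk_bddBelow {X : Type*} [MeasurableSpace X] {T : X → X} {μ : Measure X}
    [IsProbabilityMeasure μ] (hT : Ergodic T μ) {h : X → ℝ} (hh : Measurable h) {C : ℝ}
    (hC : ∀ x, |h x| ≤ C) (hpos : 0 < ∫ x, h x ∂μ) :
    ∀ᵐ x ∂μ, ∃ K : ℝ, ∀ n, K ≤ birkhoffSum T h n x := by
  have hTm := hT.measurable
  have hbm : ∀ n, Measurable (birkhoffSum T h n) := fun n => by
    unfold birkhoffSum
    exact Finset.measurable_fun_sum _ fun k _ => hh.comp (hTm.iterate k)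
  set E : Set X := {x | ∀ K : ℕ, ∃ n, birkhoffSum T h n x < -K} with hE
  have hEm : MeasurableSet E := by
    have : E = ⋂ K : ℕ, ⋃ n, {x | birkhoffSum T h n x < -(K : ℝ)} := by
      ext x; simp [hE]
    rw [this]
    exact MeasurableSet.iInter fun K => MeasurableSet.iUnion fun n =>
      measurableSet_lt (hbm n) measurable_const
  have hEinv : T ⁻¹' E = E := by
    ext x
    constructor
    · intro hx K
      obtain ⟨K', hK'⟩ := exists_nat_gt (K + |h x|)
      obtain ⟨n, hn⟩ := hx K'
      refine ⟨n + 1, ?_⟩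
      rw [birkhoffSum_succ']
      have := le_abs_self (h x)
      linarith
    · intro hx K
      obtain ⟨K', hK'⟩ := exists_nat_gt (K + |h x|)
      obtain ⟨n, hn⟩ := hx K'
      have h0 := abs_nonneg (h x)
      have hK0 : (0:ℝ) ≤ K := Nat.cast_nonneg K
      rcases n with _ | n
      · simp at hn; linarith
      refine ⟨n, ?_⟩
      rw [birkhoffSum_succ'] at hn
      have := neg_abs_le (h x)
      linarith
  rcases hT.toPreErgodic.ae_mem_or_ae_notMem hEm hEinv with H | H
  · exfalso
    have hIntg : ∀ n, Integrable (minSum T h n) μ := fun n =>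
      Integrable.of_bound (minSum_measurable hTm hh n).aestronglyMeasurable (n * C)
        (Eventually.of_forall fun x => by
          rw [Real.norm_eq_abs, abs_le]
          have h3 : 0 ≤ C := (abs_nonneg _).trans (hC x)
          refine ⟨minSum_lower T hC n x, (minSum_nonpos T h n x).trans (by positivity)⟩)
    have hle : ∀ n, ∫ x, min (- minSum T h n (T x)) (h x) ∂μ ≤ 0 := by
      intro n
      simp_rw [← minSum_diff]
      have e1 : Integrable (fun x => minSum T h n (T x)) μ :=
        (hT.toMeasurePreserving.integrable_comp (hIntg n).aestronglyMeasurable).2 (hIntg n)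
      rw [integral_sub (hIntg (n+1)) e1]
      have e2 : ∫ x, minSum T h n (T x) ∂μ = ∫ x, minSum T h n x ∂μ := by
        have e3 := integral_map (μ := μ) hTm.aemeasurable (f := minSum T h n) (by
          rw [hT.toMeasurePreserving.map_eq]; exact (hIntg n).aestronglyMeasurable)
        rw [hT.toMeasurePreserving.map_eq] at e3
        exact e3.symm
      rw [e2]
      have := integral_mono (hIntg (n+1)) (hIntg n) (minSum_antitone T h n)
      linarith
    have hlim : Tendsto (fun n => ∫ x, min (- minSum T h n (T x)) (h x) ∂μ) atTop
        (𝓝 (∫ x, h x ∂μ)) := by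
      apply tendsto_integral_of_dominated_convergence (fun _ => C)
      · intro n
        exact (((minSum_measurable hTm hh n).comp hTm).neg.min hh).aestronglyMeasurable
      · exact integrable_const _
      · intro n
        refine Eventually.of_forall fun x => ?_
        have h1 := minSum_nonpos T h n (T x)
        have h2 := abs_le.mp (hC x)
        have h3 : 0 ≤ C := (abs_nonneg _).trans (hC x)
        rw [Real.norm_eq_abs, abs_le]
        exact ⟨le_min (by linarith) h2.1, (min_le_right _ _).trans h2.2⟩
      · filter_upwards [H] with x hx
        have hx' : T x ∈ E := by rw [← hEinv] at hx; exact hx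
        obtain ⟨K, hK⟩ := exists_nat_gt (h x)
        obtain ⟨n, hn⟩ := hx' K
        apply tendsto_const_nhds.congr'
        filter_upwards [eventually_ge_atTop n] with m hm
        rw [min_eq_right]
        have := minSum_le_birk T h m (T x) n hm
        linarith
    have := le_of_tendsto' hlim hle
    linarith
  · filter_upwards [H] with x hx
    simp only [hE, Set.mem_ofPred_eq, not_forall, not_exists, not_lt] at hx
    obtain ⟨K, hK⟩ := hx
    exact ⟨_, hK⟩

lemma birk_lower {X : Type*} [MeasurableSpace X] {T : X → X} {μ : Measure X}
    [IsProbabilityMeasure μ] (hT : Ergodic T μ) {h : X → ℝ} (hh : Measurable h) {C : ℝ}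
    (hC : ∀ x, |h x| ≤ C) {c : ℝ} (hpos : c < ∫ x, h x ∂μ) :
    ∀ᵐ x ∂μ, ∀ᶠ n : ℕ in atTop, c * n < birkhoffSum T h n x := by
  obtain ⟨d, hd1, hd2⟩ := exists_between hpos
  have hIntg : Integrable h μ := Integrable.of_bound hh.aestronglyMeasurable C
    (Eventually.of_forall hC)
  have := birk_bddBelow hT (h := fun x => h x - d) (hh.sub_const d) (C := C + |d|)
    (fun x => (abs_sub _ _).trans (by have := hC x; linarith)) (by
      rw [integral_sub hIntg (integrable_const _)]; simp; linarith)
  filter_upwards [this] with x ⟨K, hK⟩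
  obtain ⟨n0, hn0⟩ := exists_nat_gt ((-K) / (d - c))
  filter_upwards [eventually_ge_atTop n0] with n hn
  have h1 := hK n
  have h2 : birkhoffSum T (fun x => h x - d) n x = birkhoffSum T h n x - n * d := by
    simp [birkhoffSum, Finset.sum_sub_distrib]
  rw [h2] at h1
  have h3 : (n0 : ℝ) ≤ n := by exact_mod_cast hn
  rw [div_lt_iff₀ (by linarith)] at hn0
  have h4 : (n0 : ℝ) * (d - c) ≤ n * (d - c) := mul_le_mul_of_nonneg_right h3 (by linarith)
  nlinarith

lemma birk_upper {X : Type*} [MeasurableSpace X] {T : X → X} {μ : Measure X}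
    [IsProbabilityMeasure μ] (hT : Ergodic T μ) {h : X → ℝ} (hh : Measurable h) {C : ℝ}
    (hC : ∀ x, |h x| ≤ C) {c : ℝ} (hpos : ∫ x, h x ∂μ < c) :
    ∀ᵐ x ∂μ, ∀ᶠ n : ℕ in atTop, birkhoffSum T h n x < c * n := by
  have := birk_lower hT (h := -h) hh.neg (C := C) (fun x => by simpa using hC x) (c := -c)
    (by simp only [Pi.neg_apply]; rw [integral_neg]; linarith)
  filter_upwards [this] with x hx
  filter_upwards [hx] with n hn
  rw [birkhoffSum_neg] at hn
  linarith

lemma shift_iterate {A : Type*} (k : ℕ) (x : ℤ → A) : shift^[k] x = fun i => x (i + k) := by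
  induction k generalizing x with
  | zero => simp
  | succ k ih =>
    rw [Function.iterate_succ_apply, ih]
    funext i
    simp only [shift]
    congr 1
    push_cast
    ring

lemma shift_shiftInv {A : Type*} (x : ℤ → A) : shift (shiftInv x) = x := by
  funext i; simp [shift, shiftInv]

lemma shiftInv_shift {A : Type*} (x : ℤ → A) : shiftInv (shift x) = x := by
  funext i; simp [shift, shiftInv]

lemma measurable_shift {A : Type*} [MeasurableSpace A] : Measurable (shift : (ℤ → A) → (ℤ → A)) :=
  measurable_pi_lambda _ fun _ => measurable_pi_apply _

lemma measurable_shiftInv {A : Type*} [MeasurableSpace A] :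
    Measurable (shiftInv : (ℤ → A) → (ℤ → A)) :=
  measurable_pi_lambda _ fun _ => measurable_pi_apply _

/-- the i.i.d. measure -/
noncomputable def iidM {A : Type*} [MeasurableSpace A] (μ : Measure A) [IsProbabilityMeasure μ] :
    Measure (ℤ → A) := Measure.infinitePi (fun _ : ℤ => μ)

instance {A : Type*} [MeasurableSpace A] (μ : Measure A) [IsProbabilityMeasure μ] :
    IsProbabilityMeasure (iidM μ) := by unfold iidM; infer_instance

lemma iid_shift_mp {A : Type*} [MeasurableSpace A] (μ : Measure A) [IsProbabilityMeasure μ] :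
    MeasurePreserving shift (iidM μ) (iidM μ) := by
  refine ⟨measurable_shift, ?_⟩
  exact Measure.map_infinitePi_infinitePi_of_inj (P := fun _ : ℤ => μ)
    (f := fun i : ℤ => i + 1) (add_left_injective 1)

lemma iid_ergodic {A : Type*} [MeasurableSpace A] (μ : Measure A) [IsProbabilityMeasure μ] :
    Ergodic shift (iidM μ) := by
  have hmp := iid_shift_mp μ
  refine ⟨hmp, ⟨fun s hs hinv => ?_⟩⟩
  set P := iidM μ with hP
  have key : ∀ ε : ℝ, 0 < ε → |P.real s - P.real s ^ 2| ≤ 4 * ε := by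
    intro ε hε
    obtain ⟨t, htC, hts⟩ := exists_measure_symmDiff_lt_of_generateFrom_isSetRing (μ := P)
      (isSetRing_measurableCylinders (α := fun _ : ℤ => A))
      ⟨{Set.univ}, Set.countable_singleton _, by
        simpa using univ_mem_measurableCylinders (fun _ : ℤ => A), by simp⟩
      generateFrom_measurableCylinders.symm hs (ε := ENNReal.ofReal ε) (by simpa using hε)
    obtain ⟨I, S, hS, rfl⟩ := (mem_measurableCylinders _).1 htC
    have htm : MeasurableSet (cylinder (α := fun _ : ℤ => A) I S) := MeasurableSet.cylinder (α := fun _ : ℤ => A) I hS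
    have hts' : P.real (symmDiff (cylinder I S) s) ≤ ε :=
      ENNReal.toReal_le_of_le_ofReal hε.le hts.le
    -- choose k
    obtain ⟨k, hk⟩ : ∃ k : ℕ, Disjoint I (I.image (fun i : ℤ => i + k)) := by
      obtain ⟨m, hm⟩ : ∃ m : ℕ, ∀ i ∈ I, |i| ≤ m :=
        ⟨∑ i ∈ I, i.natAbs, fun i hi => by
          rw [Int.abs_eq_natAbs]
          exact_mod_cast Finset.single_le_sum (f := fun i : ℤ => i.natAbs) (by simp) hi⟩
      refine ⟨2 * m + 1, Finset.disjoint_left.2 fun i hi h2 => ?_⟩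
      obtain ⟨j, hj, rfl⟩ := Finset.mem_image.1 h2
      have h1 := abs_le.1 (hm _ hi)
      have h2 := abs_le.1 (hm _ hj)
      push_cast at h1
      omega
    set t' := shift^[k] ⁻¹' (cylinder I S) with ht'
    have hmpk := hmp.iterate k
    have ht'm : MeasurableSet t' := hmpk.measurable htm
    have hinvk : shift^[k] ⁻¹' s = s := by
      clear hk ht' t' ht'm hmpk
      induction k with
      | zero => simp
      | succ k ih => rw [Function.iterate_succ, Set.preimage_comp, ih, hinv]
    have ht's : P.real (symmDiff t' s) ≤ ε := by
      have : symmDiff t' s = shift^[k] ⁻¹' (symmDiff (cylinder I S) s) := by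
        rw [Set.preimage_symmDiff, hinvk]
      rw [this, measureReal_def, hmpk.measure_preimage (htm.symmDiff hs).nullMeasurableSet]
      exact hts'
    have hPt' : P.real t' = P.real (cylinder I S) := by
      rw [measureReal_def, hmpk.measure_preimage htm.nullMeasurableSet, measureReal_def]
    have hind : P.real (cylinder I S ∩ t') = P.real (cylinder I S) * P.real t' := by
      have h1 := ProbabilityTheory.iIndepFun_infinitePi (P := fun _ : ℤ => μ)
        (X := fun _ ω => ω) (fun _ => measurable_id)
      have h2 := h1.indepFun_finset I _ hk (fun i => measurable_pi_apply i)
      let g : (↥(I.image (fun i : ℤ => i + k)) → A) → (↥I → A) :=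
        fun y i => y ⟨i + k, Finset.mem_image_of_mem _ i.2⟩
      have hg : Measurable g := measurable_pi_lambda _ fun _ => measurable_pi_apply _
      have h3 := h2.measure_inter_preimage_eq_mul _ _ hS (hg hS)
      have e : t' = (fun (a : ℤ → A) (i : ↥(I.image (fun i : ℤ => i + k))) => a i) ⁻¹' (g ⁻¹' S) := by
        ext x
        simp only [t', Set.mem_preimage, mem_cylinder, shift_iterate]
        rfl
      rw [measureReal_def, measureReal_def, measureReal_def, ← ENNReal.toReal_mul]
      congr 1
      rw [e]
      exact h3
    have hA : |P.real (cylinder I S) - P.real s| ≤ ε :=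
      (abs_measureReal_sub_le_measureReal_symmDiff htm.nullMeasurableSet hs.nullMeasurableSet).trans hts'
    have hB : |P.real (cylinder I S ∩ t') - P.real s| ≤ 2 * ε := by
      refine (abs_measureReal_sub_le_measureReal_symmDiff (htm.inter ht'm).nullMeasurableSet hs.nullMeasurableSet).trans ?_
      calc P.real (symmDiff (cylinder I S ∩ t') s)
          ≤ P.real (symmDiff (cylinder I S) s ∪ symmDiff t' s) := by
            refine measureReal_mono ?_ (by finiteness)
            intro x hx
            simp only [Set.mem_symmDiff, Set.mem_union, Set.mem_inter_iff] at hx ⊢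
            tauto
        _ ≤ _ := by
            refine (measureReal_union_le _ _).trans (by linarith)
    rw [hind, hPt'] at hB
    have h01 : 0 ≤ P.real (cylinder I S) ∧ P.real (cylinder I S) ≤ 1 :=
      ⟨measureReal_nonneg, measureReal_le_one⟩
    have h02 : 0 ≤ P.real s ∧ P.real s ≤ 1 := ⟨measureReal_nonneg, measureReal_le_one⟩
    generalize P.real (cylinder I S) = a at *
    generalize P.real s = b at *
    rw [abs_le] at *
    constructor <;> nlinarith
  have h0 : P.real s - P.real s ^ 2 = 0 := by
    by_contra hne
    have h1 := key (|P.real s - P.real s ^ 2| / 8) (by positivity)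
    have : 0 < |P.real s - P.real s ^ 2| := abs_pos.2 hne
    linarith
  have h1 : P.real s * (1 - P.real s) = 0 := by linarith
  rw [Filter.eventuallyConst_set']
  rcases mul_eq_zero.1 h1 with h | h
  · left
    rw [measureReal_eq_zero_iff] at h
    rwa [ae_eq_empty]
  · right
    rw [ae_eq_univ, ← measureReal_eq_zero_iff, probReal_compl_eq_one_sub hs]
    linarith

/-- data for the involution -/
structure IData (A : Type*) where
  z : A
  b : A
  w : A → ℕ → A
  R : ℕ
  hzb : z ≠ b
  hwz : ∀ c s, ∃ j < R, w c (s + j) ≠ z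
  hwb : ∀ c s, ∃ j < R, w c (s + j) ≠ b

namespace IData
variable {A : Type*} (D : IData A)

lemma Rpos : 0 < D.R := by
  obtain ⟨j, hj, _⟩ := D.hwz D.z 0
  omega

def Tm (k : Bool) (c : A) (n j : ℕ) : A :=
  if k then
    (if j < D.R then D.z else if j = D.R then D.b else if j < n - D.R - 2 then D.w c (j - D.R - 1)
      else if j = n - D.R - 2 then D.b else D.z)
  else D.z

def Occ (y : ℤ → A) (i : ℤ) (n : ℕ) (k : Bool) : Prop :=
  2 * D.R + 3 ≤ n ∧ y (i - 1) ≠ D.z ∧ y (i + n) ≠ D.z ∧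
    ∀ j < n, y (i + j) = D.Tm k (y (i - 1)) n j

variable {D} {y : ℤ → A} {i i' : ℤ} {n n' : ℕ} {k k' : Bool}

lemma Occ.zero (h : D.Occ y i n false) (m : ℤ) (h1 : i ≤ m) (h2 : m < i + n) : y m = D.z := by
  have := h.2.2.2 (m - i).toNat (by omega)
  rw [show i + ((m - i).toNat : ℤ) = m by omega] at this
  simpa [Tm] using this

lemma Occ.val (h : D.Occ y i n k) (m : ℤ) (h1 : i ≤ m) (h2 : m < i + n) :
    y m = D.Tm k (y (i - 1)) n (m - i).toNat := by
  have := h.2.2.2 (m - i).toNat (by omega)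
  rwa [show i + ((m - i).toNat : ℤ) = m by omega] at this

lemma Occ.one1 (h : D.Occ y i n true) (m : ℤ) (h1 : i ≤ m) (h2 : m < i + D.R) : y m = D.z := by
  have h0 := h.1
  rw [h.val m h1 (by omega), Tm, if_pos rfl, if_pos (by omega)]

lemma Occ.one2 (h : D.Occ y i n true) : y (i + D.R) = D.b := by
  have h0 := h.1
  rw [h.val (i + D.R) (by omega) (by omega), Tm, if_pos rfl, if_neg (by omega), if_pos (by omega)]

lemma Occ.one3 (h : D.Occ y i n true) : y (i + n - D.R - 2) = D.b := by
  have h0 := h.1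
  rw [h.val _ (by omega) (by omega), Tm, if_pos rfl, if_neg (by omega), if_neg (by omega),
    if_neg (by omega), if_pos (by omega)]

lemma Occ.one4 (h : D.Occ y i n true) (m : ℤ) (h1 : i + n - D.R - 1 ≤ m) (h2 : m < i + n) :
    y m = D.z := by
  have h0 := h.1
  rw [h.val _ (by omega) (by omega), Tm, if_pos rfl, if_neg (by omega), if_neg (by omega),
    if_neg (by omega), if_neg (by omega)]

lemma Occ.one5 (h : D.Occ y i n true) (m : ℤ) (h1 : i + D.R < m) (h2 : m < i + n - D.R - 2) :
    y m = D.w (y (i - 1)) (m - i - D.R - 1).toNat := by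
  have h0 := h.1
  rw [h.val _ (by omega) (by omega), Tm, if_pos rfl, if_neg (by omega), if_neg (by omega),
    if_pos (by omega)]
  congr 1
  omega

lemma Occ.content (h : D.Occ y i n true) (q : A) (hq : ∀ c s, ∃ j < D.R, D.w c (s + j) ≠ q) (m : ℤ)
    (h1 : i + D.R < m) (h2 : m + D.R ≤ i + n - D.R - 2) :
    ∃ m', m ≤ m' ∧ m' < m + D.R ∧ y m' ≠ q := by
  obtain ⟨j, hj, hne⟩ := hq (y (i - 1)) (m - i - D.R - 1).toNat
  refine ⟨m + j, by omega, by omega, ?_⟩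
  rw [h.one5 _ (by omega) (by omega)]
  convert hne using 2
  omega

lemma Occ.first (h : D.Occ y i n k) : y i = D.z := by
  have h0 := h.1
  have := D.Rpos
  cases k
  · exact h.zero i le_rfl (by omega)
  · exact h.one1 i le_rfl (by omega)

lemma Occ.last (h : D.Occ y i n k) : y (i + n - 1) = D.z := by
  have h0 := h.1
  have := D.Rpos
  cases k
  · exact h.zero _ (by omega) (by omega)
  · exact h.one4 _ (by omega) (by omega)

/-- no run of `R` letters z strictly inside the middle part -/
lemma Occ.norun (h : D.Occ y i n true) (m : ℤ) (h1 : i + D.R < m) (h2 : m ≤ i + n - D.R - 2) :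
    ∃ m', m ≤ m' ∧ m' < m + D.R ∧ y m' ≠ D.z := by
  have := D.Rpos
  by_cases hc : m + D.R ≤ i + n - D.R - 2
  · exact h.content D.z D.hwz m h1 hc
  · exact ⟨i + n - D.R - 2, by omega, by omega, by rw [h.one3]; exact D.hzb.symm⟩

lemma Occ.n_le (h : D.Occ y i n k) (h' : D.Occ y i n' k') : k = k' ∧ n' ≤ n := by
  have h0 := h.1
  have h0' := h'.1
  have hR := D.Rpos
  have hz := D.hzb
  cases k <;> cases k'
  · refine ⟨rfl, ?_⟩
    by_contra hlt
    exact h.2.2.1 (h'.zero _ (by omega) (by omega))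
  · exact absurd ((h.zero (i + D.R) (by omega) (by omega)).symm.trans h'.one2) hz
  · exact absurd ((h'.zero (i + D.R) (by omega) (by omega)).symm.trans h.one2) hz
  · refine ⟨rfl, ?_⟩
    by_contra hlt
    have h3 : (n : ℤ) ≤ n' - D.R - 2 := by
      by_contra hh
      exact h.2.2.1 (h'.one4 _ (by omega) (by omega))
    obtain ⟨m', a1, a2, a3⟩ := h'.norun (i + n - D.R - 1) (by omega) (by omega)
    exact a3 (h.one4 _ a1 (by omega))

lemma Occ.start_eq (h : D.Occ y i n k) (h' : D.Occ y i' n' k') (h1 : i ≤ i') (h2 : i' < i + n) :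
    i = i' := by
  by_contra hne
  have hlt : i < i' := lt_of_le_of_ne h1 hne
  have h0 := h.1
  have h0' := h'.1
  have hR := D.Rpos
  have hz := D.hzb
  cases k
  · exact h'.2.1 (h.zero _ (by omega) (by omega))
  · have hzrun : ∀ m, i' ≤ m → m < i' + D.R → y m = D.z := by
      intro m a1 a2
      cases k'
      · exact h'.zero m a1 (by omega)
      · exact h'.one1 m a1 (by omega)
    rcases lt_trichotomy i' (i + D.R) with c | c | c
    · exact h'.2.1 (h.one1 _ (by omega) (by omega))
    · subst c
      exact hz (h'.first.symm.trans h.one2)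
    · by_cases c2 : i' ≤ i + n - D.R - 2
      · obtain ⟨m', a1, a2, a3⟩ := h.norun i' c c2
        exact a3 (hzrun _ a1 a2)
      · have c3 : i' = i + n - D.R - 1 := by
          by_contra c4
          exact h'.2.1 (h.one4 _ (by omega) (by omega))
        cases k'
        · exact h.2.2.1 (h'.zero _ (by omega) (by omega))
        · exact hz ((h.one4 (i' + D.R) (by omega) (by omega)).symm.trans h'.one2)

lemma Occ.unique (h : D.Occ y i n k) (h' : D.Occ y i' n' k') (h1 : i < i' + n') (h2 : i' < i + n) :
    i = i' ∧ n = n' ∧ k = k' := by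
  have : i = i' := by
    rcases le_total i i' with c | c
    · exact h.start_eq h' c h2
    · exact (h'.start_eq h c h1).symm
  subst this
  exact ⟨rfl, le_antisymm (h'.n_le h).2 (h.n_le h').2, (h.n_le h').1⟩

variable (D) in
/-- `m` lies in a region of `y` -/
def InReg (y : ℤ → A) (m : ℤ) : Prop := ∃ i n k, D.Occ y i n k ∧ i ≤ m ∧ m < i + n

lemma Occ.left_flank (h : D.Occ y i n k) : ¬ D.InReg y (i - 1) := by
  rintro ⟨i', n', k', h', h1, h2⟩
  have h0 := h.1
  by_cases c : i < i' + n'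
  · have := (h.unique h' c (by omega)).1
    omega
  · have : i' + n' = i := by omega
    exact h'.2.2.1 (this ▸ h.first)

lemma Occ.right_flank (h : D.Occ y i n k) : ¬ D.InReg y (i + n) := by
  rintro ⟨i', n', k', h', h1, h2⟩
  have h0 := h.1
  by_cases c : i' < i + n
  · have := (h.unique h' (by omega) c)
    omega
  · have : i' = i + n := by omega
    exact h.2.2.1 (this ▸ h'.first)

open Classical in
variable (D) in
noncomputable def Phi (y : ℤ → A) (m : ℤ) : A :=
  if h : ∃ q : ℤ × ℕ × Bool, D.Occ y q.1 q.2.1 q.2.2 ∧ q.1 ≤ m ∧ m < q.1 + q.2.1 then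
    D.Tm (!h.choose.2.2) (y (h.choose.1 - 1)) h.choose.2.1 (m - h.choose.1).toNat
  else y m

lemma Phi_not (h : ¬ D.InReg y m) : D.Phi y m = y m := by
  unfold Phi
  rw [dif_neg]
  rintro ⟨⟨i, n, k⟩, hq⟩
  exact h ⟨i, n, k, hq⟩

lemma Occ.Phi (h : D.Occ y i n k) {m : ℤ} (h1 : i ≤ m) (h2 : m < i + n) :
    D.Phi y m = D.Tm (!k) (y (i - 1)) n (m - i).toNat := by
  unfold IData.Phi
  have hex : ∃ q : ℤ × ℕ × Bool, D.Occ y q.1 q.2.1 q.2.2 ∧ q.1 ≤ m ∧ m < q.1 + q.2.1 :=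
    ⟨⟨i, n, k⟩, h, h1, h2⟩
  rw [dif_pos hex]
  have hs := hex.choose_spec
  obtain ⟨e1, e2, e3⟩ := hs.1.unique h (by omega) (by omega)
  rw [e1, e2, e3]

lemma Occ.Phi_left (h : D.Occ y i n k) : D.Phi y (i - 1) = y (i - 1) := Phi_not h.left_flank

lemma Occ.Phi_right (h : D.Occ y i n k) : D.Phi y (i + n) = y (i + n) := Phi_not h.right_flank

lemma Occ.toPhi (h : D.Occ y i n k) : D.Occ (D.Phi y) i n (!k) := by
  refine ⟨h.1, ?_, ?_, fun j hj => ?_⟩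
  · rw [h.Phi_left]; exact h.2.1
  · rw [h.Phi_right]; exact h.2.2.1
  · rw [h.Phi_left, h.Phi (by omega) (by omega)]
    congr 1
    omega

lemma Occ.ofPhi (h : D.Occ (D.Phi y) i n k) : D.Occ y i n (!k) := by
  by_cases hov : ∃ i' n' k', D.Occ y i' n' k' ∧ i < i' + (n' : ℤ) ∧ i' < i + n
  · obtain ⟨i', n', k', h', h1, h2⟩ := hov
    obtain ⟨e1, e2, e3⟩ := h.unique h'.toPhi h1 h2
    subst e1 e2 e3
    simpa using h'
  · exfalso
    have h0 := h.1
    have hnr : ∀ m, i ≤ m → m < i + n → D.Phi y m = y m := by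
      intro m h1 h2
      apply Phi_not
      rintro ⟨i', n', k', h', h3, h4⟩
      exact hov ⟨i', n', k', h', by omega, by omega⟩
    have hl : D.Phi y (i - 1) = y (i - 1) := by
      apply Phi_not
      rintro ⟨i', n', k', h', h3, h4⟩
      exact h.left_flank ⟨i', n', _, h'.toPhi, h3, h4⟩
    have hr : D.Phi y (i + n) = y (i + n) := by
      apply Phi_not
      rintro ⟨i', n', k', h', h3, h4⟩
      exact h.right_flank ⟨i', n', _, h'.toPhi, h3, h4⟩
    apply hov
    refine ⟨i, n, k, ⟨h0, ?_, ?_, fun j hj => ?_⟩, by omega, by omega⟩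
    · rw [← hl]; exact h.2.1
    · rw [← hr]; exact h.2.2.1
    · rw [← hnr _ (by omega) (by omega), ← hl]
      exact h.2.2.2 j hj

lemma Phi_Phi (y : ℤ → A) : D.Phi (D.Phi y) = y := by
  funext m
  by_cases hm : D.InReg y m
  · obtain ⟨i, n, k, h, h1, h2⟩ := hm
    rw [h.toPhi.Phi h1 h2, h.Phi_left, Bool.not_not, ← h.val m h1 h2]
  · have : ¬ D.InReg (D.Phi y) m := by
      rintro ⟨i, n, k, h, h1, h2⟩
      exact hm ⟨i, n, _, h.ofPhi, h1, h2⟩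
    rw [Phi_not this, Phi_not hm]

lemma occ_shift : D.Occ (shift y) i n k ↔ D.Occ y (i + 1) n k := by
  unfold Occ
  simp only [shift]
  rw [show i - 1 + 1 = i + 1 - 1 by ring, show i + (n : ℤ) + 1 = i + 1 + n by ring]
  simp only [show ∀ j : ℕ, i + (j : ℤ) + 1 = i + 1 + j by intro j; ring]

lemma Phi_shift (y : ℤ → A) : D.Phi (shift y) = shift (D.Phi y) := by
  funext m
  change _ = D.Phi y (m + 1)
  by_cases hm : D.InReg (shift y) m
  · obtain ⟨i, n, k, h, h1, h2⟩ := hm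
    rw [h.Phi h1 h2, (occ_shift.1 h).Phi (by omega) (by omega)]
    simp only [shift]
    congr 1
    · congr 1; ring
    · omega
  · have : ¬ D.InReg y (m + 1) := by
      rintro ⟨i, n, k, h, h1, h2⟩
      refine hm ⟨i - 1, n, k, occ_shift.2 (by simpa using h), by omega, by omega⟩
    rw [Phi_not this, Phi_not hm]
    rfl

/-- a window of `R+2` letters `b` -/
def BW (D : IData A) (y : ℤ → A) (l : ℤ) : Prop := ∀ m, l ≤ m → m < l + D.R + 2 → y m = D.b

lemma BW.not_inReg {l : ℤ} (h : D.BW y l) (m : ℤ) (h1 : l ≤ m) (h2 : m < l + D.R + 2) :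
    ¬ D.InReg y m := by
  rintro ⟨i, n, k, ho, h3, h4⟩
  have h0 := ho.1
  have hR := D.Rpos
  have hz := D.hzb
  have c1 : i < l := by
    by_contra c
    exact hz (ho.first.symm.trans (h i (by omega) (by omega)))
  have c2 : l + D.R + 2 ≤ i + n - 1 := by
    by_contra c
    exact hz (ho.last.symm.trans (h _ (by omega) (by omega)))
  cases k
  · exact hz ((ho.zero l (by omega) (by omega)).symm.trans (h l (by omega) (by omega)))
  · have d1 : i + D.R ≤ l := by
      by_contra d
      exact hz ((ho.one1 l (by omega) (by omega)).symm.trans (h l (by omega) (by omega)))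
    have d2 : l + D.R + 1 ≤ i + n - D.R - 2 := by
      by_contra d
      exact hz ((ho.one4 (l + D.R + 1) (by omega) (by omega)).symm.trans (h _ (by omega) (by omega)))
    obtain ⟨m', a1, a2, a3⟩ := ho.content D.b D.hwb (l + 1) (by omega) (by omega)
    exact a3 (h _ (by omega) (by omega))

lemma BW.Phi {l : ℤ} (h : D.BW y l) : D.BW (D.Phi y) l := by
  intro m h1 h2
  rw [Phi_not (h.not_inReg m h1 h2)]
  exact h m h1 h2

lemma bw_Phi_iff {l : ℤ} : D.BW (D.Phi y) l ↔ D.BW y l :=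
  ⟨fun h => by simpa [Phi_Phi] using h.Phi, fun h => h.Phi⟩

lemma Occ.congr {y' : ℤ → A} {l r : ℤ} (hl : D.BW y l) (hr : D.BW y r)
    (hy : ∀ m, l ≤ m → m < r + D.R + 2 → y' m = y m) {m : ℤ} (hlm : l ≤ m) (hmr : m < r + D.R + 2)
    (h : D.Occ y i n k) (h1 : i ≤ m) (h2 : m < i + n) :
    D.Occ y' i n k ∧ y' (i - 1) = y (i - 1) := by
  have h0 := h.1
  have d1 : l < i := by
    by_contra d
    exact hl.not_inReg l le_rfl (by omega) ⟨i, n, k, h, by omega, by omega⟩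
  have d2 : i + n ≤ r := by
    by_contra d
    have d3 : m < r := by
      by_contra d4
      exact hr.not_inReg m (by omega) (by omega) ⟨i, n, k, h, by omega, by omega⟩
    exact hr.not_inReg r le_rfl (by omega) ⟨i, n, k, h, by omega, by omega⟩
  have e1 := hy (i - 1) (by omega) (by omega)
  refine ⟨⟨h0, ?_, ?_, fun j hj => ?_⟩, e1⟩
  · rw [e1]; exact h.2.1
  · rw [hy _ (by omega) (by omega)]; exact h.2.2.1
  · rw [e1, hy _ (by omega) (by omega)]; exact h.2.2.2 j hj

lemma Phi_congr {y' : ℤ → A} {l r : ℤ} (hl : D.BW y l) (hr : D.BW y r)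
    (hy : ∀ m, l ≤ m → m < r + D.R + 2 → y' m = y m) {m : ℤ} (hlm : l ≤ m) (hmr : m < r + D.R + 2)
    (hlr : l ≤ r) :
    D.Phi y' m = D.Phi y m := by
  by_cases hm : D.InReg y m
  · obtain ⟨i, n, k, h, h1, h2⟩ := hm
    obtain ⟨h', e⟩ := h.congr hl hr hy hlm hmr h1 h2
    rw [h.Phi h1 h2, h'.Phi h1 h2, e]
  · have hm' : ¬ D.InReg y' m := by
      rintro ⟨i, n, k, h, h1, h2⟩
      refine hm ⟨i, n, k, (h.congr (D := D) (y' := y) (l := l) (r := r) ?_ ?_ ?_ hlm hmr h1 h2).1, h1, h2⟩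
      · intro q a1 a2; rw [hy q a1 (by omega)]; exact hl q a1 a2
      · intro q a1 a2; rw [hy q (by omega) a2]; exact hr q a1 a2
      · intro q a1 a2; exact (hy q a1 a2).symm
    rw [Phi_not hm, Phi_not hm', hy m hlm hmr]

lemma measurable_Phi [Fintype A] [MeasurableSpace A] [DiscreteMeasurableSpace A] :
    Measurable (D.Phi) := by
  have hpair : ∀ (a c : ℤ) (p : A → A → Prop), MeasurableSet {y : ℤ → A | p (y a) (y c)} := by
    intro a c p
    have : Measurable (fun y : ℤ → A => (y a, y c)) :=
      (measurable_pi_apply a).prodMk (measurable_pi_apply c)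
    exact this (MeasurableSet.of_discrete (s := {q : A × A | p q.1 q.2}))
  have hocc : ∀ i n k, MeasurableSet {y : ℤ → A | D.Occ y i n k} := by
    intro i n k
    have : {y : ℤ → A | D.Occ y i n k} = {y | 2 * D.R + 3 ≤ n} ∩ ({y | y (i - 1) ≠ D.z} ∩
        ({y | y (i + n) ≠ D.z} ∩ ⋂ j : ℕ, {y | j < n → y (i + j) = D.Tm k (y (i - 1)) n j})) := by
      ext y; simp [Occ]
    rw [this]
    refine MeasurableSet.inter (MeasurableSet.const _) (MeasurableSet.inter (hpair (i-1) (i-1) fun a _ => a ≠ D.z) (MeasurableSet.inter (hpair (i+n) (i+n) fun a _ => a ≠ D.z) ?_))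
    refine MeasurableSet.iInter fun j => ?_
    exact hpair (i + j) (i - 1) fun a c => j < n → a = D.Tm k c n j
  refine measurable_pi_lambda _ fun m => ?_
  refine measurable_to_countable' fun c => ?_
  have : (fun y => D.Phi y m) ⁻¹' {c} =
      (⋃ q : ℤ × ℕ × Bool, ({y | D.Occ y q.1 q.2.1 q.2.2} ∩ {y | q.1 ≤ m ∧ m < q.1 + q.2.1}) ∩
        {y | D.Tm (!q.2.2) (y (q.1 - 1)) q.2.1 (m - q.1).toNat = c}) ∪
      ((⋃ q : ℤ × ℕ × Bool, ({y | D.Occ y q.1 q.2.1 q.2.2} ∩ {y | q.1 ≤ m ∧ m < q.1 + q.2.1}))ᶜ ∩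
        {y | y m = c}) := by
    ext y
    simp only [Set.mem_preimage, Set.mem_singleton_iff, Set.mem_union, Set.mem_iUnion,
      Set.mem_inter_iff, Set.mem_ofPred_eq, Set.mem_compl_iff]
    by_cases hm : D.InReg y m
    · obtain ⟨i, n, k, h, h1, h2⟩ := hm
      rw [h.Phi h1 h2]
      constructor
      · intro e
        exact Or.inl ⟨⟨i, n, k⟩, ⟨h, h1, h2⟩, e⟩
      · rintro (⟨⟨i', n', k'⟩, ⟨h', h1', h2'⟩, e⟩ | ⟨h', _⟩)
        · obtain ⟨rfl, rfl, rfl⟩ := h.unique h' (by simp only at *; omega) (by simp only at *; omega)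
          exact e
        · exact absurd ⟨⟨i, n, k⟩, ⟨h, h1, h2⟩⟩ h'
    · rw [Phi_not hm]
      constructor
      · intro e
        refine Or.inr ⟨?_, e⟩
        rintro ⟨⟨i, n, k⟩, h, h1⟩
        exact hm ⟨i, n, k, h, h1⟩
      · rintro (⟨⟨i', n', k'⟩, ⟨h', h1'⟩, e⟩ | ⟨h', e⟩)
        · exact absurd ⟨i', n', k', h', h1'⟩ hm
        · exact e
  rw [this]
  have hU : ∀ q : ℤ × ℕ × Bool, MeasurableSet ({y : ℤ → A | D.Occ y q.1 q.2.1 q.2.2} ∩ {y | q.1 ≤ m ∧ m < q.1 + q.2.1}) :=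
    fun q => (hocc _ _ _).inter (MeasurableSet.const _)
  refine MeasurableSet.union (MeasurableSet.iUnion fun q => (hU q).inter (hpair (q.1 - 1) (q.1 - 1) fun a _ => D.Tm (!q.2.2) a q.2.1 (m - q.1).toNat = c)) ?_
  exact (MeasurableSet.iUnion hU).compl.inter (hpair m m fun a _ => a = c)

end IData

/-! generic: finite-window sets -/

lemma fin_dep_factor {A : Type*} (s : Finset ℤ) (p : (ℤ → A) → Prop)
    (hp : ∀ y y' : ℤ → A, (∀ m ∈ s, y m = y' m) → p y → p y') :
    {y | p y} = (fun (y : ℤ → A) (i : s) => y i) ⁻¹'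
      {q | ∃ y : ℤ → A, p y ∧ ∀ i : s, y i = q i} := by
  ext y
  simp only [Set.mem_ofPred_eq, Set.mem_preimage]
  constructor
  · intro h; exact ⟨y, h, fun _ => rfl⟩
  · rintro ⟨y', h, e⟩
    exact hp y' y (fun m hm => e ⟨m, hm⟩) h

lemma fin_dep_measurable {A : Type*} [Fintype A] [MeasurableSpace A] [DiscreteMeasurableSpace A]
    (s : Finset ℤ) (p : (ℤ → A) → Prop)
    (hp : ∀ y y' : ℤ → A, (∀ m ∈ s, y m = y' m) → p y → p y') : MeasurableSet {y | p y} := by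
  rw [fin_dep_factor s p hp]
  have : Measurable (fun (y : ℤ → A) (i : s) => y i) :=
    measurable_pi_lambda _ fun i => measurable_pi_apply _
  exact this (Set.Finite.measurableSet (Set.toFinite _))

lemma fin_dep_open {A : Type*} [TopologicalSpace A] [DiscreteTopology A]
    (s : Finset ℤ) (p : (ℤ → A) → Prop)
    (hp : ∀ y y' : ℤ → A, (∀ m ∈ s, y m = y' m) → p y → p y') : IsOpen {y | p y} := by
  rw [fin_dep_factor s p hp]
  have : Continuous (fun (y : ℤ → A) (i : s) => y i) :=
    continuous_pi fun i => continuous_apply _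
  exact this.isOpen_preimage _ (isOpen_discrete _)

lemma fin_dep_clopen {A : Type*} [TopologicalSpace A] [DiscreteTopology A]
    (s : Finset ℤ) (p : (ℤ → A) → Prop)
    (hp : ∀ y y' : ℤ → A, (∀ m ∈ s, y m = y' m) → p y → p y') : IsClopen {y | p y} := by
  refine ⟨⟨?_⟩, fin_dep_open s p hp⟩
  exact fin_dep_open s (fun y => ¬ p y) fun y y' h hn hy' => hn (hp y' y (fun m hm => (h m hm).symm) hy')

/-- segments of bi-infinite words -/
def seg {α : Type*} (y : ℤ → α) (i : ℤ) (n : ℕ) : List α := (List.range n).map fun t : ℕ => y (i + (t : ℤ))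

lemma seg_zero {α : Type*} (y : ℤ → α) (i : ℤ) : seg y i 0 = [] := rfl

lemma seg_succ {α : Type*} (y : ℤ → α) (i : ℤ) (n : ℕ) :
    seg y i (n + 1) = seg y i n ++ [y (i + n)] := by
  simp [seg, List.range_succ]

lemma seg_add {α : Type*} (y : ℤ → α) (i : ℤ) (n m : ℕ) :
    seg y i (n + m) = seg y i n ++ seg y (i + n) m := by
  induction m with
  | zero => simp [seg_zero]
  | succ m ih => rw [← Nat.add_assoc, seg_succ, ih, seg_succ, List.append_assoc]; simp [add_assoc]

lemma seg_congr {α : Type*} {y y' : ℤ → α} {i i' : ℤ} {n : ℕ}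
    (h : ∀ t : ℕ, t < n → y (i + t) = y' (i' + t)) : seg y i n = seg y' i' n := by
  unfold seg
  exact List.map_congr_left fun t ht => h t (List.mem_range.1 ht)

lemma seg_map {α β : Type*} (f : α → β) (y : ℤ → α) (i : ℤ) (n : ℕ) :
    seg (fun m => f (y m)) i n = (seg y i n).map f := by
  simp [seg]

lemma seg_length {α : Type*} (y : ℤ → α) (i : ℤ) (n : ℕ) : (seg y i n).length = n := by simp [seg]

inductive BSym (M N : ℕ) : Type where
  | la : Fin M → BSym M N
  | u  : Fin N → BSym M N
  | ra : BSym M N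
deriving DecidableEq

namespace BSym

def equivSum (M N : ℕ) : BSym M N ≃ (Fin M ⊕ Fin N ⊕ Unit) where
  toFun s := match s with
    | .la k => Sum.inl k
    | .u k => Sum.inr (Sum.inl k)
    | .ra => Sum.inr (Sum.inr ())
  invFun s := match s with
    | Sum.inl k => .la k
    | Sum.inr (Sum.inl k) => .u k
    | Sum.inr (Sum.inr _) => .ra
  left_inv s := by cases s <;> rfl
  right_inv s := by rcases s with k | k | k <;> rfl

instance (M N : ℕ) : Fintype (BSym M N) := Fintype.ofEquiv _ (equivSum M N).symm
instance (M N : ℕ) : TopologicalSpace (BSym M N) := ⊥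
instance (M N : ℕ) : DiscreteTopology (BSym M N) := ⟨rfl⟩
instance (M N : ℕ) : MeasurableSpace (BSym M N) := ⊤
instance (M N : ℕ) : DiscreteMeasurableSpace (BSym M N) := ⟨fun _ => trivial⟩
instance (M N : ℕ) : BorelSpace (BSym M N) := ⟨borel_eq_top_of_discrete.symm⟩
instance (M N : ℕ) : Nonempty (BSym M N) := ⟨.ra⟩

end BSym

instance (M N : ℕ) : DiscreteMeasurableSpace (DMSym M N) := ⟨fun _ => trivial⟩

section Decode
variable {M N : ℕ}

def kap : DMSym M N → BSym M N
  | .la k => .la k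
  | .u k => .u k
  | .ra _ => .ra

def stkStep : List (Fin M) → BSym M N → List (Fin M)
  | s, .la k => k :: s
  | s, .u _ => s
  | s, .ra => s.tail

def stk (l : List (BSym M N)) : List (Fin M) := l.foldl stkStep []

lemma stk_append_single (l : List (BSym M N)) (c : BSym M N) : stk (l ++ [c]) = stkStep (stk l) c := by
  simp [stk]

lemma stkF_drop (l : List (BSym M N)) :
    ∃ d, ∀ s, l.foldl stkStep s = stk l ++ s.drop d := by
  induction l using List.reverseRecOn with
  | nil => exact ⟨0, fun s => by simp [stk]⟩
  | append_singleton l c ih =>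
    obtain ⟨d, hd⟩ := ih
    cases c with
    | la k => exact ⟨d, fun s => by rw [stk_append_single, List.foldl_append, hd]; simp [stkStep]⟩
    | u k => exact ⟨d, fun s => by rw [stk_append_single, List.foldl_append, hd]; simp [stkStep]⟩
    | ra =>
      cases hs : stk l with
      | nil => exact ⟨d + 1, fun s => by
          rw [stk_append_single, List.foldl_append, hd, hs]; simp [stkStep]⟩
      | cons a t => exact ⟨d, fun s => by
          rw [stk_append_single, List.foldl_append, hd, hs]; simp [stkStep]⟩

lemma stk_append (l1 l2 : List (BSym M N)) :
    ∃ d, stk (l1 ++ l2) = stk l2 ++ (stk l1).drop d := by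
  obtain ⟨d, hd⟩ := stkF_drop l2
  exact ⟨d, by rw [stk, List.foldl_append]; exact hd _⟩

/-- top of the stack seen from `j` looking back `n` -/
def topS (y : ℤ → BSym M N) (j : ℤ) (n : ℕ) : Option (Fin M) := (stk (seg y (j - n) n)).head?

lemma topS_mono {y : ℤ → BSym M N} {j : ℤ} {n n' : ℕ} (h : n ≤ n') {k : Fin M}
    (hk : topS y j n = some k) : topS y j n' = some k := by
  obtain ⟨m, rfl⟩ := Nat.exists_eq_add_of_le h
  unfold topS at *
  rw [Nat.add_comm, seg_add]
  obtain ⟨d, hd⟩ := stk_append (seg y (j - (m + n : ℕ)) m) (seg y (j - (m + n : ℕ) + m) n)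
  rw [hd, show j - ((m + n : ℕ) : ℤ) + m = j - n by push_cast; ring]
  cases hs : stk (seg y (j - n) n) with
  | nil => simp [hs] at hk
  | cons a t => simpa [hs] using hk

lemma topS_unique {y : ℤ → BSym M N} {j : ℤ} {n n' : ℕ} {k k' : Fin M}
    (hk : topS y j n = some k) (hk' : topS y j n' = some k') : k = k' := by
  have h1 := topS_mono (le_max_left n n') hk
  have h2 := topS_mono (le_max_right n n') hk'
  rw [h1] at h2
  exact Option.some.inj h2

def Matched (y : ℤ → BSym M N) (j : ℤ) : Prop := ∃ n k, topS y j n = some k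

def AllM (y : ℤ → BSym M N) : Prop := ∀ j, y j = .ra → Matched y j

lemma matched_of_ne {y : ℤ → BSym M N} {j : ℤ} {n : ℕ} (h : stk (seg y (j - n) n) ≠ []) :
    Matched y j := by
  refine ⟨n, (stk (seg y (j - n) n)).head h, ?_⟩
  simp [topS, List.head?_eq_some_head h]

open Classical in
noncomputable def labl [NeZero M] (y : ℤ → BSym M N) (j : ℤ) : Fin M :=
  if h : ∃ k n, topS y j n = some k then h.choose else 0

lemma labl_eq [NeZero M] {y : ℤ → BSym M N} {j : ℤ} {n : ℕ} {k : Fin M} (h : topS y j n = some k) :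
    labl y j = k := by
  have hex : ∃ k n, topS y j n = some k := ⟨k, n, h⟩
  rw [labl, dif_pos hex]
  obtain ⟨n', hn'⟩ := hex.choose_spec
  exact topS_unique hn' h

noncomputable def psi [NeZero M] (y : ℤ → BSym M N) (j : ℤ) : DMSym M N :=
  match y j with
  | .la k => .la k
  | .u k => .u k
  | .ra => .ra (labl y j)

lemma kap_psi [NeZero M] (y : ℤ → BSym M N) (j : ℤ) : kap (psi y j) = y j := by
  unfold psi
  cases y j <;> rfl

lemma wordAt_eq_seg (x : ℤ → DMSym M N) (j k : ℤ) : wordAt x j k = seg x j (k + 1 - j).toNat := by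
  simp only [wordAt, seg, List.bind_eq_flatMap, List.pure_def, ← List.map_eq_flatMap, List.map_map, Function.comp_def]

lemma red_append_single (l : List (DMSym M N)) (c : DMSym M N) :
    red (l ++ [c]) = dyckStep (red l) c := by simp [red]

lemma red_append_none (l l' : List (DMSym M N)) (h : red l = none) : red (l ++ l') = none := by
  unfold red at *
  rw [List.foldl_append, h]
  induction l' with
  | nil => rfl
  | cons a t ih => simpa [dyckStep] using ih

lemma mem_SigmaD_iff (x : ℤ → DMSym M N) : x ∈ SigmaD M N ↔ ∀ i n, red (seg x i n) ≠ none := by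
  constructor
  · intro h i n hn
    have := h i (i + n + 1) (by omega)
    apply this
    rw [wordAt_eq_seg, show (i + n + 1 + 1 - i).toNat = n + 2 by omega, seg_add]
    exact red_append_none _ _ hn
  · intro h j k _
    rw [wordAt_eq_seg]
    exact h _ _

lemma psi_red [NeZero M] (y : ℤ → BSym M N) (i : ℤ) (n : ℕ) :
    ∃ bs as, red (seg (psi y) i n) = some (bs, as) ∧ as.reverse = stk (seg y i n) := by
  induction n with
  | zero => exact ⟨[], [], rfl, rfl⟩
  | succ n ih =>
    obtain ⟨bs, as, h1, h2⟩ := ih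
    rw [seg_succ, seg_succ, red_append_single, stk_append_single, h1]
    cases hy : y (i + n) with
    | la k => exact ⟨bs, as ++ [k], by simp [psi, hy, dyckStep], by simp [stkStep, h2]⟩
    | u k => exact ⟨bs, as, by simp [psi, hy, dyckStep], by simp [stkStep, h2]⟩
    | ra =>
      have hpsi : psi y (i + n) = .ra (labl y (i + n)) := by simp [psi, hy]
      rw [hpsi]
      rcases List.eq_nil_or_concat as with rfl | ⟨as', a, rfl⟩
      · refine ⟨bs ++ [labl y (i + n)], [], by simp [dyckStep], ?_⟩
        simp at h2
        simp [h2, stkStep]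
      · refine ⟨bs, as', ?_, ?_⟩
        · have : labl y (i + n) = a := by
            apply labl_eq (n := n)
            unfold topS
            rw [show i + (n : ℤ) - n = i by ring, ← h2]
            simp
          simp [dyckStep, this]
        · rw [← h2]; simp [stkStep]

lemma psi_mem [NeZero M] (y : ℤ → BSym M N) : psi y ∈ SigmaD M N := by
  rw [mem_SigmaD_iff]
  intro i n h
  obtain ⟨bs, as, h1, _⟩ := psi_red y i n
  rw [h1] at h
  exact absurd h (by simp)

lemma red_stk (l : List (DMSym M N)) {bs as} (h : red l = some (bs, as)) :
    as.reverse = stk (l.map kap) := by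
  induction l using List.reverseRecOn generalizing bs as with
  | nil => simp [red] at h; simp [h.2, stk]
  | append_singleton l c ih =>
    rw [red_append_single] at h
    rw [List.map_append, List.map_singleton, stk_append_single]
    cases hr : red l with
    | none => rw [hr] at h; simp [dyckStep] at h
    | some q =>
      obtain ⟨bs', as'⟩ := q
      have ih' := ih hr
      rw [← ih']
      rw [hr] at h
      cases c with
      | la k =>
        simp [dyckStep] at h
        simp [kap, stkStep, ← h.2]
      | u k =>
        simp [dyckStep] at h
        simp [kap, stkStep, ← h.2]
      | ra k =>
        rcases List.eq_nil_or_concat as' with rfl | ⟨t, a, rfl⟩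
        · simp [dyckStep] at h
          simp [kap, stkStep, h.2]
        · simp [dyckStep] at h
          simp [kap, stkStep, ← h.2.2]

/-- collapse on sequences -/
def kapS (x : ℤ → DMSym M N) : ℤ → BSym M N := fun i => kap (x i)

lemma kapS_psi [NeZero M] (y : ℤ → BSym M N) : kapS (psi y) = y := by
  funext j; exact kap_psi y j

lemma psi_kapS_at [NeZero M] {x : ℤ → DMSym M N} (hx : x ∈ SigmaD M N) (j : ℤ)
    (h : kapS x j = .ra → Matched (kapS x) j) : psi (kapS x) j = x j := by
  cases hxj : x j with
  | la k => simp [psi, kapS, hxj, kap]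
  | u k => simp [psi, kapS, hxj, kap]
  | ra k =>
    have hk : kapS x j = .ra := by simp [kapS, hxj, kap]
    obtain ⟨n, k', hn⟩ := h hk
    have hl := labl_eq hn
    have : psi (kapS x) j = .ra k' := by simp [psi, hk, hl]
    rw [this]
    congr 1
    have h1 := (mem_SigmaD_iff x).1 hx (j - n) (n + 1)
    rw [seg_succ, red_append_single, show j - (n : ℤ) + n = j by ring, hxj] at h1
    cases hr : red (seg x (j - n) n) with
    | none => rw [hr] at h1; simp [dyckStep] at h1
    | some q =>
      obtain ⟨bs, as⟩ := q
      have h2 := red_stk _ hr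
      unfold topS at hn
      unfold kapS at hn
      rw [seg_map, ← h2] at hn
      rw [List.head?_reverse] at hn
      rw [hr] at h1
      simp only [dyckStep, hn] at h1
      by_contra hne
      rw [if_neg hne] at h1
      exact h1 rfl

lemma psi_kapS [NeZero M] {x : ℤ → DMSym M N} (hx : x ∈ SigmaD M N) (h : AllM (kapS x)) :
    psi (kapS x) = x := funext fun j => psi_kapS_at hx j (h j)

/-- height -/
def hB : BSym M N → ℤ
  | .la _ => 1
  | .u _ => 0
  | .ra => -1

lemma hB_le_stk (l : List (BSym M N)) : (l.map hB).sum ≤ (stk l).length := by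
  induction l using List.reverseRecOn with
  | nil => simp [stk]
  | append_singleton l c ih =>
    rw [stk_append_single]
    cases c <;> simp [stkStep, hB] <;> omega

lemma matched_of_sum_pos {y : ℤ → BSym M N} {j : ℤ} {n : ℕ}
    (h : 0 < ((seg y (j - n) n).map hB).sum) : Matched y j := by
  refine matched_of_ne (n := n) fun h0 => ?_
  have := hB_le_stk (seg y (j - n) n)
  rw [h0] at this
  simp at this
  omega

lemma psi_congr [NeZero M] {y y' : ℤ → BSym M N} {j : ℤ} {n : ℕ}
    (hm : y j = .ra → ∃ k, topS y j n = some k)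
    (h : ∀ m, j - n ≤ m → m ≤ j → y' m = y m) : psi y' j = psi y j := by
  have hj := h j (by omega) le_rfl
  cases hy : y j with
  | la k => simp [psi, hj, hy]
  | u k => simp [psi, hj, hy]
  | ra =>
    obtain ⟨k, hk⟩ := hm hy
    have hk' : topS y' j n = some k := by
      rw [← hk]; unfold topS
      rw [seg_congr fun t ht => h _ (by omega) (by omega)]
    simp [psi, hj, hy, labl_eq hk, labl_eq hk']

lemma seg_shift {α : Type*} (y : ℤ → α) (i : ℤ) (n : ℕ) : seg (shift y) i n = seg y (i + 1) n :=
  seg_congr fun t _ => by simp only [shift]; congr 1; ring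

lemma topS_shift (y : ℤ → BSym M N) (j : ℤ) (n : ℕ) : topS (shift y) j n = topS y (j + 1) n := by
  unfold topS
  rw [seg_shift, show j - (n : ℤ) + 1 = j + 1 - n by ring]

lemma matched_shift (y : ℤ → BSym M N) (j : ℤ) : Matched (shift y) j ↔ Matched y (j + 1) := by
  unfold Matched
  simp only [topS_shift]

lemma psi_shift [NeZero M] (y : ℤ → BSym M N) : psi (shift y) = shift (psi y) := by
  funext j
  have : labl (shift y) j = labl y (j + 1) := by
    by_cases h : ∃ k n, topS y (j + 1) n = some k
    · obtain ⟨k, n, hk⟩ := h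
      rw [labl_eq hk, labl_eq ((topS_shift y j n).trans hk)]
    · have h' : ¬ ∃ k n, topS (shift y) j n = some k := by
        simpa only [topS_shift] using h
      rw [labl, labl, dif_neg h, dif_neg h']
  simp only [psi, shift, this] at *

lemma topS_set_measurable (j : ℤ) (n : ℕ) (o : Option (Fin M)) :
    MeasurableSet {y : ℤ → BSym M N | topS y j n = o} := by
  refine fin_dep_measurable (Finset.Ico (j - n) j) _ fun y y' h hy => ?_
  rw [← hy]
  unfold topS
  rw [seg_congr fun t ht => (h _ (Finset.mem_Ico.2 ⟨by omega, by omega⟩)).symm]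

lemma matched_measurable (j : ℤ) : MeasurableSet {y : ℤ → BSym M N | Matched y j} := by
  have : {y : ℤ → BSym M N | Matched y j} = ⋃ n, ⋃ k, {y | topS y j n = some k} := by
    ext y; simp [Matched]
  rw [this]
  exact MeasurableSet.iUnion fun n => MeasurableSet.iUnion fun k => topS_set_measurable j n _

lemma eval_set_measurable {A : Type*} [MeasurableSpace A] [DiscreteMeasurableSpace A] (j : ℤ)
    (p : A → Prop) : MeasurableSet {y : ℤ → A | p (y j)} :=
  measurable_pi_apply j (MeasurableSet.of_discrete (s := {a | p a}))

lemma allM_measurable : MeasurableSet {y : ℤ → BSym M N | AllM y} := by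
  have : {y : ℤ → BSym M N | AllM y} = ⋂ j, ({y | ¬ y j = .ra} ∪ {y | Matched y j}) := by
    ext y; simp [AllM, imp_iff_not_or]
  rw [this]
  exact MeasurableSet.iInter fun j => (eval_set_measurable j fun a => ¬ a = .ra).union
    (matched_measurable j)

lemma labl_measurable [NeZero M] (j : ℤ) : Measurable fun y : ℤ → BSym M N => labl y j := by
  refine measurable_to_countable' fun k => ?_
  have : (fun y : ℤ → BSym M N => labl y j) ⁻¹' {k} =
      (⋃ n, {y | topS y j n = some k}) ∪ ({y | Matched y j}ᶜ ∩ {_y | (0 : Fin M) = k}) := by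
    ext y
    simp only [Set.mem_preimage, Set.mem_singleton_iff, Set.mem_union, Set.mem_iUnion,
      Set.mem_inter_iff, Set.mem_compl_iff, Set.mem_ofPred_eq]
    by_cases h : Matched y j
    · obtain ⟨n, k', hn⟩ := h
      rw [labl_eq hn]
      constructor
      · rintro rfl; exact Or.inl ⟨n, hn⟩
      · rintro (⟨n', h'⟩ | ⟨h', _⟩)
        · exact topS_unique hn h'
        · exact absurd ⟨n, k', hn⟩ h'
    · have h0 : ¬ ∃ k n, topS y j n = some k := fun ⟨k, n, hh⟩ => h ⟨n, k, hh⟩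
      rw [labl, dif_neg h0]
      constructor
      · intro e; exact Or.inr ⟨h, e⟩
      · rintro (⟨n', h'⟩ | ⟨_, e⟩)
        · exact absurd ⟨k, n', h'⟩ h0
        · exact e
  rw [this]
  exact (MeasurableSet.iUnion fun n => topS_set_measurable j n _).union
    ((matched_measurable j).compl.inter (MeasurableSet.const _))

lemma psi_measurable [NeZero M] : Measurable (psi : (ℤ → BSym M N) → (ℤ → DMSym M N)) := by
  refine measurable_pi_lambda _ fun j => ?_
  have h1 : Measurable fun y : ℤ → BSym M N => (y j, labl y j) :=
    (measurable_pi_apply j).prodMk (labl_measurable j)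
  have h2 : Measurable fun q : BSym M N × Fin M => (match q.1 with
      | .la k => DMSym.la k
      | .u k => .u k
      | .ra => .ra q.2 : DMSym M N) := Measurable.of_discrete
  exact h2.comp h1

lemma kapS_measurable : Measurable (kapS : (ℤ → DMSym M N) → (ℤ → BSym M N)) :=
  measurable_pi_lambda _ fun j => (Measurable.of_discrete (f := kap)).comp (measurable_pi_apply j)

lemma kapS_shift (x : ℤ → DMSym M N) : kapS (shift x) = shift (kapS x) := rfl

end Decode

section Cyl
variable {X A : Type*} (e : X → (ℤ → A))

/-- cylinders -/
def Cy (m : ℕ) (l : List A) : Set X := {x | seg (e x) (-m) (2 * m + 1) = l}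

lemma mem_Cy_seg (m : ℕ) (x : X) : x ∈ Cy e m (seg (e x) (-m) (2 * m + 1)) := rfl

lemma seg_eq_iff {y y' : ℤ → A} {i : ℤ} {n : ℕ} :
    seg y i n = seg y' i n ↔ ∀ j, i ≤ j → j < i + n → y j = y' j := by
  constructor
  · intro h j h1 h2
    have := congrArg (fun l => l[(j - i).toNat]?) h
    simp only [seg, List.getElem?_map] at this
    rw [List.getElem?_range (by omega)] at this
    simp only [Option.map_some, Option.some.injEq] at this
    rwa [show i + ((j - i).toNat : ℤ) = j by omega] at this
  · intro h
    exact seg_congr fun t ht => h _ (by omega) (by omega)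

lemma Cy_pi : IsPiSystem {s : Set X | ∃ m l, s = Cy e m l} := by
  have key : ∀ m l m' l', m ≤ m' → (Cy e m l ∩ Cy e m' l').Nonempty → Cy e m l ∩ Cy e m' l' = Cy e m' l' := by
    rintro m l m' l' hm ⟨x, hx, hx'⟩
    apply Set.inter_eq_right.2
    intro x' h'
    have hx2 : seg (e x) (-m) (2 * m + 1) = l := hx
    change seg (e x') (-m) (2 * m + 1) = l
    have h3 : seg (e x') (-m') (2 * m' + 1) = seg (e x) (-m') (2 * m' + 1) := h'.trans hx'.symm
    rw [← hx2]
    rw [seg_eq_iff] at h3 ⊢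
    intro j h1 h2
    exact h3 j (by omega) (by push_cast at *; omega)
  rintro _ ⟨m, l, rfl⟩ _ ⟨m', l', rfl⟩ hne
  rcases le_total m m' with h | h
  · exact ⟨m', l', key _ _ _ _ h hne⟩
  · rw [Set.inter_comm] at hne ⊢
    exact ⟨m, l, key _ _ _ _ h hne⟩

variable [TopologicalSpace X] [TopologicalSpace A] [DiscreteTopology A]

variable {e} in
lemma Cy_clopen (he : Continuous e) (m : ℕ) (l : List A) : IsClopen (Cy e m l) := by
  have : IsClopen {y : ℤ → A | seg y (-m) (2 * m + 1) = l} := by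
    refine fin_dep_clopen (Finset.Ico (-m : ℤ) (m + 1)) _ fun y y' h hy => ?_
    rw [← hy]
    exact seg_congr fun t ht => (h _ (Finset.mem_Ico.2 ⟨by omega, by omega⟩)).symm
  exact this.preimage he

variable {e} in
lemma Cy_basis (he : IsInducing e) {u : Set X} (hu : IsOpen u) {x : X} (hx : x ∈ u) :
    ∃ m, Cy e m (seg (e x) (-m) (2 * m + 1)) ⊆ u := by
  obtain ⟨v, hv, rfl⟩ := he.isOpen_iff.1 hu
  obtain ⟨I, w, hw, hsub⟩ := isOpen_pi_iff.1 hv (e x) hx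
  refine ⟨∑ i ∈ I, i.natAbs, fun x' hx' => hsub fun i hi => ?_⟩
  have hx2 := seg_eq_iff.1 hx'
  have h1 := Finset.single_le_sum (f := fun i : ℤ => i.natAbs) (by simp) hi
  rw [hx2 i (by omega) (by omega)]
  exact (hw i hi).2

variable [MeasurableSpace X] [OpensMeasurableSpace X]

variable {e} in
lemma tendsto_of_Cy [SecondCountableTopology X] (he : IsInducing e) {ι : Type*} {L : Filter ι} [L.IsCountablyGenerated]
    {μ : ι → ProbabilityMeasure X} {ν : ProbabilityMeasure X}
    (h : ∀ m l, Tendsto (fun i => (μ i).toMeasure.real (Cy e m l)) L (𝓝 (ν.toMeasure.real (Cy e m l)))) :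
    Tendsto μ L (𝓝 ν) := by
  refine (Cy_pi e).tendsto_probabilityMeasure_of_tendsto_of_mem ?_ ?_ ?_
  · rintro _ ⟨m, l, rfl⟩
    exact (Cy_clopen he.continuous m l).isOpen.measurableSet
  · intro u hu x hx
    obtain ⟨m, hm⟩ := Cy_basis he hu hx
    exact ⟨_, ⟨m, _, rfl⟩, (Cy_clopen he.continuous m _).isOpen.mem_nhds (mem_Cy_seg e m x), hm⟩
  · rintro _ ⟨m, l, rfl⟩
    rw [← NNReal.tendsto_coe]
    exact h m l

lemma continuous_real_clopen [HasOuterApproxClosed X] {s : Set X} (hs : IsClopen s) :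
    Continuous fun ν : ProbabilityMeasure X => ν.toMeasure.real s := by
  rw [continuous_iff_continuousAt]
  intro ν
  have := ProbabilityMeasure.tendsto_measure_of_isClopen_of_tendsto (tendsto_id (x := 𝓝 ν)) hs
  rw [← NNReal.tendsto_coe] at this
  exact this

end Cyl

section NBs
variable {M N : ℕ}

lemma exists_cidx (A : Type*) [Countable A] : ∃ f : ℕ → ℕ × List A, Function.Surjective f :=
  exists_surjective_nat _

noncomputable def cset (i : ℕ) : Set ↥(SigmaD M N) :=
  Cy Subtype.val ((exists_cidx (DMSym M N)).choose i).1 ((exists_cidx (DMSym M N)).choose i).2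

lemma cset_clopen (i : ℕ) : IsClopen (cset i : Set ↥(SigmaD M N)) :=
  Cy_clopen continuous_subtype_val _ _

lemma cset_meas (i : ℕ) : MeasurableSet (cset i : Set ↥(SigmaD M N)) :=
  (cset_clopen i).isOpen.measurableSet

lemma tendsto_of_cset {ι : Type*} {L : Filter ι} [L.IsCountablyGenerated]
    {μ : ι → ProbabilityMeasure ↥(SigmaD M N)} {ν : ProbabilityMeasure ↥(SigmaD M N)}
    (h : ∀ i, Tendsto (fun t => (μ t).toMeasure.real (cset i)) L (𝓝 (ν.toMeasure.real (cset i)))) :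
    Tendsto μ L (𝓝 ν) := by
  refine tendsto_of_Cy (e := Subtype.val) IsInducing.subtypeVal fun m l => ?_
  obtain ⟨i, hi⟩ := (exists_cidx (DMSym M N)).choose_spec (m, l)
  have := h i
  unfold cset at this
  rwa [hi] at this

def NB (μ : ProbabilityMeasure ↥(SigmaD M N)) (j : ℕ) : Set (ProbabilityMeasure ↥(SigmaD M N)) :=
  {ν | ∀ i < j, |ν.toMeasure.real (cset i) - μ.toMeasure.real (cset i)| < 1 / ((j : ℝ) + 1)}

lemma NB_self (μ : ProbabilityMeasure ↥(SigmaD M N)) (j : ℕ) : μ ∈ NB μ j := by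
  intro i _
  simp only [sub_self, abs_zero]
  positivity

lemma NB_open (μ : ProbabilityMeasure ↥(SigmaD M N)) (j : ℕ) : IsOpen (NB μ j) := by
  have : NB μ j = ⋂ i ∈ Finset.range j, {ν : ProbabilityMeasure ↥(SigmaD M N) |
      |ν.toMeasure.real (cset i) - μ.toMeasure.real (cset i)| < 1 / ((j : ℝ) + 1)} := by
    ext ν; simp [NB]
  rw [this]
  refine isOpen_biInter_finset fun i _ => ?_
  exact isOpen_lt (((continuous_real_clopen (cset_clopen i)).sub continuous_const).abs) continuous_const

lemma mix_real {X : Type*} [MeasurableSpace X] {μ ν ρ : ProbabilityMeasure X} {t : ℝ≥0∞} (ht : t ≤ 1)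
    (h : ρ.toMeasure = t • μ.toMeasure + (1 - t) • ν.toMeasure) (s : Set X) :
    ρ.toMeasure.real s = t.toReal * μ.toMeasure.real s + (1 - t.toReal) * ν.toMeasure.real s := by
  have ht' : t ≠ ∞ := ne_top_of_le_ne_top (by simp) ht
  rw [measureReal_def, h]
  simp only [Measure.coe_add, Measure.coe_smul, Pi.add_apply, Pi.smul_apply, smul_eq_mul]
  rw [ENNReal.toReal_add (by finiteness) (by finiteness), ENNReal.toReal_mul, ENNReal.toReal_mul,
    ENNReal.toReal_sub_of_le ht (by simp)]
  simp [measureReal_def]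

lemma NB_convex (μ : ProbabilityMeasure ↥(SigmaD M N)) (j : ℕ) : ConvexMeasSet (NB μ j) := by
  intro ν hν ν' hν' t ht ρ h i hi
  rw [mix_real ht h]
  have h1 := abs_lt.1 (hν i hi)
  have h2 := abs_lt.1 (hν' i hi)
  have ht0 : 0 ≤ t.toReal := ENNReal.toReal_nonneg
  have ht1 : t.toReal ≤ 1 := ENNReal.toReal_le_of_le_ofReal (by simp) (by simpa using ht)
  have hd : 0 < 1 / ((j : ℝ) + 1) := by positivity
  generalize 1 / ((j : ℝ) + 1) = d at *
  generalize t.toReal = τ at *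
  rw [abs_lt]
  constructor <;> rcases eq_or_lt_of_le ht0 with h0 | h0 <;> first | (subst h0; linarith) | nlinarith

lemma NB_tendsto {ι : Type*} {L : Filter ι} [L.IsCountablyGenerated]
    {μ : ι → ProbabilityMeasure ↥(SigmaD M N)} {ν : ProbabilityMeasure ↥(SigmaD M N)}
    (h : ∀ j, ∀ᶠ t in L, μ t ∈ NB ν j) : Tendsto μ L (𝓝 ν) := by
  refine tendsto_of_cset fun i => ?_
  rw [Metric.tendsto_nhds]
  intro ε hε
  obtain ⟨n, hn⟩ := exists_nat_one_div_lt hε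
  filter_upwards [h (max n (i + 1))] with t ht
  rw [Real.dist_eq]
  refine (ht i (by omega)).trans (lt_of_le_of_lt ?_ hn)
  apply one_div_le_one_div_of_le (by positivity)
  have : n ≤ max n (i + 1) := le_max_left _ _
  have : (n : ℝ) ≤ (max n (i + 1) : ℕ) := by exact_mod_cast this
  linarith

lemma NB_anti (μ : ProbabilityMeasure ↥(SigmaD M N)) {j j' : ℕ} (h : j ≤ j') : NB μ j' ⊆ NB μ j := by
  intro ν hν i hi
  refine (hν i (by omega)).trans_le ?_
  apply one_div_le_one_div_of_le (by positivity)
  have : (j : ℝ) ≤ j' := by exact_mod_cast h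
  linarith

lemma NB_basis {μ : ProbabilityMeasure ↥(SigmaD M N)} {V : Set (ProbabilityMeasure ↥(SigmaD M N))}
    (hV : IsOpen V) (hμ : μ ∈ V) : ∃ j, NB μ j ⊆ V := by
  by_contra hcon
  push Not at hcon
  simp only [Set.not_subset] at hcon
  choose ν h1 h2 using hcon
  have : Tendsto ν atTop (𝓝 μ) := by
    refine NB_tendsto fun j => ?_
    filter_upwards [eventually_ge_atTop j] with t ht
    exact NB_anti μ ht (h1 t)
  obtain ⟨t, ht⟩ := (this.eventually (hV.mem_nhds hμ)).exists
  exact h2 t ht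

end NBs

section Drift
variable {M N : ℕ}

lemma Gfun_eq (x : ℤ → DMSym M N) (j : ℤ) : Gfun x j = hB (kapS x j) := by
  unfold Gfun kapS
  cases x j <;> rfl

lemma Hfun_zero (x : ℤ → DMSym M N) : Hfun x 0 = 0 := by simp [Hfun]

lemma Hfun_nat (x : ℤ → DMSym M N) (n : ℕ) : Hfun x n = ∑ j ∈ Finset.range n, Gfun x j := by
  simp [Hfun]

lemma Hfun_neg (x : ℤ → DMSym M N) (n : ℕ) :
    Hfun x (-n) = -∑ j ∈ Finset.range n, Gfun x (-n + j) := by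
  rcases Nat.eq_zero_or_pos n with rfl | h
  · simp [Hfun]
  · rw [Hfun, if_neg (by omega)]
    simp

lemma Hfun_succ (x : ℤ → DMSym M N) (i : ℤ) : Hfun x (i + 1) = Hfun x i + Gfun x i := by
  rcases le_or_gt 0 i with h | h
  · obtain ⟨n, rfl⟩ := Int.eq_ofNat_of_zero_le h
    have := Hfun_nat x (n + 1)
    push_cast at this
    rw [this, Hfun_nat, Finset.sum_range_succ]
  · obtain ⟨n, hn⟩ : ∃ n : ℕ, i = -((n : ℤ) + 1) := ⟨(-i - 1).toNat, by omega⟩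
    subst hn
    rw [show -((n : ℤ) + 1) + 1 = -(n : ℤ) by ring, Hfun_neg]
    have := Hfun_neg x (n + 1)
    push_cast at this
    rw [this, Finset.sum_range_succ']
    simp only [Nat.cast_zero, add_zero, neg_add_rev]
    have h2 : ∑ j ∈ Finset.range n, Gfun x (-(n : ℤ) + j)
        = ∑ j ∈ Finset.range n, Gfun x (-1 + -(n : ℤ) + ((j + 1 : ℕ) : ℤ)) := by
      refine Finset.sum_congr rfl fun j _ => ?_
      rw [show -1 + -(n : ℤ) + ((j + 1 : ℕ) : ℤ) = -(n : ℤ) + j by push_cast; ring]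
    rw [h2]
    ring

lemma Hfun_seg (x : ℤ → DMSym M N) (i : ℤ) (n : ℕ) :
    ((seg (kapS x) i n).map hB).sum = Hfun x (i + n) - Hfun x i := by
  induction n with
  | zero => simp [seg_zero]
  | succ n ih =>
    rw [seg_succ, List.map_append, List.sum_append, ih]
    have := Hfun_succ x (i + n)
    rw [Gfun_eq] at this
    push_cast
    rw [← add_assoc, this]
    simp
    ring

lemma allM_of_A0 {x : ℤ → DMSym M N} (hx : x ∈ A0set M N) : AllM (kapS x) := by
  intro j hj
  obtain ⟨n, hn, h⟩ := (hx.2 (j + 1)).2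
  have h1 := Hfun_succ x j
  rw [Gfun_eq, hj] at h1
  simp only [hB] at h1
  refine matched_of_sum_pos (n := n - 1) ?_
  rw [Hfun_seg, show j - ((n - 1 : ℕ) : ℤ) + ((n - 1 : ℕ) : ℤ) = j by ring,
    show j - ((n - 1 : ℕ) : ℤ) = j + 1 - n by omega, h]
  omega

lemma allM_of_Aal {x : ℤ → DMSym M N} (hx : x ∈ AalphaSet M N) : AllM (kapS x) := by
  intro j _
  have h := hx.2.2
  obtain ⟨i, hi1, hi2⟩ := ((h.eventually (eventually_lt_atBot (Hfun x j))).and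
    (eventually_le_atBot j)).exists
  refine matched_of_sum_pos (n := (j - i).toNat) ?_
  rw [Hfun_seg, show j - ((j - i).toNat : ℤ) = i by omega,
    show i + ((j - i).toNat : ℤ) = j by omega]
  omega

lemma shiftInv_mem_SigmaD {x : ℤ → DMSym M N} (hx : x ∈ SigmaD M N) :
    shiftInv x ∈ SigmaD M N := by
  rw [mem_SigmaD_iff] at *
  intro i n
  have : seg (shiftInv x) i n = seg x (i - 1) n :=
    seg_congr fun t _ => by simp only [shiftInv]; congr 1; ring
  rw [this]
  exact hx _ _

lemma measurable_shiftD : Measurable (shiftD M N) :=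
  (measurable_shift.comp measurable_subtype_coe).subtype_mk

def shiftDE (M N : ℕ) : ↥(SigmaD M N) ≃ᵐ ↥(SigmaD M N) where
  toFun := shiftD M N
  invFun := fun x => ⟨shiftInv x.val, shiftInv_mem_SigmaD x.property⟩
  left_inv := fun x => Subtype.ext (shiftInv_shift _)
  right_inv := fun x => Subtype.ext (shift_shiftInv _)
  measurable_toFun := measurable_shiftD
  measurable_invFun := (measurable_shiftInv.comp measurable_subtype_coe).subtype_mk

lemma shiftD_iterate (k : ℕ) (x : ↥(SigmaD M N)) (i : ℤ) : ((shiftD M N)^[k] x).val i = x.val (i + k) := by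
  have : ((shiftD M N)^[k] x).val = shift^[k] x.val := by
    induction k generalizing x with
    | zero => rfl
    | succ k ih => rw [Function.iterate_succ_apply, ih, Function.iterate_succ_apply]; rfl
  rw [this, shift_iterate]

lemma shiftDE_symm_iterate (k : ℕ) (x : ↥(SigmaD M N)) (i : ℤ) :
    ((shiftDE M N).symm^[k] x).val i = x.val (i - k) := by
  induction k generalizing x i with
  | zero => simp
  | succ k ih =>
    rw [Function.iterate_succ_apply, ih]
    change x.val (i - k - 1) = _
    rw [show i - ((k + 1 : ℕ) : ℤ) = i - k - 1 by push_cast; ring]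

/-- the drift observable -/
noncomputable def g0 (x : ↥(SigmaD M N)) : ℝ := (Gfun x.val 0 : ℝ)

lemma g0_le (x : ↥(SigmaD M N)) : |g0 x| ≤ 1 := by
  unfold g0 Gfun
  cases x.val 0 <;> simp

lemma g0_dm_meas (f : DMSym M N → ℝ) (j : ℤ) : Measurable fun x : ↥(SigmaD M N) => f (x.val j) :=
  (Measurable.of_discrete (f := f)).comp ((measurable_pi_apply j).comp measurable_subtype_coe)

lemma G_meas (j : ℤ) : Measurable fun x : ↥(SigmaD M N) => (Gfun x.val j : ℝ) := by
  have h := g0_dm_meas (M := M) (N := N) (fun c => (hB (kap c) : ℝ)) j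
  have h2 : (fun x : ↥(SigmaD M N) => (Gfun x.val j : ℝ)) = fun x => (hB (kap (x.val j)) : ℝ) := by
    funext x; rw [Gfun_eq]; rfl
  rw [h2]; exact h

lemma prob_one_of_ae {X : Type*} [MeasurableSpace X] {μ : Measure X} [IsProbabilityMeasure μ]
    {s : Set X} (h : ∀ᵐ x ∂μ, x ∈ s) : μ s = 1 := by
  rw [measure_congr (show s =ᵐ[μ] Set.univ from eventuallyEq_univ.2 h)]
  exact measure_univ

lemma H_of_birk {x : ℤ → DMSym M N} {c : ℝ} (hc : 0 < c)
    (h1 : ∀ᶠ n : ℕ in atTop, c * n < Hfun x n)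
    (h2 : ∀ᶠ n : ℕ in atTop, c * n < -Hfun x (-n)) :
    Tendsto (Hfun x) atTop atTop ∧ Tendsto (Hfun x) atBot atBot := by
  constructor
  · rw [tendsto_atTop]
    intro b
    obtain ⟨n0, hn0⟩ := eventually_atTop.1 h1
    obtain ⟨n1, hn1⟩ := exists_nat_gt ((b : ℝ) / c)
    filter_upwards [eventually_ge_atTop ((max n0 n1 : ℕ) : ℤ)] with i hi
    obtain ⟨n, rfl⟩ := Int.eq_ofNat_of_zero_le (show 0 ≤ i by omega)
    have ha := hn0 n (by omega)
    rw [div_lt_iff₀ hc] at hn1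
    have hb : (n1 : ℝ) ≤ n := by exact_mod_cast (show n1 ≤ n by omega)
    have : (b : ℝ) < Hfun x n := by nlinarith
    exact_mod_cast this.le
  · rw [tendsto_atBot]
    intro b
    obtain ⟨n0, hn0⟩ := eventually_atTop.1 h2
    obtain ⟨n1, hn1⟩ := exists_nat_gt (-(b : ℝ) / c)
    filter_upwards [eventually_le_atBot (-((max n0 n1 : ℕ) : ℤ))] with i hi
    obtain ⟨n, rfl⟩ : ∃ n : ℕ, i = -(n : ℤ) := ⟨(-i).toNat, by omega⟩
    have ha := hn0 n (by omega)
    rw [div_lt_iff₀ hc] at hn1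
    have hb : (n1 : ℝ) ≤ n := by exact_mod_cast (show n1 ≤ n by omega)
    have : (Hfun x (-n) : ℝ) < b := by nlinarith
    exact_mod_cast this.le

lemma mem_MeAl_of_drift {μ : ProbabilityMeasure ↥(SigmaD M N)} (he : Ergodic (shiftD M N) μ.toMeasure)
    (hd : 0 < ∫ x, g0 x ∂μ.toMeasure) : μ ∈ MeAl M N := by
  refine ⟨he, prob_one_of_ae ?_⟩
  set d := ∫ x, g0 x ∂μ.toMeasure with hdd
  have h1 := birk_lower he (h := g0) (G_meas 0) g0_le (c := d / 2) (by linarith)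
  have he' : Ergodic (shiftDE M N) μ.toMeasure := he
  have hes := he'.symm
  have hIntg : ∫ x : ↥(SigmaD M N), (Gfun x.val (-1) : ℝ) ∂μ.toMeasure = d := by
    have := hes.toMeasurePreserving.integral_comp (shiftDE M N).symm.measurableEmbedding (g0 (M := M) (N := N))
    rw [hdd, ← this]
    rfl
  have h2 := birk_lower hes (h := fun x : ↥(SigmaD M N) => (Gfun x.val (-1) : ℝ)) (G_meas (-1))
    (C := 1) (fun x => by rw [Gfun_eq]; cases kapS x.val (-1) <;> simp [hB]) (c := d / 2) (by linarith)
  filter_upwards [h1, h2] with x hx1 hx2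
  refine ⟨x.2, H_of_birk (c := d / 2) (by linarith) ?_ ?_⟩
  · filter_upwards [hx1] with n hn
    refine hn.trans_le (le_of_eq ?_)
    rw [Hfun_nat, birkhoffSum]
    push_cast
    refine Finset.sum_congr rfl fun k _ => ?_
    unfold g0 Gfun
    rw [shiftD_iterate, zero_add]
  · filter_upwards [hx2] with n hn
    refine hn.trans_le (le_of_eq ?_)
    rw [Hfun_neg, birkhoffSum]
    push_cast
    rw [neg_neg, ← Finset.sum_range_reflect]
    refine Finset.sum_congr rfl fun k hk => ?_
    have hk' := Finset.mem_range.1 hk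
    unfold Gfun
    rw [shiftDE_symm_iterate, show (-1 : ℤ) - ((n - 1 - k : ℕ) : ℤ) = -n + k by omega]

lemma ae_allM {μ : ProbabilityMeasure ↥(SigmaD M N)} (h : μ ∈ Me0 M N ∪ MeAl M N) :
    ∀ᵐ x ∂μ.toMeasure, AllM (kapS x.val) := by
  have hm : MeasurableSet {x : ↥(SigmaD M N) | AllM (kapS x.val)} :=
    (kapS_measurable.comp measurable_subtype_coe) allM_measurable
  have h1 : 1 ≤ μ.toMeasure {x : ↥(SigmaD M N) | AllM (kapS x.val)} := by
    rcases h with h | h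
    · rw [← h.2]; exact measure_mono fun x hx => allM_of_A0 hx
    · rw [← h.2]; exact measure_mono fun x hx => allM_of_Aal hx
  have h2 := le_antisymm prob_le_one h1
  exact (mem_ae_iff_prob_eq_one hm).2 h2

end Drift

section Orbit
variable {M N : ℕ} [NeZero M]

/-- the point of `Σ_D` determined by a sequence over the reduced alphabet -/
noncomputable def pt (y : ℤ → BSym M N) : ↥(SigmaD M N) := ⟨psi y, psi_mem y⟩

lemma pt_shift (y : ℤ → BSym M N) : pt (shift y) = shiftD M N (pt y) :=
  Subtype.ext (psi_shift y)

lemma pt_iterate (y : ℤ → BSym M N) (k : ℕ) : pt (shift^[k] y) = (shiftD M N)^[k] (pt y) := by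
  induction k with
  | zero => rfl
  | succ k ih => rw [Function.iterate_succ_apply', Function.iterate_succ_apply', pt_shift, ih]

lemma pt_measurable : Measurable (pt : (ℤ → BSym M N) → _) := psi_measurable.subtype_mk

/-- orbit measure -/
noncomputable def orbM (y : ℤ → BSym M N) (q : ℕ) : Measure ↥(SigmaD M N) :=
  (q : ℝ≥0∞)⁻¹ • ∑ k ∈ Finset.range q, Measure.dirac (pt (shift^[k] y))

lemma orbM_prob (y : ℤ → BSym M N) {q : ℕ} (hq : 0 < q) : IsProbabilityMeasure (orbM y q) := by
  constructor
  simp only [orbM, Measure.smul_apply, Measure.finsetSum_apply, measure_univ, Finset.sum_const,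
    Finset.card_range, smul_eq_mul, nsmul_eq_mul, mul_one]
  exact ENNReal.inv_mul_cancel (by exact_mod_cast hq.ne') (ENNReal.natCast_ne_top q)

noncomputable def orb (y : ℤ → BSym M N) {q : ℕ} (hq : 0 < q) : ProbabilityMeasure ↥(SigmaD M N) :=
  ⟨orbM y q, orbM_prob y hq⟩

lemma orb_integral (y : ℤ → BSym M N) {q : ℕ} (hq : 0 < q) {f : ↥(SigmaD M N) → ℝ}
    (hf : Measurable f) :
    ∫ x, f x ∂(orb y hq).toMeasure = (q : ℝ)⁻¹ * ∑ k ∈ Finset.range q, f (pt (shift^[k] y)) := by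
  change ∫ x, f x ∂(orbM y q) = _
  rw [orbM, integral_smul_measure, integral_finsetSum_measure]
  · simp only [integral_dirac' _ _ hf.stronglyMeasurable]
    simp
  · intro i _
    exact integrable_dirac' hf.stronglyMeasurable (by simp)

lemma orb_real (y : ℤ → BSym M N) {q : ℕ} (hq : 0 < q) {s : Set ↥(SigmaD M N)}
    (hs : MeasurableSet s) :
    (orb y hq).toMeasure.real s
      = (q : ℝ)⁻¹ * ∑ k ∈ Finset.range q, s.indicator (fun _ => (1 : ℝ)) (pt (shift^[k] y)) := by
  rw [← orb_integral y hq (measurable_const.indicator hs), integral_indicator_const _ hs]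
  simp

lemma per_iter {A : Type*} {y : ℤ → A} {p : ℕ} (hper : ∀ i, y (i + p) = y i) : shift^[p] y = y := by
  rw [shift_iterate]; funext i; exact hper i

lemma per_mul {A : Type*} {y : ℤ → A} {p : ℕ} (hper : ∀ i, y (i + p) = y i) (r : ℕ) (i : ℤ) :
    y (i + (p * r : ℕ)) = y i := by
  induction r with
  | zero => simp
  | succ r ih => rw [Nat.mul_succ, Nat.cast_add, ← add_assoc, hper, ih]

lemma per_sum {f : ℕ → ℝ} {p : ℕ} (hf : ∀ k, f (k + p) = f k) (r : ℕ) :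
    ∑ k ∈ Finset.range (p * r), f k = r * ∑ k ∈ Finset.range p, f k := by
  induction r with
  | zero => simp
  | succ r ih =>
    rw [Nat.mul_succ, Finset.sum_range_add, ih]
    have : ∀ k, f (p * r + k) = f k := by
      intro k
      clear ih
      induction r with
      | zero => simp
      | succ r ih => rw [Nat.mul_succ, add_right_comm, hf, ih]
    simp only [this]
    push_cast; ring

lemma per_sum_shift {f : ℕ → ℝ} {p : ℕ} (hf : ∀ k, f (k + p) = f k) (s : ℕ) :
    ∑ k ∈ Finset.range p, f (s + k) = ∑ k ∈ Finset.range p, f k := by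
  induction s with
  | zero => simp
  | succ s ih =>
    rw [← ih]
    have h1 := Finset.sum_range_succ (fun k => f (s + k)) p
    have h2 := Finset.sum_range_succ' (fun k => f (s + k)) p
    rw [hf] at h1
    simp only [add_zero] at h2
    have h3 : ∀ k, f (s + 1 + k) = f (s + (k + 1)) := fun k => by congr 1; ring
    simp only [h3]
    linarith

lemma iter_per {y : ℤ → BSym M N} {p : ℕ} (hper : ∀ i, y (i + p) = y i) (k : ℕ) :
    shift^[k + p] y = shift^[k] y := by
  rw [Function.iterate_add_apply, per_iter hper]

lemma orb_mul {y : ℤ → BSym M N} {p : ℕ} (hp : 0 < p) (hper : ∀ i, y (i + p) = y i) {q r : ℕ}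
    (hq : 0 < q) (hqr : q = p * r) : orb y hq = orb y hp := by
  subst hqr
  apply Subtype.ext
  have hr : 0 < r := Nat.pos_of_mul_pos_left hq
  haveI := orbM_prob y hq
  haveI := orbM_prob y hp
  refine Measure.ext fun s hs => ?_
  change (orb y hq).toMeasure s = (orb y hp).toMeasure s
  rw [← ENNReal.ofReal_toReal (measure_ne_top (orb y hq).toMeasure s),
    ← ENNReal.ofReal_toReal (measure_ne_top (orb y hp).toMeasure s)]
  congr 1
  change (orb y hq).toMeasure.real s = (orb y hp).toMeasure.real s
  rw [orb_real y hq hs, orb_real y hp hs, per_sum]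
  · push_cast
    have h1 : (p : ℝ) ≠ 0 := by positivity
    have h2 : (r : ℝ) ≠ 0 := by positivity
    field_simp
  · intro k; rw [iter_per hper]

lemma orb_mp {y : ℤ → BSym M N} {p : ℕ} (hp : 0 < p) (hper : ∀ i, y (i + p) = y i) :
    MeasurePreserving (shiftD M N) (orb y hp).toMeasure (orb y hp).toMeasure := by
  refine ⟨measurable_shiftD, ?_⟩
  refine Measure.ext fun s hs => ?_
  rw [Measure.map_apply measurable_shiftD hs]
  rw [← ENNReal.ofReal_toReal (measure_ne_top (orb y hp).toMeasure s),
    ← ENNReal.ofReal_toReal (measure_ne_top (orb y hp).toMeasure (shiftD M N ⁻¹' s))]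
  congr 1
  change (orb y hp).toMeasure.real _ = (orb y hp).toMeasure.real s
  rw [orb_real y hp hs, orb_real y hp (measurable_shiftD hs)]
  congr 1
  rw [← per_sum_shift (f := fun k => s.indicator (fun _ => (1 : ℝ)) (pt (shift^[k] y))) (p := p)
    (fun k => by rw [iter_per hper]) 1]
  refine Finset.sum_congr rfl fun k _ => ?_
  rw [add_comm 1 k, Function.iterate_succ_apply', pt_shift]
  rfl

lemma orb_ae {y : ℤ → BSym M N} {p : ℕ} (hp : 0 < p) {s : Set ↥(SigmaD M N)} (hs : MeasurableSet s)
    (h : ∀ k, pt (shift^[k] y) ∉ s) : ∀ᵐ x ∂(orb y hp).toMeasure, x ∉ s := by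
  have h0 : (orb y hp).toMeasure.real s = 0 := by
    rw [orb_real y hp hs]
    simp [h]
  rw [measureReal_eq_zero_iff] at h0
  exact measure_eq_zero_iff_ae_notMem.1 h0

lemma orb_ergodic {y : ℤ → BSym M N} {p : ℕ} (hp : 0 < p) (hper : ∀ i, y (i + p) = y i) :
    Ergodic (shiftD M N) (orb y hp).toMeasure := by
  refine ⟨orb_mp hp hper, ⟨fun s hs hinv => ?_⟩⟩
  have hk : ∀ k, pt (shift^[k] y) ∈ s ↔ pt y ∈ s := by
    intro k
    induction k with
    | zero => rfl
    | succ k ih =>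
      rw [Function.iterate_succ_apply', pt_shift, ← ih]
      exact (Set.ext_iff.1 hinv (pt (shift^[k] y)))
  rw [eventuallyConst_set]
  by_cases h : pt y ∈ s
  · left
    have := orb_ae (y := y) hp hs.compl (fun k hc => hc ((hk k).2 h))
    simpa using this
  · right
    exact orb_ae (y := y) hp hs (fun k hc => h ((hk k).1 hc))

end Orbit

section PerW

/-- a periodic sequence of positive drift -/
structure PerW (M N : ℕ) where
  y : ℤ → BSym (M + 2) N
  p : ℕ
  hp : 0 < p
  per : ∀ i, y (i + p) = y i
  drift : 0 < ((seg y 0 p).map hB).sum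
  nz : ∃ i, y i ≠ .la 0
  nb : ∃ i, y i ≠ .la 1

variable {M N : ℕ}

noncomputable def PerW.meas (W : PerW M N) : ProbabilityMeasure ↥(SigmaD (M + 2) N) := orb W.y W.hp

lemma sum_seg {f : BSym M N → ℤ} (y : ℤ → BSym M N) (i : ℤ) (n : ℕ) :
    ((seg y i n).map f).sum = ∑ k ∈ Finset.range n, f (y (i + k)) := by
  induction n with
  | zero => simp [seg_zero]
  | succ n ih => rw [seg_succ, Finset.sum_range_succ, ← ih]; simp

/-- the set of measures of positive drift -/
def Dpos (M N : ℕ) : Set (ProbabilityMeasure ↥(SigmaD M N)) := {ν | 0 < ∫ x, g0 x ∂ν.toMeasure}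

lemma g0_cont : Continuous (g0 : ↥(SigmaD M N) → ℝ) := by
  have : (g0 : ↥(SigmaD M N) → ℝ) = (fun c => (hB (kap c) : ℝ)) ∘ (fun x => x.val 0) := by
    funext x; simp only [g0, Gfun_eq]; rfl
  rw [this]
  exact continuous_of_discreteTopology.comp ((continuous_apply 0).comp continuous_subtype_val)

lemma Dpos_open : IsOpen (Dpos M N) := by
  let f : BoundedContinuousFunction ↥(SigmaD M N) ℝ :=
    BoundedContinuousFunction.ofNormedAddCommGroup g0 g0_cont 1 (fun x => g0_le x)
  exact isOpen_lt continuous_const (ProbabilityMeasure.continuous_integral_boundedContinuousFunction f)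

lemma g0_int (μ : ProbabilityMeasure ↥(SigmaD M N)) : Integrable g0 μ.toMeasure :=
  Integrable.of_bound (G_meas 0).aestronglyMeasurable 1 (ae_of_all _ g0_le)

lemma Dpos_convex : ConvexMeasSet (Dpos M N) := by
  intro μ hμ ν hν t ht ρ h
  change 0 < ∫ x, g0 x ∂ρ.toMeasure
  have h1 : t ≠ ⊤ := ne_top_of_le_ne_top ENNReal.one_ne_top ht
  rw [h, integral_add_measure ((g0_int μ).smul_measure h1)
    ((g0_int ν).smul_measure (ENNReal.sub_ne_top ENNReal.one_ne_top)), integral_smul_measure,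
    integral_smul_measure, ENNReal.toReal_sub_of_le ht ENNReal.one_ne_top]
  have h2 : t.toReal ≤ 1 := ENNReal.toReal_mono ENNReal.one_ne_top ht
  have h3 : 0 ≤ t.toReal := ENNReal.toReal_nonneg
  have h4 : 0 < ∫ x, g0 x ∂μ.toMeasure := hμ
  have h5 : 0 < ∫ x, g0 x ∂ν.toMeasure := hν
  simp only [smul_eq_mul, ENNReal.toReal_one]
  rcases h3.eq_or_lt with h3 | h3
  · rw [← h3]; linarith
  · have := mul_pos h3 h4
    have := mul_nonneg (sub_nonneg.2 h2) h5.le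
    linarith

lemma PerW.mem_Dpos (W : PerW M N) : W.meas ∈ Dpos (M + 2) N := by
  change 0 < ∫ x, g0 x ∂(orb W.y W.hp).toMeasure
  rw [orb_integral W.y W.hp (f := g0) (G_meas 0)]
  have h1 : ∀ k, g0 (pt (shift^[k] W.y)) = (hB (W.y k) : ℝ) := by
    intro k
    simp only [g0, Gfun_eq, pt, kapS_psi, shift_iterate, zero_add]
  simp only [h1]
  have h2 := W.drift
  rw [sum_seg] at h2
  simp only [zero_add] at h2
  have h3 : (0 : ℝ) < ∑ k ∈ Finset.range W.p, (hB (W.y k) : ℝ) := by exact_mod_cast h2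
  have := W.hp
  positivity

lemma PerW.ergodic (W : PerW M N) : Ergodic (shiftD (M + 2) N) W.meas.toMeasure :=
  orb_ergodic W.hp W.per

lemma PerW.mem_MeAl (W : PerW M N) : W.meas ∈ MeAl (M + 2) N :=
  mem_MeAl_of_drift W.ergodic W.mem_Dpos

/-- change of period -/
def PerW.mul (W : PerW M N) (r : ℕ) (hr : 0 < r) : PerW M N where
  y := W.y
  p := W.p * r
  hp := Nat.mul_pos W.hp hr
  per := per_mul W.per r
  drift := by
    have h := W.drift
    rw [sum_seg] at *
    have := per_sum (f := fun k : ℕ => ((hB (W.y (0 + k)) : ℤ) : ℝ)) (p := W.p)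
      (fun k => by
        push_cast
        rw [← add_assoc, W.per]) r
    have h2 : ∑ k ∈ Finset.range (W.p * r), hB (W.y (0 + k))
      = r * ∑ k ∈ Finset.range W.p, hB (W.y (0 + k)) := by exact_mod_cast this
    rw [h2]
    positivity
  nz := W.nz
  nb := W.nb

lemma PerW.mul_meas (W : PerW M N) (r : ℕ) (hr : 0 < r) : (W.mul r hr).meas = W.meas :=
  orb_mul W.hp W.per (W.mul r hr).hp rfl

end PerW

section Approx
variable {M N : ℕ}

open Classical in
noncomputable def badC (y : ℤ → BSym M N) (n : ℕ) : ℕ :=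
  ∑ j ∈ Finset.range n, if (y j = .ra ∧ topS y j j = none) then 1 else 0

lemma stk_len (y : ℤ → BSym M N) (n : ℕ) :
    ((stk (seg y 0 n)).length : ℤ) = ((seg y 0 n).map hB).sum + badC y n := by
  induction n with
  | zero => simp [seg_zero, stk, badC]
  | succ n ih =>
    rw [seg_succ, stk_append_single, badC, Finset.sum_range_succ, ← badC]
    rw [List.map_append, List.sum_append]
    have ht : topS y n n = (stk (seg y 0 n)).head? := by rw [topS, sub_self]
    rw [ht]
    simp only [zero_add, List.map_cons, List.map_nil, List.sum_cons, List.sum_nil, add_zero]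
    cases hy : y n with
    | la k => simp [stkStep, hB]; omega
    | u k => simp [stkStep, hB]; omega
    | ra =>
      cases hs : stk (seg y 0 n) with
      | nil => simp [stkStep, hB]; rw [hs] at ih; simp at ih; omega
      | cons a l => simp [stkStep, hB]; rw [hs] at ih; simp at ih; omega

lemma topS_iter (K k : ℕ) (y : ℤ → BSym M N) (t : ℤ) : topS (shift^[k] y) t K = topS y (t + k) K := by
  induction k generalizing y t with
  | zero => simp
  | succ k ih =>
    rw [Function.iterate_succ_apply', topS_shift, ih]
    congr 1; push_cast; ring

/-- periodic approximation -/
def apY (y : ℤ → BSym (M + 2) N) (n P : ℕ) : ℤ → BSym (M + 2) N := fun i =>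
  if i % ((n + P : ℕ) : ℤ) < n then y (i % ((n + P : ℕ) : ℤ))
  else if i % ((n + P : ℕ) : ℤ) = n then .la 0 else .la 1

lemma apY_lt (y : ℤ → BSym (M + 2) N) (n P : ℕ) {i : ℤ} (h0 : 0 ≤ i) (h1 : i < n) :
    apY y n P i = y i := by
  have : i % ((n + P : ℕ) : ℤ) = i := Int.emod_eq_of_lt h0 (by push_cast; omega)
  rw [apY, this, if_pos h1]

lemma apY_ge (y : ℤ → BSym (M + 2) N) (n P : ℕ) {i : ℤ} (h0 : n ≤ i) (h1 : i < n + P) :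
    apY y n P i = if i = n then .la 0 else .la 1 := by
  have : i % ((n + P : ℕ) : ℤ) = i := Int.emod_eq_of_lt (by omega) (by push_cast; omega)
  rw [apY, this, if_neg (by omega)]

def apW (y : ℤ → BSym (M + 2) N) (n P : ℕ) (hP : 2 ≤ P) (hb : badC y n < P) : PerW M N where
  y := apY y n P
  p := n + P
  hp := by omega
  per := fun i => by simp only [apY]; rw [Int.add_emod_right]
  drift := by
    rw [seg_add, List.map_append, List.sum_append]
    have h1 : seg (apY y n P) 0 n = seg y 0 n :=
      seg_congr fun t ht => apY_lt y n P (by omega) (by omega)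
    have h2 : ((seg (apY y n P) (0 + n) P).map hB).sum = P := by
      rw [sum_seg]
      have : ∀ k ∈ Finset.range P, hB (apY y n P (0 + n + k)) = 1 := by
        intro k hk
        have := Finset.mem_range.1 hk
        rw [apY_ge y n P (by omega) (by omega)]
        split_ifs <;> rfl
      rw [Finset.sum_congr rfl this]
      simp
    rw [h1, h2]
    have := stk_len y n
    omega
  nz := ⟨n + 1, by
    rw [apY_ge y n P (by omega) (by omega), if_neg (by omega)]
    simp⟩
  nb := ⟨n, by
    rw [apY_ge y n P (by omega) (by omega), if_pos rfl]
    simp⟩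

/-- positions without a local match -/
def FK (M N m K : ℕ) : Set ↥(SigmaD M N) :=
  {x | ∃ t : ℤ, -m ≤ t ∧ t ≤ m ∧ kapS x.val t = .ra ∧ topS (kapS x.val) t K = none}

lemma FK_meas (m K : ℕ) : MeasurableSet (FK M N m K) := by
  have : FK M N m K = (fun x : ↥(SigmaD M N) => kapS x.val) ⁻¹' (⋃ t : ℤ, {y | -m ≤ t ∧ t ≤ m} ∩
      ({y | y t = .ra} ∩ {y | topS y t K = none})) := by
    ext x; simp [FK, and_assoc]
  rw [this]
  refine (kapS_measurable.comp measurable_subtype_coe) (MeasurableSet.iUnion fun t => ?_)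
  exact (MeasurableSet.const _).inter ((eval_set_measurable t (fun c => c = .ra)).inter (topS_set_measurable t K none))

lemma FK_small {μ : ProbabilityMeasure ↥(SigmaD M N)} (h : ∀ᵐ x ∂μ.toMeasure, AllM (kapS x.val)) (m : ℕ)
    {ε : ℝ} (hε : 0 < ε) : ∃ K, μ.toMeasure.real (FK M N m K) < ε := by
  have hanti : Antitone (FK M N m) := by
    intro K K' hK x hx
    obtain ⟨t, h1, h2, h3, h4⟩ := hx
    refine ⟨t, h1, h2, h3, ?_⟩
    cases ho : topS (kapS x.val) t K with
    | none => rfl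
    | some k => rw [topS_mono hK ho] at h4; cases h4
  have ht := tendsto_measure_iInter_atTop (μ := μ.toMeasure) (fun K => (FK_meas (M := M) (N := N) m K).nullMeasurableSet) hanti
    ⟨0, measure_ne_top _ _⟩
  have h0 : μ.toMeasure (⋂ K, FK M N m K) = 0 := by
    rw [measure_eq_zero_iff_ae_notMem]
    filter_upwards [h] with x hx hc
    rw [Set.mem_iInter] at hc
    have : ∀ t : ℤ, ∃ K, kapS x.val t = .ra → topS (kapS x.val) t K ≠ none := by
      intro t
      by_cases hr : kapS x.val t = .ra
      · obtain ⟨n, k, hk⟩ := hx t hr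
        exact ⟨n, fun _ => by rw [hk]; simp⟩
      · exact ⟨0, fun h => absurd h hr⟩
    choose K hK using this
    obtain ⟨t, h1, h2, h3, h4⟩ := hc ((Finset.Icc (-(m : ℤ)) m).sup K)
    have hle : K t ≤ (Finset.Icc (-(m : ℤ)) m).sup K := Finset.le_sup (Finset.mem_Icc.2 ⟨h1, h2⟩)
    cases ho : topS (kapS x.val) t (K t) with
    | none => exact hK t h3 ho
    | some k => rw [topS_mono hle ho] at h4; cases h4
  rw [h0] at ht
  have ht2 := (ENNReal.tendsto_toReal ENNReal.zero_ne_top).comp ht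
  obtain ⟨K, hK⟩ := (ht2.eventually (gt_mem_nhds (show (0 : ℝ≥0∞).toReal < ε by simpa using hε))).exists
  exact ⟨K, hK⟩

lemma sum_ite_lt (n a : ℕ) : ∑ k ∈ Finset.range n, (if k < a then (1 : ℝ) else 0) ≤ a := by
  rw [Finset.sum_boole]
  have : ((Finset.range n).filter (· < a)).card ≤ (Finset.range a).card :=
    Finset.card_le_card fun k hk => by simp at hk ⊢; exact hk.2
  rw [Finset.card_range] at this
  exact_mod_cast this

lemma sum_ite_ge (n a : ℕ) : ∑ k ∈ Finset.range n, (if n ≤ k + a then (1 : ℝ) else 0) ≤ a := by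
  rw [Finset.sum_boole]
  have : ((Finset.range n).filter (fun k => n ≤ k + a)).card ≤ (Finset.Ico (n - a) n).card :=
    Finset.card_le_card fun k hk => by simp at hk ⊢; omega
  rw [Nat.card_Ico] at this
  have h2 : ((Finset.range n).filter (fun k => n ≤ k + a)).card ≤ a := by omega
  exact_mod_cast h2

/-- the counting comparison -/
lemma ap_count (x : ↥(SigmaD (M + 2) N)) (n P m K : ℕ) {m' : ℕ} (hm : m' ≤ m) (l : List (DMSym (M + 2) N)) :
    |∑ k ∈ Finset.range (n + P), (Cy Subtype.val m' l : Set ↥(SigmaD (M + 2) N)).indicator (fun _ => (1 : ℝ))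
        (pt (shift^[k] (apY (kapS x.val) n P)))
      - birkhoffSum (shiftD (M + 2) N) ((Cy Subtype.val m' l : Set ↥(SigmaD (M + 2) N)).indicator (fun _ => (1 : ℝ))) n x|
    ≤ P + K + 2 * m + birkhoffSum (shiftD (M + 2) N) ((FK (M + 2) N m K).indicator (fun _ => (1 : ℝ))) n x := by
  set c : Set ↥(SigmaD (M + 2) N) := Cy Subtype.val m' l with hc
  have i1 : ∀ (s : Set ↥(SigmaD (M + 2) N)) w, 0 ≤ s.indicator (fun _ => (1 : ℝ)) w :=
    fun s w => Set.indicator_nonneg (fun _ _ => zero_le_one) w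
  have i2 : ∀ (s : Set ↥(SigmaD (M + 2) N)) w, s.indicator (fun _ => (1 : ℝ)) w ≤ 1 :=
    fun s w => Set.indicator_le_self' (fun _ _ => zero_le_one) w
  rw [Finset.sum_range_add, birkhoffSum, birkhoffSum]
  have e1 : |∑ k ∈ Finset.range n, (c.indicator (fun _ => (1 : ℝ)) (pt (shift^[k] (apY (kapS x.val) n P)))
      - c.indicator (fun _ => (1 : ℝ)) ((shiftD (M + 2) N)^[k] x))| ≤
      ∑ k ∈ Finset.range n, ((if k < K + m then (1 : ℝ) else 0) + (if n ≤ k + m then (1 : ℝ) else 0)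
        + (FK (M + 2) N m K).indicator (fun _ => (1 : ℝ)) ((shiftD (M + 2) N)^[k] x)) := by
    refine (Finset.abs_sum_le_sum_abs _ _).trans (Finset.sum_le_sum fun k hk => ?_)
    have a1 := i1 c (pt (shift^[k] (apY (kapS x.val) n P)))
    have a2 := i2 c (pt (shift^[k] (apY (kapS x.val) n P)))
    have a3 := i1 c ((shiftD (M + 2) N)^[k] x)
    have a4 := i2 c ((shiftD (M + 2) N)^[k] x)
    have a5 := i1 (FK (M + 2) N m K) ((shiftD (M + 2) N)^[k] x)
    have a6 := i2 (FK (M + 2) N m K) ((shiftD (M + 2) N)^[k] x)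
    have a7 : |c.indicator (fun _ => (1 : ℝ)) (pt (shift^[k] (apY (kapS x.val) n P)))
      - c.indicator (fun _ => (1 : ℝ)) ((shiftD (M + 2) N)^[k] x)| ≤ 1 := by
      rw [abs_le]; constructor <;> linarith
    by_cases h1 : k < K + m
    · rw [if_pos h1]; split_ifs <;> linarith
    by_cases h2 : n ≤ k + m
    · rw [if_pos h2, if_neg h1]; linarith
    by_cases h3 : (shiftD (M + 2) N)^[k] x ∈ FK (M + 2) N m K
    · rw [Set.indicator_of_mem h3, if_neg h1, if_neg h2]; linarith
    · have : (pt (shift^[k] (apY (kapS x.val) n P)) ∈ c ↔ (shiftD (M + 2) N)^[k] x ∈ c) := by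
        have hs : seg (pt (shift^[k] (apY (kapS x.val) n P))).val (-m') (2 * m' + 1)
            = seg ((shiftD (M + 2) N)^[k] x).val (-m') (2 * m' + 1) := by
          rw [seg_eq_iff]
          intro t ht1 ht2
          rw [pt_iterate, shiftD_iterate, shiftD_iterate]
          change psi (apY (kapS x.val) n P) (t + k) = x.val (t + k)
          rw [← psi_kapS_at x.2 (t + k)]
          · refine psi_congr (n := K) ?_ ?_
            · intro hr
              by_contra hno
              refine h3 ⟨t, by omega, by omega, ?_, ?_⟩
              · simp only [kapS, shiftD_iterate]; exact hr
              · have e : kapS ((shiftD (M + 2) N)^[k] x).val = shift^[k] (kapS x.val) := by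
                  funext i; simp only [kapS, shiftD_iterate, shift_iterate]
                rw [e, topS_iter]
                cases ho : topS (kapS x.val) (t + k) K with
                | none => rfl
                | some q => exact absurd ⟨q, ho⟩ hno
            · intro j hj1 hj2
              exact apY_lt _ _ _ (by omega) (by omega)
          · intro hr
            by_contra hno
            refine h3 ⟨t, by omega, by omega, ?_, ?_⟩
            · simp only [kapS, shiftD_iterate]; exact hr
            · have e : kapS ((shiftD (M + 2) N)^[k] x).val = shift^[k] (kapS x.val) := by
                funext i; simp only [kapS, shiftD_iterate, shift_iterate]
              rw [e, topS_iter]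
              cases ho : topS (kapS x.val) (t + k) K with
              | none => rfl
              | some q => exact absurd ⟨K, q, ho⟩ hno
        change _ = l ↔ _ = l
        rw [hs]
      rw [if_neg h1, if_neg h2, Set.indicator_of_notMem h3]
      by_cases h4 : (shiftD (M + 2) N)^[k] x ∈ c
      · rw [Set.indicator_of_mem h4, Set.indicator_of_mem (this.2 h4)]; simp
      · rw [Set.indicator_of_notMem h4, Set.indicator_of_notMem (mt this.1 h4)]; simp
  rw [Finset.sum_sub_distrib, Finset.sum_add_distrib, Finset.sum_add_distrib] at e1
  have e2 := sum_ite_lt n (K + m)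
  have e3 := sum_ite_ge n m
  have e4 : ∑ k ∈ Finset.range P, c.indicator (fun _ => (1 : ℝ)) (pt (shift^[n + k] (apY (kapS x.val) n P)))
      ≤ P := by
    refine (Finset.sum_le_sum fun k _ => i2 c _).trans ?_
    simp
  have e5 : 0 ≤ ∑ k ∈ Finset.range P, c.indicator (fun _ => (1 : ℝ)) (pt (shift^[n + k] (apY (kapS x.val) n P))) :=
    Finset.sum_nonneg fun k _ => i1 c _
  push_cast at e2
  rw [abs_le] at e1 ⊢
  constructor <;> linarith [e1.1, e1.2]

lemma ap_bad (x : ↥(SigmaD M N)) (n m K : ℕ) :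
    (badC (kapS x.val) n : ℝ) ≤ K + birkhoffSum (shiftD M N) ((FK M N m K).indicator (fun _ => (1 : ℝ))) n x := by
  have e2 := sum_ite_lt n K
  rw [birkhoffSum]
  refine le_trans ?_ (add_le_add_left e2 _)
  rw [← Finset.sum_add_distrib, badC]
  push_cast
  refine Finset.sum_le_sum fun k _ => ?_
  have a5 : 0 ≤ (FK M N m K).indicator (fun _ => (1 : ℝ)) ((shiftD M N)^[k] x) :=
    Set.indicator_nonneg (fun _ _ => zero_le_one) _
  by_cases h1 : k < K
  · rw [if_pos h1]; split_ifs <;> linarith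
  rw [if_neg h1]
  split_ifs with h
  · rw [Set.indicator_of_mem]
    · simp
    · refine ⟨0, by omega, by omega, ?_, ?_⟩
      · simp only [kapS, shiftD_iterate, zero_add]; exact h.1
      · have e : kapS ((shiftD M N)^[k] x).val = shift^[k] (kapS x.val) := by
          funext i; simp only [kapS, shiftD_iterate, shift_iterate]
        rw [e, topS_iter, zero_add]
        cases ho : topS (kapS x.val) k K with
        | none => rfl
        | some q =>
          have := topS_mono (show K ≤ k by omega) ho
          rw [h.2] at this; cases this
  · linarith

lemma ap_arith {C S μc n q E ε : ℝ} (h0 : 0 ≤ μc) (h1 : μc ≤ 1) (hn : 0 < n) (hnq : n ≤ q)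
    (hq : q - n ≤ 2 * ε * n) (hC : |C - S| ≤ E) (hE : E ≤ 3 * ε * n)
    (hS1 : (μc - ε) * n < S) (hS2 : S < (μc + ε) * n) (hε : 0 < ε) :
    |q⁻¹ * C - μc| < 8 * ε := by
  have hq0 : 0 < q := by linarith
  have : q⁻¹ * C - μc = (C - q * μc) / q := by field_simp
  rw [this, abs_div, abs_of_pos hq0, div_lt_iff₀ hq0, abs_lt]
  rw [abs_le] at hC
  have h3 : (q - n) * μc ≤ q - n := mul_le_of_le_one_right (by linarith) h1
  have h4 : 0 ≤ (q - n) * μc := mul_nonneg (by linarith) h0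
  have h5 : ε * n ≤ ε * q := by nlinarith
  have h6 : 0 < ε * n := by positivity
  constructor <;> nlinarith [hC.1, hC.2]

lemma approx {μ : ProbabilityMeasure ↥(SigmaD (M + 2) N)} (h : μ ∈ Me0 (M + 2) N ∪ MeAl (M + 2) N) (j : ℕ) :
    ∃ W : PerW M N, W.meas ∈ NB μ j := by
  have he : Ergodic (shiftD (M + 2) N) μ.toMeasure := by
    rcases h with h | h
    · exact h.1
    · exact h.1
  have hA := ae_allM h
  obtain ⟨m, hm⟩ : ∃ m : ℕ, ∀ i < j, ((exists_cidx (DMSym (M + 2) N)).choose i).1 ≤ m :=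
    ⟨(Finset.range j).sup (fun i => ((exists_cidx (DMSym (M + 2) N)).choose i).1), fun i hi =>
      Finset.le_sup (f := fun i => ((exists_cidx (DMSym (M + 2) N)).choose i).1) (Finset.mem_range.2 hi)⟩
  set ε : ℝ := 1 / ((j : ℝ) + 1) / 8 with hε
  have hε0 : 0 < ε := by positivity
  obtain ⟨K, hK⟩ := FK_small hA m hε0
  have ib : ∀ (s : Set ↥(SigmaD (M + 2) N)) w, |s.indicator (fun _ => (1 : ℝ)) w| ≤ 1 := by
    intro s w
    by_cases hw : w ∈ s
    · simp [hw]
    · simp [hw]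
  have hF := birk_upper he (h := (FK (M + 2) N m K).indicator (fun _ => (1 : ℝ)))
    (measurable_const.indicator (FK_meas m K)) (ib _) (c := ε)
    (by rw [integral_indicator_const _ (FK_meas m K)]; simpa using hK)
  have hL := fun i => birk_lower he (h := (cset i).indicator (fun _ => (1 : ℝ)))
    (measurable_const.indicator (cset_meas i)) (ib _) (c := μ.toMeasure.real (cset i) - ε)
    (by rw [integral_indicator_const _ (cset_meas i)]; simpa using hε0)
  have hR := fun i => birk_upper he (h := (cset i).indicator (fun _ => (1 : ℝ)))
    (measurable_const.indicator (cset_meas i)) (ib _) (c := μ.toMeasure.real (cset i) + ε)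
    (by rw [integral_indicator_const _ (cset_meas i)]; simpa using hε0)
  obtain ⟨x, hx⟩ := (hF.and ((ae_all_iff.2 hL).and (ae_all_iff.2 hR))).exists
  obtain ⟨hx1, hx2, hx3⟩ := hx
  have hfin : ∀ᶠ n : ℕ in atTop, ∀ i ∈ Finset.range j,
      (μ.toMeasure.real (cset i) - ε) * n < birkhoffSum (shiftD (M + 2) N) ((cset i).indicator (fun _ => (1 : ℝ))) n x ∧
      birkhoffSum (shiftD (M + 2) N) ((cset i).indicator (fun _ => (1 : ℝ))) n x < (μ.toMeasure.real (cset i) + ε) * n :=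
    (Finset.eventually_all _).2 fun i _ => (hx2 i).and (hx3 i)
  obtain ⟨n0, hn0⟩ := exists_nat_gt ((2 * K + 2 * m + 3) / ε)
  obtain ⟨n, hn1, hn2, hn3⟩ := (hx1.and (hfin.and (eventually_ge_atTop n0))).exists
  have hn4 : (2 * K + 2 * m + 3 : ℝ) < ε * n := by
    rw [div_lt_iff₀ hε0] at hn0
    have : (n0 : ℝ) ≤ n := by exact_mod_cast hn3
    nlinarith
  have hnpos : (0 : ℝ) < n := by
    by_contra hc
    have : (0 : ℝ) ≤ n := Nat.cast_nonneg n
    have hz : (n : ℝ) = 0 := by linarith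
    rw [hz] at hn4
    have : (0 : ℝ) ≤ 2 * K + 2 * m + 3 := by positivity
    linarith
  obtain ⟨f, hf⟩ : ∃ f : ℕ, birkhoffSum (shiftD (M + 2) N) ((FK (M + 2) N m K).indicator (fun _ => (1 : ℝ))) n x = f := by
    classical
    refine ⟨∑ k ∈ Finset.range n, if (shiftD (M + 2) N)^[k] x ∈ FK (M + 2) N m K then 1 else 0, ?_⟩
    rw [birkhoffSum]
    push_cast
    exact Finset.sum_congr rfl fun k _ => by rw [Set.indicator_apply]
  have hb := ap_bad x n m K
  rw [hf] at hb hn1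
  have hb' : badC (kapS x.val) n < K + f + 2 := by
    have : badC (kapS x.val) n ≤ K + f := by exact_mod_cast hb
    omega
  refine ⟨apW (kapS x.val) n (K + f + 2) (by omega) hb', fun i hi => ?_⟩
  have hor := orb_real (apY (kapS x.val) n (K + f + 2)) (q := n + (K + f + 2)) (by omega) (cset_meas i)
  change |(orb (apY (kapS x.val) n (K + f + 2)) (q := n + (K + f + 2)) (by omega)).toMeasure.real (cset i) - _| < _
  rw [hor]
  have hcnt := ap_count x n (K + f + 2) m K (hm i hi) ((exists_cidx (DMSym (M + 2) N)).choose i).2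
  rw [hf] at hcnt
  obtain ⟨hs1, hs2⟩ := hn2 i (Finset.mem_range.2 hi)
  have := ap_arith (measureReal_nonneg) (measureReal_le_one) hnpos (q := ((n + (K + f + 2) : ℕ) : ℝ))
    (by push_cast; linarith [(Nat.cast_nonneg K : (0 : ℝ) ≤ K), (Nat.cast_nonneg f : (0 : ℝ) ≤ f)])
    (by push_cast; nlinarith [(Nat.cast_nonneg K : (0 : ℝ) ≤ K), (Nat.cast_nonneg m : (0 : ℝ) ≤ m)]) hcnt
    (by push_cast; nlinarith) hs1 hs2 hε0
  refine this.trans_le ?_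
  rw [hε]
  apply le_of_eq
  field_simp

end Approx

section Simplex
variable {A : Type*} [Fintype A] [MeasurableSpace A] [DiscreteMeasurableSpace A]

/-- the measure on a finite alphabet with given weights -/
noncomputable def lmS (f : stdSimplex ℝ A) : Measure A := ∑ a, ENNReal.ofReal (f.val a) • Measure.dirac a

lemma lmS_apply (f : stdSimplex ℝ A) (a : A) : lmS f {a} = ENNReal.ofReal (f.val a) := by
  classical
  simp only [lmS, Measure.finsetSum_apply, Measure.smul_apply, smul_eq_mul,
    Measure.dirac_apply' _ (MeasurableSet.singleton a)]
  rw [Finset.sum_eq_single a]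
  · simp
  · intro b _ hb; simp [hb]
  · simp

instance lmS_prob (f : stdSimplex ℝ A) : IsProbabilityMeasure (lmS f) := by
  constructor
  simp only [lmS, Measure.finsetSum_apply, Measure.smul_apply, smul_eq_mul, measure_univ, mul_one]
  rw [← ENNReal.ofReal_sum_of_nonneg (fun a _ => f.2.1 a), f.2.2, ENNReal.ofReal_one]

noncomputable def iidS (f : stdSimplex ℝ A) : ProbabilityMeasure (ℤ → A) := ⟨iidM (lmS f), inferInstance⟩

lemma iidS_cyl (f : stdSimplex ℝ A) (s : Finset ℤ) (y : ℤ → A) :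
    (iidS f).toMeasure {x | ∀ i ∈ s, x i = y i} = ∏ i ∈ s, ENNReal.ofReal (f.val (y i)) := by
  have : {x : ℤ → A | ∀ i ∈ s, x i = y i} = Set.pi s (fun i => {y i}) := by
    ext x; simp [Set.mem_pi]
  rw [this]
  change Measure.infinitePi (fun _ : ℤ => lmS f) _ = _
  rw [Measure.infinitePi_pi _ (fun i _ => MeasurableSet.singleton _)]
  simp only [lmS_apply]

lemma iidS_cyl_real (f : stdSimplex ℝ A) (s : Finset ℤ) (y : ℤ → A) :
    (iidS f).toMeasure.real {x | ∀ i ∈ s, x i = y i} = ∏ i ∈ s, f.val (y i) := by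
  rw [measureReal_def, iidS_cyl, ENNReal.toReal_prod]
  exact Finset.prod_congr rfl fun i _ => ENNReal.toReal_ofReal (f.2.1 _)

lemma cyl_measurable (s : Finset ℤ) (y : ℤ → A) : MeasurableSet {x : ℤ → A | ∀ i ∈ s, x i = y i} :=
  fin_dep_measurable s _ fun a a' h ha i hi => (h i hi).symm.trans (ha i hi)

lemma iidS_continuous [TopologicalSpace A] [DiscreteTopology A] [BorelSpace A] :
    Continuous (iidS : stdSimplex ℝ A → ProbabilityMeasure (ℤ → A)) := by
  rw [continuous_iff_continuousAt]
  intro f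
  refine tendsto_of_Cy (e := id) IsInducing.id fun m l => ?_
  by_cases hne : (Cy (id : (ℤ → A) → (ℤ → A)) m l).Nonempty
  · obtain ⟨y, hy⟩ := hne
    have : Cy (id : (ℤ → A) → (ℤ → A)) m l = {x | ∀ i ∈ Finset.Icc (-(m : ℤ)) m, x i = y i} := by
      ext x
      rw [← show _ = l from hy]
      change seg x _ _ = seg y _ _ ↔ _
      rw [seg_eq_iff]
      constructor
      · intro h i hi
        rw [Finset.mem_Icc] at hi
        exact h i (by omega) (by omega)
      · intro h i hi1 hi2
        exact h i (Finset.mem_Icc.2 ⟨by omega, by omega⟩)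
    rw [this]
    simp only [iidS_cyl_real]
    have hc : Continuous fun g : stdSimplex ℝ A => ∏ i ∈ Finset.Icc (-(m : ℤ)) m, g.val (y i) :=
      continuous_finset_prod _ fun i _ => (continuous_apply _).comp continuous_subtype_val
    exact hc.tendsto f
  · rw [Set.not_nonempty_iff_eq_empty] at hne
    rw [hne]
    simp

def shiftE (A : Type*) [MeasurableSpace A] : (ℤ → A) ≃ᵐ (ℤ → A) where
  toFun := shift
  invFun := shiftInv
  left_inv := shiftInv_shift
  right_inv := shift_shiftInv
  measurable_toFun := measurable_shift
  measurable_invFun := measurable_shiftInv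

lemma shiftInv_iterate {A : Type*} (k : ℕ) (x : ℤ → A) : shiftInv^[k] x = fun i => x (i - k) := by
  induction k generalizing x with
  | zero => funext i; simp
  | succ k ih =>
    rw [Function.iterate_succ_apply, ih]
    funext i
    simp only [shiftInv]
    congr 1; push_cast; ring

lemma recur_aux {X : Type*} [MeasurableSpace X] {T : X → X} {μ : Measure X}
    [IsProbabilityMeasure μ] (hT : Ergodic T μ) {E : Set X} (hE : MeasurableSet E) (hpos : 0 < μ E) :
    ∀ᵐ x ∂μ, ∀ n0 : ℕ, ∃ k ≥ n0, T^[k] x ∈ E := by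
  have h0 : 0 < μ.real E := ENNReal.toReal_pos hpos.ne' (measure_ne_top _ _)
  have := birk_lower hT (h := E.indicator fun _ => (1 : ℝ)) (measurable_const.indicator hE) (C := 1)
    (fun w => by by_cases hw : w ∈ E <;> simp [hw]) (c := μ.real E / 2)
    (by rw [integral_indicator_const _ hE]; simp; linarith)
  filter_upwards [this] with x hx n0
  by_contra hno
  push Not at hno
  obtain ⟨n1, hn1⟩ := exists_nat_gt ((n0 : ℝ) / (μ.real E / 2))
  obtain ⟨n, hn, hn2, hn3⟩ := (hx.and ((eventually_ge_atTop n1).and (eventually_ge_atTop n0))).exists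
  have hle : birkhoffSum T (E.indicator fun _ => (1 : ℝ)) n x ≤ n0 := by
    rw [birkhoffSum]
    refine le_trans (Finset.sum_le_sum fun k hk => ?_) (sum_ite_lt n n0)
    by_cases h : k < n0
    · rw [if_pos h]; exact Set.indicator_le_self' (fun _ _ => zero_le_one) _
    · rw [if_neg h, Set.indicator_of_notMem (hno k (by omega))]
  rw [div_lt_iff₀ (by linarith)] at hn1
  have : (n1 : ℝ) ≤ n := by exact_mod_cast hn2
  nlinarith

lemma iid_recur (f : stdSimplex ℝ A) {E : Set (ℤ → A)} (hE : MeasurableSet E)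
    (hpos : 0 < (iidS f).toMeasure E) :
    ∀ᵐ x ∂(iidS f).toMeasure, ∀ n0 : ℕ, (∃ k ≥ n0, shift^[k] x ∈ E) ∧ (∃ k ≥ n0, shiftInv^[k] x ∈ E) := by
  have he : Ergodic shift (iidS f).toMeasure := iid_ergodic (lmS f)
  have he2 : Ergodic (shiftE A) (iidS f).toMeasure := he
  have he3 : Ergodic shiftInv (iidS f).toMeasure := he2.symm
  filter_upwards [recur_aux he hE hpos, recur_aux he3 hE hpos] with x h1 h2 n0
  exact ⟨h1 n0, h2 n0⟩

lemma iid_bw (D : IData A) (f : stdSimplex ℝ A) (hb : 0 < f.val D.b) :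
    ∀ᵐ x ∂(iidS f).toMeasure, ∀ n0 : ℕ, (∃ l : ℤ, n0 ≤ l ∧ D.BW x l) ∧ (∃ l : ℤ, l ≤ -n0 ∧ D.BW x l) := by
  have hs : {x : ℤ → A | D.BW x 0} = {x | ∀ i ∈ Finset.Ico (0 : ℤ) (0 + D.R + 2), x i = (fun _ => D.b) i} := by
    ext x; simp [IData.BW]
  have hpos : 0 < (iidS f).toMeasure {x | D.BW x 0} := by
    rw [hs, iidS_cyl]
    exact pos_iff_ne_zero.2 (Finset.prod_ne_zero_iff.2 fun i _ => by simpa using hb)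
  have hm : MeasurableSet {x : ℤ → A | D.BW x 0} := by rw [hs]; exact cyl_measurable _ _
  filter_upwards [iid_recur f hm hpos] with x hx n0
  obtain ⟨⟨k, hk, h1⟩, ⟨k', hk', h2⟩⟩ := hx n0
  refine ⟨⟨k, by exact_mod_cast hk, fun m hm1 hm2 => ?_⟩, ⟨-k', by omega, fun m hm1 hm2 => ?_⟩⟩
  · have := h1 (m - k) (by omega) (by omega)
    rw [shift_iterate] at this
    simpa using this
  · have := h2 (m + k') (by omega) (by omega)
    rw [shiftInv_iterate] at this
    simpa using this

lemma iid_letter (f : stdSimplex ℝ A) {q c : A} (hc : 0 < f.val c) (hq : c ≠ q) :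
    ∀ᵐ x ∂(iidS f).toMeasure, (∃ l : ℤ, 0 < l ∧ x l ≠ q) ∧ (∃ l : ℤ, l < 0 ∧ x l ≠ q) := by
  have hs : {x : ℤ → A | x 0 = c} = {x | ∀ i ∈ ({0} : Finset ℤ), x i = (fun _ => c) i} := by
    ext x; simp
  have hpos : 0 < (iidS f).toMeasure {x | x 0 = c} := by
    rw [hs, iidS_cyl]
    exact pos_iff_ne_zero.2 (Finset.prod_ne_zero_iff.2 fun i _ => by simpa using hc)
  have hm : MeasurableSet {x : ℤ → A | x 0 = c} := by rw [hs]; exact cyl_measurable _ _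
  filter_upwards [iid_recur f hm hpos] with x hx
  obtain ⟨⟨k, hk, h1⟩, ⟨k', hk', h2⟩⟩ := hx 1
  refine ⟨⟨k, by omega, ?_⟩, ⟨-k', by omega, ?_⟩⟩
  · simp only [shift_iterate, Set.mem_ofPred_eq, zero_add] at h1
    rw [h1]; exact hq
  · simp only [shiftInv_iterate, Set.mem_ofPred_eq, zero_sub] at h2
    rw [h2]; exact hq

end Simplex

section Nu
variable {M N : ℕ} [NeZero M] (D : IData (BSym M N))

lemma ptPhi_measurable : Measurable fun x : ℤ → BSym M N => pt (D.Phi x) :=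
  pt_measurable.comp D.measurable_Phi

/-- the image measure -/
noncomputable def nu (f : stdSimplex ℝ (BSym M N)) : ProbabilityMeasure ↥(SigmaD M N) :=
  (iidS f).map (ptPhi_measurable D).aemeasurable

lemma nu_toMeasure (f : stdSimplex ℝ (BSym M N)) :
    (nu D f).toMeasure = Measure.map (fun x => pt (D.Phi x)) (iidS f).toMeasure := rfl

lemma nu_real (f : stdSimplex ℝ (BSym M N)) {s : Set ↥(SigmaD M N)} (hs : MeasurableSet s) :
    (nu D f).toMeasure.real s = (iidS f).toMeasure.real ((fun x => pt (D.Phi x)) ⁻¹' s) := by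
  rw [nu_toMeasure, map_measureReal_apply (ptPhi_measurable D) hs]

lemma nu_ergodic (f : stdSimplex ℝ (BSym M N)) : Ergodic (shiftD M N) (nu D f).toMeasure := by
  have he : Ergodic shift (iidS f).toMeasure := iid_ergodic (lmS f)
  have h1 : MeasurePreserving (fun x => pt (D.Phi x)) (iidS f).toMeasure (nu D f).toMeasure :=
    ⟨ptPhi_measurable D, rfl⟩
  have hc : (shiftD M N) ∘ (fun x => pt (D.Phi x)) = (fun x => pt (D.Phi x)) ∘ shift := by
    funext x
    simp only [Function.comp]
    rw [D.Phi_shift, pt_shift]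
  exact h1.ergodic_of_ergodic_semiconj he measurable_shiftD fun x => (congrFun hc x).symm

lemma nu_allM {f : stdSimplex ℝ (BSym M N)} (h : nu D f ∈ Dpos M N) :
    ∀ᵐ x ∂(iidS f).toMeasure, AllM (D.Phi x) := by
  have h1 := ae_allM (Or.inr (mem_MeAl_of_drift (nu_ergodic D f) h))
  rw [nu_toMeasure] at h1
  have := ae_of_ae_map (ptPhi_measurable D).aemeasurable h1
  filter_upwards [this] with x hx
  simpa only [pt, kapS_psi] using hx

variable {D} in
lemma loc_const {x : ℤ → BSym M N}
    (hbw : ∀ n0 : ℕ, (∃ l : ℤ, n0 ≤ l ∧ D.BW x l) ∧ (∃ l : ℤ, l ≤ -n0 ∧ D.BW x l))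
    (hA : AllM (D.Phi x)) (m : ℕ) :
    ∃ L : ℕ, ∀ x', (∀ i : ℤ, -L ≤ i → i ≤ L → x' i = x i) →
      ∀ t : ℤ, -m ≤ t → t ≤ m → psi (D.Phi x') t = psi (D.Phi x) t := by
  have : ∀ t : ℤ, ∃ n, D.Phi x t = .ra → ∃ k, topS (D.Phi x) t n = some k := by
    intro t
    by_cases h : D.Phi x t = .ra
    · obtain ⟨n, k, hk⟩ := hA t h
      exact ⟨n, fun _ => ⟨k, hk⟩⟩
    · exact ⟨0, fun h' => absurd h' h⟩
  choose n hn using this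
  set K := (Finset.Icc (-(m : ℤ)) m).sup n with hK
  obtain ⟨r, hr1, hr2⟩ := (hbw (m + 1)).1
  obtain ⟨l, hl1, hl2⟩ := (hbw (m + K + 1)).2
  push_cast at hr1 hl1
  refine ⟨(r + D.R + 2 - l).toNat, fun x' hx' t ht1 ht2 => ?_⟩
  have hK' : n t ≤ K := Finset.le_sup (Finset.mem_Icc.2 ⟨ht1, ht2⟩)
  refine psi_congr (n := K) ?_ ?_
  · intro h
    obtain ⟨k, hk⟩ := hn t h
    exact ⟨k, topS_mono hK' hk⟩
  · intro j hj1 hj2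
    exact IData.Phi_congr hl2 hr2 (fun i hi1 hi2 => hx' i (by omega) (by omega)) (by omega) (by omega) (by omega)

lemma win_open {A : Type*} [TopologicalSpace A] [DiscreteTopology A] (x : ℤ → A) (L : ℕ) :
    IsOpen {x' : ℤ → A | ∀ i : ℤ, -L ≤ i → i ≤ L → x' i = x i} :=
  fin_dep_open (Finset.Icc (-(L : ℤ)) L) _ fun y y' h hy i h1 h2 =>
    (h i (Finset.mem_Icc.2 ⟨h1, h2⟩)).symm.trans (hy i h1 h2)

lemma nu_continuousAt {f : stdSimplex ℝ (BSym M N)} (hb : 0 < f.val D.b) (h : nu D f ∈ Dpos M N) :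
    ContinuousAt (nu D) f := by
  refine tendsto_of_Cy (e := Subtype.val) IsInducing.subtypeVal fun m l => ?_
  have hm : MeasurableSet (Cy Subtype.val m l : Set ↥(SigmaD M N)) :=
    (Cy_clopen continuous_subtype_val m l).isOpen.measurableSet
  simp only [nu_real D _ hm]
  set E := (fun x : ℤ → BSym M N => pt (D.Phi x)) ⁻¹' (Cy Subtype.val m l) with hE
  have hfr : (iidS f).toMeasure (frontier E) = 0 := by
    rw [measure_eq_zero_iff_ae_notMem]
    filter_upwards [iid_bw D f hb, nu_allM D h] with x h1 h2
    obtain ⟨L, hL⟩ := loc_const h1 h2 m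
    have hiff : ∀ x' ∈ {x' : ℤ → BSym M N | ∀ i : ℤ, -L ≤ i → i ≤ L → x' i = x i}, (x' ∈ E ↔ x ∈ E) := by
      intro x' hx'
      have : seg (pt (D.Phi x')).val (-m) (2 * m + 1) = seg (pt (D.Phi x)).val (-m) (2 * m + 1) := by
        rw [seg_eq_iff]
        intro t ht1 ht2
        exact hL x' hx' t ht1 (by omega)
      change seg _ _ _ = l ↔ seg _ _ _ = l
      rw [this]
    have hmem : x ∈ {x' : ℤ → BSym M N | ∀ i : ℤ, -L ≤ i → i ≤ L → x' i = x i} := fun i _ _ => rfl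
    rw [← Set.mem_compl_iff, compl_frontier_eq_union_interior]
    by_cases hx : x ∈ E
    · exact Or.inl (mem_interior.2 ⟨_, fun x' hx' => (hiff x' hx').2 hx, win_open x L, hmem⟩)
    · exact Or.inr (mem_interior.2 ⟨_, fun x' hx' => fun h' => hx ((hiff x' hx').1 h'), win_open x L, hmem⟩)
  have := ProbabilityMeasure.tendsto_measure_of_null_frontier_of_tendsto' (iidS_continuous.tendsto f) (E := E) hfr
  exact (ENNReal.tendsto_toReal (measure_ne_top _ _)).comp this

end Nu

section FS
variable {M N : ℕ}

lemma red_fold (l : List (DMSym M N)) {bs as : List (Fin M)} (h : red l = some (bs, as)) (S : List (Fin M)) :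
    (l.map kap).foldl stkStep (bs ++ S) = as.reverse ++ S := by
  induction l using List.reverseRecOn generalizing bs as S with
  | nil => simp [red] at h; simp [h.1, h.2]
  | append_singleton l c ih =>
    rw [red_append_single] at h
    cases hr : red l with
    | none => rw [hr] at h; simp [dyckStep] at h
    | some q =>
      obtain ⟨bs', as'⟩ := q
      rw [hr] at h
      rw [List.map_append, List.foldl_append]
      cases c with
      | la k =>
        simp only [dyckStep, Option.some.injEq, Prod.mk.injEq] at h
        obtain ⟨rfl, rfl⟩ := h
        rw [ih hr]
        simp [kap, stkStep]
      | u k =>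
        simp only [dyckStep, Option.some.injEq, Prod.mk.injEq] at h
        obtain ⟨rfl, rfl⟩ := h
        rw [ih hr]
        simp [kap, stkStep]
      | ra k =>
        rcases List.eq_nil_or_concat as' with rfl | ⟨a, j, rfl⟩
        · simp only [dyckStep, List.getLast?_nil, Option.some.injEq, Prod.mk.injEq] at h
          obtain ⟨rfl, rfl⟩ := h
          rw [List.append_assoc, ih hr]
          simp [kap, stkStep]
        · simp only [dyckStep, List.concat_eq_append, List.getLast?_append, List.getLast?_singleton, Option.some_or] at h
          split_ifs at h with hj
          simp only [Option.some.injEq, Prod.mk.injEq] at h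
          obtain ⟨rfl, rfl⟩ := h
          rw [ih hr]
          simp [kap, stkStep]

lemma red_pre_word (l l2 : List (DMSym M N)) {bs as : List (Fin M)} (h : red (l ++ l2) = some (bs, as)) :
    ∃ bs1 as1, red l = some (bs1, as1) ∧ ∃ S, bs = bs1 ++ S := by
  induction l2 using List.reverseRecOn generalizing bs as with
  | nil => exact ⟨bs, as, by simpa using h, [], by simp⟩
  | append_singleton l2 c ih =>
    rw [← List.append_assoc, red_append_single] at h
    cases hr : red (l ++ l2) with
    | none => rw [hr] at h; simp [dyckStep] at h
    | some q =>
      obtain ⟨bs', as'⟩ := q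
      obtain ⟨b1, a1, h1, S, rfl⟩ := ih hr
      rw [hr] at h
      refine ⟨b1, a1, h1, ?_⟩
      cases c with
      | la k =>
        simp only [dyckStep, Option.some.injEq, Prod.mk.injEq] at h
        exact ⟨S, h.1.symm⟩
      | u k =>
        simp only [dyckStep, Option.some.injEq, Prod.mk.injEq] at h
        exact ⟨S, h.1.symm⟩
      | ra k =>
        simp only [dyckStep] at h
        split at h
        · simp only [Option.some.injEq, Prod.mk.injEq] at h
          exact ⟨S ++ [k], by rw [← h.1, List.append_assoc]⟩
        · split_ifs at h with hj
          simp only [Option.some.injEq, Prod.mk.injEq] at h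
          exact ⟨S, h.1.symm⟩

lemma red_ra_head (l l2 : List (DMSym M N)) (k : Fin M) {bs as : List (Fin M)}
    (h : red (l ++ .ra k :: l2) = some (bs, as)) :
    ((l.map kap).foldl stkStep bs).head? = some k := by
  have h' : red ((l ++ [.ra k]) ++ l2) = some (bs, as) := by simpa using h
  obtain ⟨b1, a1, h1, S, rfl⟩ := red_pre_word _ _ h'
  rw [red_append_single] at h1
  cases hr : red l with
  | none => rw [hr] at h1; simp [dyckStep] at h1
  | some q =>
    obtain ⟨bs', as'⟩ := q
    rw [hr] at h1
    rcases List.eq_nil_or_concat as' with rfl | ⟨a, j, rfl⟩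
    · simp only [dyckStep, List.getLast?_nil, Option.some.injEq, Prod.mk.injEq] at h1
      obtain ⟨rfl, rfl⟩ := h1
      rw [List.append_assoc, red_fold l hr]
      simp
    · simp only [dyckStep, List.concat_eq_append, List.getLast?_append, List.getLast?_singleton, Option.some_or] at h1
      split_ifs at h1 with hj
      simp only [Option.some.injEq, Prod.mk.injEq] at h1
      obtain ⟨rfl, rfl⟩ := h1
      rw [red_fold l hr]
      simp [hj]

lemma ext_word [NeZero M] (w : ↥(SigmaD M N)) (m : ℕ) (b1 : Fin M) :
    ∃ (y : ℤ → BSym M N) (L : ℕ), AllM y ∧ (∀ t : ℤ, -m ≤ t → t ≤ m → psi y t = w.val t) ∧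
      ∀ i : ℤ, i < -L ∨ L < i → y i = .la b1 := by
  have hne := (mem_SigmaD_iff _).1 w.2 (-m) (2 * m + 1)
  obtain ⟨⟨bs, as⟩, hr⟩ := Option.ne_none_iff_exists'.1 hne
  set y : ℤ → BSym M N := fun i => if i < -m then .la (bs.getD (-m - 1 - i).toNat b1)
    else if i ≤ m then kap (w.val i) else .la b1 with hy
  have hyw : ∀ t : ℤ, -m ≤ t → t ≤ m → y t = kap (w.val t) := by
    intro t h1 h2
    simp only [hy]
    rw [if_neg (by omega), if_pos h2]
  have hst : ∀ n, n ≤ bs.length → stk (seg y (-m - bs.length) n) = bs.drop (bs.length - n) := by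
    intro n
    induction n with
    | zero => intro _; simp [seg_zero, stk]
    | succ n ih =>
      intro hn
      rw [seg_succ, stk_append_single, ih (by omega)]
      have : y (-m - bs.length + n) = .la (bs[bs.length - (n + 1)]'(by omega)) := by
        simp only [hy]
        rw [if_pos (by omega), show (-(m : ℤ) - 1 - (-m - bs.length + n)).toNat = bs.length - (n + 1) by omega,
          List.getD_eq_getElem _ _ (by omega)]
      rw [this]
      simp only [stkStep]
      rw [List.drop_eq_getElem_cons (i := bs.length - (n + 1)) (by omega),
        show bs.length - (n + 1) + 1 = bs.length - n by omega]
  have htop : ∀ (t : ℤ) (k : Fin M), -m ≤ t → t ≤ m → w.val t = .ra k → topS y t (bs.length + (t + m).toNat) = some k := by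
    intro t k h1 h2 hk
    unfold topS
    rw [show t - ((bs.length + (t + m).toNat : ℕ) : ℤ) = -m - bs.length by push_cast; omega, seg_add, stk, List.foldl_append]
    have h3 := hst bs.length le_rfl
    rw [Nat.sub_self, List.drop_zero, stk] at h3
    rw [h3]
    have h4 : seg y (-m - bs.length + bs.length) (t + m).toNat = (seg w.val (-m) (t + m).toNat).map kap := by
      rw [← seg_map]
      refine seg_congr fun s hs => ?_
      rw [hyw _ (by omega) (by omega)]
      congr 2; ring_nf
    rw [h4]
    have h5 : seg w.val (-m) (2 * m + 1) = seg w.val (-m) (t + m).toNat ++ .ra k :: seg w.val (t + 1) (m - t).toNat := by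
      rw [show 2 * m + 1 = (t + m).toNat + 1 + (m - t).toNat by omega, seg_add, seg_succ, List.append_assoc]
      rw [show (-(m : ℤ) + ((t + m).toNat : ℤ)) = t by omega, hk]
      rw [show (-(m : ℤ) + (((t + m).toNat + 1 : ℕ) : ℤ)) = t + 1 by push_cast; omega]
      rfl
    rw [h5] at hr
    exact red_ra_head _ _ _ hr
  refine ⟨y, m + bs.length, ?_, ?_, ?_⟩
  · intro t ht
    have h1 : -m ≤ t := by
      by_contra h
      simp only [hy] at ht
      rw [if_pos (by omega)] at ht
      cases ht
    have h2 : t ≤ m := by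
      by_contra h
      simp only [hy] at ht
      rw [if_neg (by omega), if_neg h] at ht
      cases ht
    rw [hyw t h1 h2] at ht
    cases hw : w.val t with
    | la k => rw [hw] at ht; cases ht
    | u k => rw [hw] at ht; cases ht
    | ra k => exact ⟨_, k, htop t k h1 h2 hw⟩
  · intro t h1 h2
    unfold psi
    rw [hyw t h1 h2]
    cases hw : w.val t with
    | la k => rfl
    | u k => rfl
    | ra k => simp only [kap]; rw [labl_eq (htop t k h1 h2 hw)]
  · intro i hi
    simp only [hy]
    rcases hi with hi | hi
    · rw [if_pos (by push_cast at hi; omega), List.getD_eq_default _ _ (by push_cast at hi; omega)]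
    · rw [if_neg (by push_cast at hi; omega), if_neg (by push_cast at hi; omega)]

lemma nu_fullSupp [NeZero M] (D : IData (BSym M N)) {b1 : Fin M} (hb : D.b = .la b1)
    {f : stdSimplex ℝ (BSym M N)} (hf : ∀ a, 0 < f.val a) : FullSupp (nu D f) := by
  intro O hO ⟨w, hw⟩
  obtain ⟨m, hm⟩ := Cy_basis (e := Subtype.val) IsInducing.subtypeVal hO hw
  obtain ⟨y, L, hA, hyw, hyl⟩ := ext_word w m b1
  set x := D.Phi y with hx
  have hbw : ∀ n0 : ℕ, (∃ l : ℤ, n0 ≤ l ∧ D.BW x l) ∧ (∃ l : ℤ, l ≤ -n0 ∧ D.BW x l) := by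
    intro n0
    refine ⟨⟨n0 + L + 1, by omega, IData.bw_Phi_iff.2 fun i h1 h2 => ?_⟩,
      ⟨-n0 - L - 1 - D.R - 2, by omega, IData.bw_Phi_iff.2 fun i h1 h2 => ?_⟩⟩
    · rw [hb]; exact hyl i (Or.inr (by omega))
    · rw [hb]; exact hyl i (Or.inl (by omega))
  have hPx : D.Phi x = y := by rw [hx, D.Phi_Phi]
  obtain ⟨K, hK⟩ := loc_const hbw (by rw [hPx]; exact hA) m
  rw [nu_toMeasure, Measure.map_apply (ptPhi_measurable D) hO.measurableSet]
  refine lt_of_lt_of_le ?_ (measure_mono (s := {x' | ∀ i ∈ Finset.Icc (-(K : ℤ)) K, x' i = x i}) ?_)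
  · rw [iidS_cyl]
    exact pos_iff_ne_zero.2 (Finset.prod_ne_zero_iff.2 fun i _ => by simpa using hf _)
  · intro x' hx'
    apply hm
    change seg _ _ _ = seg _ _ _
    rw [seg_eq_iff]
    intro t h1 h2
    change psi (D.Phi x') t = _
    rw [hK x' (fun i h1 h2 => hx' i (Finset.mem_Icc.2 ⟨h1, h2⟩)) t h1 (by omega), hPx]
    exact hyw t h1 (by omega)

lemma nu_bw [NeZero M] (D : IData (BSym M N)) (f : stdSimplex ℝ (BSym M N)) :
    (nu D f).toMeasure.real {x | D.BW (kapS x.val) 0} = f.val D.b ^ (D.R + 2) := by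
  have hm : MeasurableSet {x : ↥(SigmaD M N) | D.BW (kapS x.val) 0} := by
    refine (kapS_measurable.comp measurable_subtype_coe) (t := {y | D.BW y 0}) ?_
    refine fin_dep_measurable (Finset.Ico (0 : ℤ) (0 + D.R + 2)) _ fun y y' h hy i h1 h2 => ?_
    rw [← h i (Finset.mem_Ico.2 ⟨h1, h2⟩)]
    exact hy i h1 h2
  rw [nu_real D f hm]
  have hs : (fun x => pt (D.Phi x)) ⁻¹' {x : ↥(SigmaD M N) | D.BW (kapS x.val) 0} =
      {x | ∀ i ∈ Finset.Ico (0 : ℤ) (0 + D.R + 2), x i = (fun _ => D.b) i} := by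
    ext x
    change D.BW (kapS (psi (D.Phi x))) 0 ↔ _
    rw [kapS_psi, IData.bw_Phi_iff]
    simp [IData.BW]
  rw [hs, iidS_cyl_real]
  simp only [Finset.prod_const, Int.card_Ico]
  congr 1
  omega

lemma nu_bernoulli [NeZero M] (D : IData (BSym M N)) {f : stdSimplex ℝ (BSym M N)}
    (h : nu D f ∈ Dpos M N) : IsBernoulli (shiftD M N) (nu D f).toMeasure := by
  classical
  set enc : BSym M N → ℕ := fun a => (Fintype.equivFin (BSym M N) a : ℕ) with henc
  have hinj : Function.Injective enc := fun a a' h => (Fintype.equivFin _).injective (Fin.ext h)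
  have : Nonempty (BSym M N) := ⟨.ra⟩
  set dec := Function.invFun enc with hdec
  have hde : ∀ a, dec (enc a) = a := Function.leftInverse_invFun hinj
  have hencm : Measurable enc := Measurable.of_discrete
  have hdecm : Measurable dec := Measurable.of_discrete
  have hpq : IsProbabilityMeasure (Measure.map enc (lmS f)) := Measure.isProbabilityMeasure_map hencm.aemeasurable
  set q := Measure.map enc (lmS f) with hq
  set E : (ℤ → BSym M N) → (ℤ → ℕ) := fun x i => enc (x i) with hE
  set F : (ℤ → ℕ) → (ℤ → BSym M N) := fun x i => dec (x i) with hF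
  have hEm : Measurable E := measurable_pi_lambda _ fun i => hencm.comp (measurable_pi_apply i)
  have hFm : Measurable F := measurable_pi_lambda _ fun i => hdecm.comp (measurable_pi_apply i)
  have hFE : ∀ x, F (E x) = x := fun x => funext fun i => hde _
  have hmapE : Measure.map E (iidS f).toMeasure = iidM q := by
    change Measure.map E (Measure.infinitePi fun _ : ℤ => lmS f) = Measure.infinitePi fun _ : ℤ => q
    rw [← Measure.infinitePi_map_pi (fun _ : ℤ => lmS f) (f := fun _ : ℤ => enc) (fun _ => hencm)]
  have hkm : Measurable fun x : ↥(SigmaD M N) => D.Phi (kapS x.val) :=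
    D.measurable_Phi.comp (kapS_measurable.comp measurable_subtype_coe)
  have hkk : ∀ x, D.Phi (kapS (pt (D.Phi x)).val) = x := by
    intro x
    change D.Phi (kapS (psi _)) = x
    rw [kapS_psi, D.Phi_Phi]
  refine ⟨fun n => q {n}, iidM q, ?_, inferInstance, ?_, fun x => E (D.Phi (kapS x.val)), fun y => pt (D.Phi (F y)),
    hEm.comp hkm, (ptPhi_measurable D).comp hFm, ?_, ?_, ?_, ?_, ?_⟩
  · have := measure_iUnion (μ := q) (f := fun n : ℕ => ({n} : Set ℕ))
      (fun i j hij => Set.disjoint_singleton.2 hij) (fun n => MeasurableSet.singleton n)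
    rw [← this, Set.iUnion_of_singleton, measure_univ]
  · intro n w j
    obtain ⟨ι, hι⟩ : ∃ ι : Fin n ↪ ℤ, ∀ i, ι i = j + ((i : ℕ) : ℤ) :=
      ⟨⟨fun i : Fin n => j + ((i : ℕ) : ℤ), fun a b hab => by
        simp only at hab; exact Fin.ext (by omega)⟩, fun _ => rfl⟩
    set s : Finset ℤ := Finset.univ.map ι with hs
    set v : ℤ → ℕ := fun t => if h : (t - j).toNat < n then w ⟨(t - j).toNat, h⟩ else 0 with hv
    have hvw : ∀ i : Fin n, v (j + (i : ℕ)) = w i := by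
      intro i
      simp only [hv]
      rw [dif_pos (by omega)]
      congr 1
      exact Fin.ext (by simp)
    have : {y : ℤ → ℕ | ∀ i : Fin n, y (j + (i : ℕ)) = w i} = Set.pi s (fun i => {v i}) := by
      ext y
      simp [hs, Set.mem_pi, hι, hvw]
    rw [this]
    change Measure.infinitePi (fun _ : ℤ => q) _ = _
    rw [Measure.infinitePi_pi _ (fun i _ => MeasurableSet.singleton _), hs, Finset.prod_map]
    simp [hι, hvw]
  · rw [nu_toMeasure, Measure.map_map (g := fun x : ↥(SigmaD M N) => E (D.Phi (kapS x.val))) (hEm.comp hkm) (ptPhi_measurable D)]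
    rw [← hmapE]
    congr 1
    funext x
    change E (D.Phi (kapS (pt (D.Phi x)).val)) = _
    rw [hkk]
  · rw [← hmapE, Measure.map_map (g := fun y => pt (D.Phi (F y))) ((ptPhi_measurable D).comp hFm) hEm, nu_toMeasure]
    congr 1
    funext x
    simp only [Function.comp, hFE]
  · have h1 := ae_allM (Or.inr (mem_MeAl_of_drift (nu_ergodic D f) h))
    filter_upwards [h1] with x hx
    simp only [hFE, D.Phi_Phi]
    exact Subtype.ext (psi_kapS x.2 hx)
  · rw [← hmapE]
    have hme : MeasurableSet {y : ℤ → ℕ | E (D.Phi (kapS (pt (D.Phi (F y))).val)) = y} :=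
      measurableSet_eq_fun (hEm.comp (hkm.comp ((ptPhi_measurable D).comp hFm))) measurable_id
    rw [ae_map_iff hEm.aemeasurable hme]
    refine Eventually.of_forall fun x => ?_
    rw [hFE, hkk]
  · refine Eventually.of_forall fun x => ?_
    change E (D.Phi (kapS (shift x.val))) = _
    rw [kapS_shift, D.Phi_shift]
    rfl
end FS

section Limit
variable {M N : ℕ}

lemma PerW.periodic (W : PerW M N) : Function.Periodic W.y (W.p : ℤ) := W.per

lemma PerW.mod (W : PerW M N) (s i : ℤ) : ∃ j < W.p, W.y (s + (j : ℕ)) = W.y i := by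
  have hp : (0 : ℤ) < W.p := by exact_mod_cast W.hp
  have h1 := Int.emod_nonneg (i - s) hp.ne'
  have h2 := Int.emod_lt_of_pos (i - s) hp
  refine ⟨((i - s) % W.p).toNat, by omega, ?_⟩
  have h3 := (W.periodic.int_mul ((i - s) / W.p)) (s + ((((i - s) % W.p).toNat : ℕ) : ℤ))
  rw [← h3]
  congr 1
  have := Int.emod_add_mul_ediv (i - s) W.p
  rw [Int.toNat_of_nonneg h1, Int.cast_id]
  linarith [mul_comm (W.p : ℤ) ((i - s) / W.p)]

lemma PerW.seg_drift (W : PerW M N) (s : ℤ) : 0 < ((seg W.y s W.p).map hB).sum := by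
  have hp : (0 : ℤ) < W.p := by exact_mod_cast W.hp
  have hd := W.drift
  rw [sum_seg] at hd ⊢
  have h1 := Int.emod_nonneg s hp.ne'
  have h3 : ∀ k : ℕ, W.y (s + k) = W.y (((s % W.p).toNat + k : ℕ) : ℤ) := by
    intro k
    have h3 := (W.periodic.int_mul (s / W.p)) (((s % W.p).toNat + k : ℕ) : ℤ)
    rw [← h3]
    congr 1
    have := Int.emod_add_mul_ediv s W.p
    push_cast
    rw [Int.toNat_of_nonneg h1]
    linarith [mul_comm (W.p : ℤ) (s / W.p)]
  have h4 := per_sum_shift (f := fun k : ℕ => (hB (W.y (k : ℤ)) : ℝ)) (p := W.p) (fun k => by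
    have := W.per k
    push_cast
    rw [this]) (s % W.p).toNat
  simp only [h3]
  simp only [zero_add] at hd
  have h5 : ((∑ k ∈ Finset.range W.p, hB (W.y (((s % W.p).toNat + k : ℕ) : ℤ)) : ℤ) : ℝ) =
      ((∑ k ∈ Finset.range W.p, hB (W.y (k : ℤ)) : ℤ) : ℝ) := by
    push_cast at h4 ⊢
    exact h4
  rw [Int.cast_inj.1 h5]
  exact hd

def wsel (W1 W2 : PerW M N) (c : BSym (M + 2) N) : PerW M N := if c = .ra then W1 else W2

lemma wsel_p {W1 W2 : PerW M N} (h : W2.p = W1.p) (c : BSym (M + 2) N) : (wsel W1 W2 c).p = W1.p := by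
  unfold wsel; split_ifs; exacts [rfl, h]

/-- the involution data attached to two periodic words -/
def mkD (W1 W2 : PerW M N) (h : W2.p = W1.p) : IData (BSym (M + 2) N) where
  z := .la 0
  b := .la 1
  w c s := (wsel W1 W2 c).y s
  R := W1.p
  hzb := by simp
  hwz := by
    intro c s
    obtain ⟨i, hi⟩ := (wsel W1 W2 c).nz
    obtain ⟨j, hj, he⟩ := (wsel W1 W2 c).mod s i
    rw [wsel_p h] at hj
    exact ⟨j, hj, by push_cast; rwa [he]⟩
  hwb := by
    intro c s
    obtain ⟨i, hi⟩ := (wsel W1 W2 c).nb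
    obtain ⟨j, hj, he⟩ := (wsel W1 W2 c).mod s i
    rw [wsel_p h] at hj
    exact ⟨j, hj, by push_cast; rwa [he]⟩

lemma core (W1 W2 : PerW M N) (h : W2.p = W1.p) {x : ℤ → BSym (M + 2) N} {m n r : ℕ}
    (l : List (DMSym (M + 2) N))
    (hn : m + 2 * W1.p + 3 < n) (hr : m + 2 * W1.p + 3 < r) (hxn : x (-n) ≠ .la 0) (hxr : x r ≠ .la 0)
    (hx : ∀ i : ℤ, -n < i → i < r → x i = .la 0) :
    ∑ k ∈ Finset.range W1.p, (Cy Subtype.val m l).indicator (fun _ => (1 : ℝ))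
        (pt (shift^[k] ((mkD W1 W2 h).Phi x))) =
      W1.p * (wsel W1 W2 (x (-n))).meas.toMeasure.real (Cy Subtype.val m l) := by
  set D := mkD W1 W2 h with hD
  set V := wsel W1 W2 (x (-n)) with hV
  have hVp : V.p = W1.p := wsel_p h _
  have hR : D.R = W1.p := rfl
  have hOcc : D.Occ x (-n + 1) (r + n - 1) false := by
    refine ⟨by omega, ?_, ?_, ?_⟩
    · rw [show (-(n : ℤ) + 1 - 1) = -n by ring]; exact hxn
    · rw [show (-(n : ℤ) + 1 + ((r + n - 1 : ℕ) : ℤ)) = r by omega]; exact hxr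
    · intro j hj
      simp only [IData.Tm]
      exact hx _ (by omega) (by omega)
  set s := n - W1.p - 2 with hs
  set y' := shift^[s] V.y with hy'
  have hPhi : ∀ t : ℤ, -n + W1.p + 2 ≤ t → t < r - W1.p - 2 → D.Phi x t = y' t := by
    intro t h1 h2
    rw [hOcc.Phi (by omega) (by omega), hy', shift_iterate]
    rw [show (-(n : ℤ) + 1 - 1) = -n by ring]
    simp only [IData.Tm, Bool.not_false, if_true]
    rw [if_neg (by omega), if_neg (by omega), if_pos (by omega)]
    change V.y _ = _
    congr 1
    omega
  have hpsi : ∀ t : ℤ, -m ≤ t → t < m + W1.p → psi (D.Phi x) t = psi y' t := by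
    intro t h1 h2
    refine psi_congr (n := W1.p) ?_ (fun j h3 h4 => hPhi j (by omega) (by omega))
    intro _
    have h5 := V.seg_drift (t - W1.p + s)
    have h6 : seg y' (t - W1.p) W1.p = seg V.y (t - W1.p + s) V.p := by
      rw [hVp]
      refine seg_congr fun j _ => ?_
      rw [hy', shift_iterate]
      simp only
      congr 1; ring
    have h7 : stk (seg y' (t - W1.p) W1.p) ≠ [] := by
      intro h0
      have := hB_le_stk (seg y' (t - W1.p) W1.p)
      rw [h0, h6] at this
      simp at this
      omega
    exact ⟨_, List.head?_eq_some_head h7⟩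
  have hmem : ∀ k < W1.p, (pt (shift^[k] (D.Phi x)) ∈ Cy Subtype.val m l ↔ pt (shift^[s + k] V.y) ∈ Cy Subtype.val m l) := by
    intro k hk
    have h1 : seg (psi (shift^[k] (D.Phi x))) (-m) (2 * m + 1) = seg (psi (shift^[s + k] V.y)) (-m) (2 * m + 1) := by
      rw [Nat.add_comm s k, Function.iterate_add_apply, ← hy', seg_eq_iff]
      have hps : ∀ y : ℤ → BSym (M + 2) N, psi (shift^[k] y) = shift^[k] (psi y) := by
        intro y
        have := congrArg Subtype.val (pt_iterate y k)
        rw [shift_iterate k (psi y)]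
        funext i
        rw [← show _ = psi y (i + k) from shiftD_iterate k (pt y) i]
        exact congrFun this i
      intro t h1 h2
      rw [hps, hps, shift_iterate, shift_iterate]
      exact hpsi _ (by omega) (by omega)
    change seg _ _ _ = l ↔ seg _ _ _ = l
    change seg (psi _) _ _ = l ↔ seg (psi _) _ _ = l
    rw [h1]
  have hms : MeasurableSet (Cy Subtype.val m l : Set ↥(SigmaD (M + 2) N)) :=
    (Cy_clopen continuous_subtype_val m l).isOpen.measurableSet
  have hVr := orb_real V.y V.hp hms
  rw [PerW.meas, hVr, hVp, mul_inv_cancel_left₀ (by have := W1.hp; positivity)]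
  have h8 := per_sum_shift (f := fun k => (Cy Subtype.val m l).indicator (fun _ => (1 : ℝ)) (pt (shift^[k] V.y)))
    (p := W1.p) (fun k => by rw [← hVp, iter_per V.per]) s
  rw [← h8]
  refine Finset.sum_congr rfl fun k hk => ?_
  have := hmem k (Finset.mem_range.1 hk)
  by_cases h9 : pt (shift^[k] (D.Phi x)) ∈ Cy Subtype.val m l
  · rw [Set.indicator_of_mem h9, Set.indicator_of_mem (this.1 h9)]
  · rw [Set.indicator_of_notMem h9, Set.indicator_of_notMem (fun hh => h9 (this.2 hh))]

end Limit

section Limit2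
variable {M N : ℕ}

def Tn (M N : ℕ) (n : ℕ) : Set (ℤ → BSym (M + 2) N) :=
  {x | ∀ i ∈ insert (-((n : ℤ) + 1)) (Finset.Icc (-(n : ℤ)) (-1)), x i = if i = -((n : ℤ) + 1) then .ra else .la 0}

lemma mem_Tn {n : ℕ} {x : ℤ → BSym (M + 2) N} : x ∈ Tn M N n ↔
    x (-((n : ℤ) + 1)) = .ra ∧ ∀ i : ℤ, -((n : ℤ) + 1) < i → i < 0 → x i = .la 0 := by
  constructor
  · intro h
    refine ⟨by simpa using h (-((n : ℤ) + 1)) (by simp), fun i h1 h2 => ?_⟩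
    have := h i (Finset.mem_insert_of_mem (Finset.mem_Icc.2 ⟨by omega, by omega⟩))
    rwa [if_neg (by omega)] at this
  · rintro ⟨h1, h2⟩ i hi
    rcases Finset.mem_insert.1 hi with rfl | hi
    · rw [if_pos rfl]; exact h1
    · rw [Finset.mem_Icc] at hi
      rw [if_neg (by omega)]
      exact h2 i (by omega) (by omega)

lemma Tn_meas (n : ℕ) : MeasurableSet (Tn M N n) := cyl_measurable _ _

lemma Tn_measure (f : stdSimplex ℝ (BSym (M + 2) N)) (n : ℕ) :
    (iidS f).toMeasure (Tn M N n) = ENNReal.ofReal (f.val .ra * f.val (.la 0) ^ n) := by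
  have h := iidS_cyl_real f (insert (-((n : ℤ) + 1)) (Finset.Icc (-(n : ℤ)) (-1)))
    (fun i => if i = -((n : ℤ) + 1) then .ra else .la 0)
  rw [Finset.prod_insert (by simp)] at h
  simp only [if_true] at h
  rw [Finset.prod_congr rfl (g := fun _ => f.val (.la 0)) (fun i hi => by
    rw [Finset.mem_Icc] at hi; rw [if_neg (by omega)])] at h
  rw [Finset.prod_const, Int.card_Icc, show (-1 + 1 - (-(n : ℤ))).toNat = n by omega] at h
  rw [← h, ofReal_measureReal]
  rfl

lemma T_measure (f : stdSimplex ℝ (BSym (M + 2) N)) {ε θ : ℝ} (hε : 0 < ε)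
    (hz : f.val (.la 0) = 1 - ε) (hr : f.val .ra = ε * θ) :
    (iidS f).toMeasure.real (⋃ n, Tn M N n) = θ := by
  have h0 : 0 ≤ 1 - ε := hz ▸ f.2.1 _
  have h1 : 0 ≤ ε * θ := hr ▸ f.2.1 _
  have hdis : Pairwise (Function.onFun Disjoint (Tn M N)) := by
    have key : ∀ i j : ℕ, i < j → Disjoint (Tn M N i) (Tn M N j) := by
      intro i j hij
      rw [Set.disjoint_left]
      intro x h1 h2
      rw [mem_Tn] at h1 h2
      have := h2.2 (-((i : ℤ) + 1)) (by omega) (by omega)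
      rw [h1.1] at this
      cases this
    intro i j hij
    rcases lt_or_gt_of_ne hij with h | h
    · exact key i j h
    · exact (key j i h).symm
  rw [measureReal_def, measure_iUnion hdis Tn_meas]
  simp only [Tn_measure, hz, hr]
  have hs : HasSum (fun n : ℕ => ε * θ * (1 - ε) ^ n) (ε * θ * (1 - (1 - ε))⁻¹) :=
    (hasSum_geometric_of_lt_one h0 (by linarith)).mul_left _
  rw [← ENNReal.ofReal_tsum_of_nonneg (fun n => mul_nonneg h1 (pow_nonneg h0 n)) hs.summable, hs.tsum_eq]
  rw [ENNReal.toReal_ofReal (by rw [sub_sub_cancel]; positivity)]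
  rw [sub_sub_cancel]
  field_simp

lemma nu_bound (W1 W2 : PerW M N) (h : W2.p = W1.p) (f : stdSimplex ℝ (BSym (M + 2) N)) {ε θ : ℝ}
    (hε : 0 < ε) (hz : f.val (.la 0) = 1 - ε) (hr : f.val .ra = ε * θ) (m : ℕ) (l : List (DMSym (M + 2) N)) :
    |(nu (mkD W1 W2 h) f).toMeasure.real (Cy Subtype.val m l) -
      (θ * W1.meas.toMeasure.real (Cy Subtype.val m l) + (1 - θ) * W2.meas.toMeasure.real (Cy Subtype.val m l))| ≤
      1 - (1 - ε) ^ (2 * (m + 2 * W1.p + 3) + 1) := by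
  classical
  set D := mkD W1 W2 h with hD
  set c : Set ↥(SigmaD (M + 2) N) := Cy Subtype.val m l with hc
  have hcm : MeasurableSet c := (Cy_clopen continuous_subtype_val m l).isOpen.measurableSet
  set P := (iidS f).toMeasure with hP
  set B := m + 2 * W1.p + 3 with hB
  set T : Set (ℤ → BSym (M + 2) N) := ⋃ n, Tn M N n with hT
  have hTm : MeasurableSet T := MeasurableSet.iUnion Tn_meas
  set Good : Set (ℤ → BSym (M + 2) N) := {x | ∀ i ∈ Finset.Icc (-(B : ℤ)) B, x i = (fun _ => .la 0) i} with hGood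
  have hGm : MeasurableSet Good := cyl_measurable _ _
  have hGP : P.real Good = (1 - ε) ^ (2 * B + 1) := by
    rw [hP, hGood, iidS_cyl_real]
    simp only [Finset.prod_const, Int.card_Icc, hz]
    congr 1
    omega
  set a1 := W1.meas.toMeasure.real c with ha1
  set a2 := W2.meas.toMeasure.real c with ha2
  have hp0 : (0 : ℝ) < W1.p := by exact_mod_cast W1.hp
  set F : (ℤ → BSym (M + 2) N) → ℝ := fun x => ∑ k ∈ Finset.range W1.p, c.indicator (fun _ => (1 : ℝ)) (pt (shift^[k] (D.Phi x))) with hF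
  set G : (ℤ → BSym (M + 2) N) → ℝ := fun x => T.indicator (fun _ => W1.p * (a1 - a2)) x + W1.p * a2 with hG
  have hkey : ∀ k, Integrable (fun x => c.indicator (fun _ => (1 : ℝ)) (pt (shift^[k] (D.Phi x)))) P ∧
      ∫ x, c.indicator (fun _ => (1 : ℝ)) (pt (shift^[k] (D.Phi x))) ∂P = (nu D f).toMeasure.real c := by
    intro k
    have hmk : Measurable (fun x => c.indicator (fun _ => (1 : ℝ)) ((shiftD (M + 2) N)^[k] x)) :=
      (measurable_const.indicator hcm).comp (measurable_shiftD.iterate k)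
    simp only [pt_iterate]
    constructor
    · refine Integrable.of_bound (hmk.comp (ptPhi_measurable D)).aestronglyMeasurable 1 (ae_of_all _ fun x => ?_)
      rw [Set.indicator_apply]
      split_ifs <;> simp
    · have h1 := integral_map (μ := P) (ptPhi_measurable D).aemeasurable (f := fun x => c.indicator (fun _ => (1 : ℝ)) ((shiftD (M + 2) N)^[k] x)) hmk.aestronglyMeasurable
      rw [← h1, hP, ← nu_toMeasure]
      have hmp := (nu_ergodic D f).toMeasurePreserving.iterate k
      have h2 := integral_map (μ := (nu D f).toMeasure) hmp.measurable.aemeasurable (f := c.indicator (fun _ => (1 : ℝ)))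
        (measurable_const.indicator hcm).aestronglyMeasurable
      rw [← h2, hmp.map_eq, integral_indicator_const _ hcm]
      simp
  have hFi : Integrable F P := integrable_finsetSum _ fun k _ => (hkey k).1
  have hFI : ∫ x, F x ∂P = W1.p * (nu D f).toMeasure.real c := by
    rw [hF, integral_finsetSum _ fun k _ => (hkey k).1]
    simp only [(hkey _).2, Finset.sum_const, Finset.card_range, nsmul_eq_mul]
  have hTi : Integrable (T.indicator (fun _ => W1.p * (a1 - a2))) P := (integrable_const _).indicator hTm
  have hGi : Integrable G P := hTi.add (integrable_const _)
  have hGI : ∫ x, G x ∂P = W1.p * (θ * a1 + (1 - θ) * a2) := by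
    rw [hG, integral_add hTi (integrable_const _), integral_indicator_const _ hTm, hP, T_measure f hε hz hr]
    simp
    ring
  obtain ⟨q, hq1, hq2⟩ : ∃ q, 0 < f.val q ∧ q ≠ .la 0 := by
    by_contra hcon
    push Not at hcon
    have h1 : ∑ a, f.val a = f.val (.la 0) := Finset.sum_eq_single _ (fun b _ hb => by
      by_contra h2
      exact hb (hcon b (lt_of_le_of_ne (f.2.1 b) (Ne.symm h2)))) (by simp)
    rw [f.2.2] at h1
    linarith
  have hpt : ∀ᵐ x ∂P, ‖F x - G x‖ ≤ Goodᶜ.indicator (fun _ => (W1.p : ℝ)) x := by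
    filter_upwards [iid_letter f hq1 hq2] with x hx
    have ha1' : a1 ∈ Set.Icc (0 : ℝ) 1 := ⟨measureReal_nonneg, measureReal_le_one⟩
    have ha2' : a2 ∈ Set.Icc (0 : ℝ) 1 := ⟨measureReal_nonneg, measureReal_le_one⟩
    by_cases hg : x ∈ Good
    · rw [Set.indicator_of_notMem (by simpa using hg)]
      suffices F x = G x by rw [this]; simp
      obtain ⟨⟨l1, hl1, hl1'⟩, ⟨l2, hl2, hl2'⟩⟩ := hx
      have hex1 : ∃ r : ℕ, 0 < r ∧ x r ≠ .la 0 := ⟨l1.toNat, by omega, by rwa [Int.toNat_of_nonneg hl1.le]⟩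
      have hex2 : ∃ n : ℕ, 0 < n ∧ x (-n) ≠ .la 0 := ⟨(-l2).toNat, by omega, by
        rwa [Int.toNat_of_nonneg (by omega), neg_neg]⟩
      obtain ⟨hr1, hr2⟩ := Nat.find_spec hex1
      obtain ⟨hn1, hn2⟩ := Nat.find_spec hex2
      have hrm := fun j => Nat.find_min hex1 (m := j)
      have hnm := fun j => Nat.find_min hex2 (m := j)
      set r := Nat.find hex1
      set n := Nat.find hex2
      have hrB : B < r := by
        by_contra hcon
        exact hr2 (hg r (Finset.mem_Icc.2 ⟨by omega, by omega⟩))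
      have hnB : B < n := by
        by_contra hcon
        exact hn2 (hg (-n) (Finset.mem_Icc.2 ⟨by omega, by omega⟩))
      have hxx : ∀ i : ℤ, -n < i → i < r → x i = .la 0 := by
        intro i h1 h2
        rcases lt_trichotomy i 0 with h3 | h3 | h3
        · have := hnm (-i).toNat (by omega)
          by_contra h4
          exact this ⟨by omega, by rwa [Int.toNat_of_nonneg (by omega), neg_neg]⟩
        · rw [h3]; exact hg 0 (Finset.mem_Icc.2 ⟨by omega, by omega⟩)
        · have := hrm i.toNat (by omega)
          by_contra h4
          exact this ⟨by omega, by rwa [Int.toNat_of_nonneg (by omega)]⟩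
      have hcore := core W1 W2 h l hnB hrB hn2 hr2 hxx
      rw [hF, hG]
      simp only
      rw [hcore]
      by_cases hra : x (-n) = .ra
      · have hxT : x ∈ T := by
          refine Set.mem_iUnion.2 ⟨n - 1, mem_Tn.2 ⟨?_, fun i h1 h2 => hxx i (by omega) (by omega)⟩⟩
          rw [show (-(((n - 1 : ℕ) : ℤ) + 1)) = -n by omega]
          exact hra
        rw [Set.indicator_of_mem hxT, wsel, if_pos hra]
        ring
      · have hxT : x ∉ T := by
          intro hxT
          obtain ⟨n', hn'⟩ := Set.mem_iUnion.1 hxT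
          rw [mem_Tn] at hn'
          rcases lt_trichotomy n (n' + 1) with h3 | h3 | h3
          · exact hn2 (hn'.2 (-n) (by omega) (by omega))
          · rw [h3] at hra
            exact hra (by push_cast; exact hn'.1)
          · have := hxx (-((n' : ℤ) + 1)) (by omega) (by omega)
            rw [hn'.1] at this
            cases this
        rw [Set.indicator_of_notMem hxT, wsel, if_neg hra]
        ring
    · rw [Set.indicator_of_mem (by simpa using hg)]
      have hF0 : 0 ≤ F x := Finset.sum_nonneg fun k _ => Set.indicator_nonneg (by simp) _
      have hF1 : F x ≤ W1.p := by
        refine (Finset.sum_le_card_nsmul _ _ 1 fun k _ => ?_).trans (by simp)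
        rw [Set.indicator_apply]; split_ifs <;> simp
      have hG01 : 0 ≤ G x ∧ G x ≤ W1.p := by
        rw [hG]
        simp only
        rw [Set.indicator_apply]
        split_ifs
        · have : W1.p * (a1 - a2) + W1.p * a2 = W1.p * a1 := by ring
          rw [this]
          exact ⟨mul_nonneg hp0.le ha1'.1, by nlinarith [ha1'.2]⟩
        · rw [zero_add]
          exact ⟨mul_nonneg hp0.le ha2'.1, by nlinarith [ha2'.2]⟩
      rw [Real.norm_eq_abs, abs_le]
      constructor <;> linarith [hG01.1, hG01.2]
  have hfin : |W1.p * ((nu D f).toMeasure.real c - (θ * a1 + (1 - θ) * a2))| ≤ W1.p * (1 - (1 - ε) ^ (2 * B + 1)) := by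
    have e1 : W1.p * ((nu D f).toMeasure.real c - (θ * a1 + (1 - θ) * a2)) = ∫ x, (F x - G x) ∂P := by
      rw [integral_sub hFi hGi, hFI, hGI]; ring
    rw [e1, ← Real.norm_eq_abs]
    refine (norm_integral_le_of_norm_le ((integrable_const _).indicator hGm.compl) hpt).trans (le_of_eq ?_)
    rw [integral_indicator_const _ hGm.compl, probReal_compl_eq_one_sub hGm, hGP, smul_eq_mul, mul_comm]
  rw [abs_mul, abs_of_pos hp0] at hfin
  exact le_of_mul_le_mul_left hfin hp0

end Limit2

section Segment
variable {M N : ℕ}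

noncomputable def KK (M N : ℕ) : ℝ := (((Finset.univ : Finset (BSym (M + 2) N)).erase (.la 0)).erase .ra).card

lemma KK_pos : 0 < KK M N := by
  unfold KK
  have : 0 < (((Finset.univ : Finset (BSym (M + 2) N)).erase (.la 0)).erase .ra).card :=
    Finset.card_pos.2 ⟨.la 1, by simp⟩
  exact_mod_cast this

/-- weights -/
noncomputable def fV (ε θ : ℝ) (a : BSym (M + 2) N) : ℝ :=
  if a = .la 0 then 1 - ε else if a = .ra then ε * θ else ε * (1 - θ) / KK M N

lemma fV_sum (ε θ : ℝ) : ∑ a : BSym (M + 2) N, fV ε θ a = 1 := by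
  rw [← Finset.add_sum_erase _ _ (Finset.mem_univ (.la 0)), ← Finset.add_sum_erase _ _ (a := .ra) (by simp)]
  rw [Finset.sum_congr rfl (g := fun _ => ε * (1 - θ) / KK M N) (fun a ha => by
    simp only [Finset.mem_erase] at ha
    rw [fV, if_neg ha.2.1, if_neg ha.1])]
  rw [Finset.sum_const, nsmul_eq_mul, ← KK]
  have := (KK_pos (M := M) (N := N)).ne'
  rw [mul_div_cancel₀ _ this]
  simp [fV]
  ring

noncomputable def fS (M N : ℕ) (q : unitInterval × unitInterval) : stdSimplex ℝ (BSym (M + 2) N) :=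
  ⟨fV q.1 q.2, fun a => by
    have h1 := q.1.2.1
    have h2 := q.1.2.2
    have h3 := q.2.2.1
    have h4 := q.2.2.2
    have hK := KK_pos (M := M) (N := N)
    unfold fV
    split_ifs
    · linarith
    · exact mul_nonneg h1 h3
    · exact div_nonneg (mul_nonneg h1 (by linarith)) hK.le, fV_sum _ _⟩

lemma fS_continuous : Continuous (fS M N) := by
  refine Continuous.subtype_mk (continuous_pi fun a => ?_) _
  unfold fV
  split_ifs <;> fun_prop

lemma fS_pos {q : unitInterval × unitInterval} (h1 : 0 < (q.1 : ℝ)) (h1' : (q.1 : ℝ) < 1) (h2 : 0 < (q.2 : ℝ)) (h2' : (q.2 : ℝ) < 1)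
    (a : BSym (M + 2) N) : 0 < (fS M N q).val a := by
  have hK := KK_pos (M := M) (N := N)
  change 0 < fV _ _ a
  unfold fV
  split_ifs
  · linarith
  · exact mul_pos h1 h2
  · exact div_pos (mul_pos h1 (by linarith)) hK

/-- convex combination -/
noncomputable def mixP (μ ν : ProbabilityMeasure ↥(SigmaD (M + 2) N)) (θ : unitInterval) :
    ProbabilityMeasure ↥(SigmaD (M + 2) N) :=
  ⟨ENNReal.ofReal θ • μ.toMeasure + (1 - ENNReal.ofReal θ) • ν.toMeasure, ⟨by
    simp only [Measure.add_apply, Measure.smul_apply, measure_univ, smul_eq_mul, mul_one]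
    exact add_tsub_cancel_of_le (ENNReal.ofReal_le_one.2 θ.2.2)⟩⟩

lemma mixP_real (μ ν : ProbabilityMeasure ↥(SigmaD (M + 2) N)) (θ : unitInterval) (s) :
    (mixP μ ν θ).toMeasure.real s = θ * μ.toMeasure.real s + (1 - θ) * ν.toMeasure.real s := by
  rw [mix_real (ENNReal.ofReal_le_one.2 θ.2.2) (ρ := mixP μ ν θ) rfl, ENNReal.toReal_ofReal θ.2.1]

lemma mixP_one (μ ν : ProbabilityMeasure ↥(SigmaD (M + 2) N)) : mixP μ ν 1 = μ := by
  apply Subtype.ext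
  simp [mixP]

lemma mixP_zero (μ ν : ProbabilityMeasure ↥(SigmaD (M + 2) N)) : mixP μ ν 0 = ν := by
  apply Subtype.ext
  simp [mixP]

lemma nu_limit (W1 W2 : PerW M N) (h : W2.p = W1.p) (θ0 : unitInterval) :
    Tendsto (fun q => nu (mkD W1 W2 h) (fS M N q)) (𝓝[{q | 0 < (q.1 : ℝ)}] (0, θ0))
      (𝓝 (mixP W1.meas W2.meas θ0)) := by
  refine tendsto_of_Cy (e := Subtype.val) IsInducing.subtypeVal fun m l => ?_
  rw [mixP_real]
  set a1 := W1.meas.toMeasure.real (Cy Subtype.val m l)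
  set a2 := W2.meas.toMeasure.real (Cy Subtype.val m l)
  have h1 : Tendsto (fun q : unitInterval × unitInterval => (q.2 : ℝ) * a1 + (1 - q.2) * a2)
      (𝓝[{q | 0 < (q.1 : ℝ)}] (0, θ0)) (𝓝 (θ0 * a1 + (1 - θ0) * a2)) := by
    have : Continuous (fun q : unitInterval × unitInterval => (q.2 : ℝ) * a1 + (1 - q.2) * a2) := by fun_prop
    exact (this.tendsto (0, θ0)).mono_left nhdsWithin_le_nhds
  have h2 : Tendsto (fun q : unitInterval × unitInterval => (1 : ℝ) - (1 - q.1) ^ (2 * (m + 2 * W1.p + 3) + 1))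
      (𝓝[{q | 0 < (q.1 : ℝ)}] (0, θ0)) (𝓝 0) := by
    have : Continuous (fun q : unitInterval × unitInterval => (1 : ℝ) - (1 - q.1) ^ (2 * (m + 2 * W1.p + 3) + 1)) := by fun_prop
    have h3 := (this.tendsto (0, θ0)).mono_left (nhdsWithin_le_nhds (s := {q | 0 < (q.1 : ℝ)}))
    simpa using h3
  have h3 : Tendsto (fun q : unitInterval × unitInterval => (nu (mkD W1 W2 h) (fS M N q)).toMeasure.real (Cy Subtype.val m l) -
      ((q.2 : ℝ) * a1 + (1 - q.2) * a2)) (𝓝[{q | 0 < (q.1 : ℝ)}] (0, θ0)) (𝓝 0) := by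
    refine squeeze_zero_norm' ?_ h2
    filter_upwards [self_mem_nhdsWithin] with q hq
    exact nu_bound W1 W2 h (fS M N q) hq (by simp [fS, fV]) (by simp [fS, fV]) m l
  simpa using h3.add h1

lemma exists_eps (W1 W2 : PerW M N) (h : W2.p = W1.p) {V : Set (ProbabilityMeasure ↥(SigmaD (M + 2) N))}
    (hV : IsOpen V) (hmix : ∀ θ, mixP W1.meas W2.meas θ ∈ V) :
    ∃ ε1 : unitInterval, 0 < (ε1 : ℝ) ∧ ∀ ε θ : unitInterval, 0 < (ε : ℝ) → ε ≤ ε1 → nu (mkD W1 W2 h) (fS M N (ε, θ)) ∈ V := by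
  have h1 : ∀ᶠ ε : unitInterval in 𝓝 0, ∀ θ ∈ (Set.univ : Set unitInterval), 0 < (ε : ℝ) → nu (mkD W1 W2 h) (fS M N (ε, θ)) ∈ V := by
    refine isCompact_univ.eventually_forall_of_forall_eventually fun θ0 _ => ?_
    have := (nu_limit W1 W2 h θ0).eventually (hV.mem_nhds (hmix θ0))
    rw [eventually_nhdsWithin_iff] at this
    exact this
  rw [Metric.eventually_nhds_iff] at h1
  obtain ⟨δ, hδ, h1⟩ := h1
  refine ⟨⟨min (δ / 2) 1, le_min (by positivity) zero_le_one, min_le_right _ _⟩, lt_min (by positivity) zero_lt_one, ?_⟩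
  intro ε θ h2 h3
  refine h1 ?_ θ trivial h2
  rw [Subtype.dist_eq, Real.dist_eq]
  have h4 : (ε : ℝ) ≤ min (δ / 2) 1 := h3
  have h5 := min_le_left (δ / 2) 1
  simp only [Set.Icc.coe_zero, sub_zero]
  rw [abs_of_pos h2]
  linarith

lemma cubic_finite (c : ℝ) : {t : unitInterval | (t : ℝ) ^ 2 * (1 - t) = c}.Countable := by
  have hne : (Polynomial.X ^ 2 * (1 - Polynomial.X) - Polynomial.C c : Polynomial ℝ) ≠ 0 := by
    intro h0
    have h1 := congrArg (Polynomial.eval 0) h0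
    have h2 := congrArg (Polynomial.eval (-1)) h0
    simp at h1 h2
    norm_num [h1] at h2
  have hf := (Polynomial.X ^ 2 * (1 - Polynomial.X) - Polynomial.C c : Polynomial ℝ).roots.toFinset.finite_toSet
  have := hf.preimage (f := (Subtype.val : unitInterval → ℝ)) Subtype.val_injective.injOn
  refine (this.subset fun t ht => ?_).countable
  simp only [Set.mem_preimage, Finset.mem_coe, Multiset.mem_toFinset]
  rw [Polynomial.mem_roots hne]
  simp only [Polynomial.IsRoot, Polynomial.eval_sub, Polynomial.eval_mul, Polynomial.eval_pow, Polynomial.eval_X,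
    Polynomial.eval_one, Polynomial.eval_C]
  have : (t : ℝ) ^ 2 * (1 - t) = c := ht
  linarith

lemma segment_eq (W1 W2 : PerW M N) (h : W2.p = W1.p) {V : Set (ProbabilityMeasure ↥(SigmaD (M + 2) N))}
    (hV : IsOpen V) (hmix : ∀ θ, mixP W1.meas W2.meas θ ∈ V) (hVD : V ⊆ Dpos (M + 2) N) :
    ∃ γ : unitInterval → ProbabilityMeasure ↥(SigmaD (M + 2) N), Continuous γ ∧ γ 0 = W1.meas ∧ γ 1 = W2.meas ∧
      (∀ t, γ t ∈ V ∧ γ t ∈ MeAl (M + 2) N) ∧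
      (∀ t, t ≠ 0 → t ≠ 1 → FullSupp (γ t) ∧ IsBernoulli (shiftD (M + 2) N) (γ t).toMeasure) ∧
      ∀ μ, {t | γ t = μ}.Countable := by
  classical
  obtain ⟨ε1, hε1, hε⟩ := exists_eps W1 W2 h hV hmix
  set D := mkD W1 W2 h with hD
  set Q : unitInterval → unitInterval × unitInterval := fun t => (ε1 * (t * unitInterval.symm t), unitInterval.symm t) with hQ
  have hQc : Continuous Q := by fun_prop
  set γ : unitInterval → ProbabilityMeasure ↥(SigmaD (M + 2) N) :=
    fun t => if t = 0 then W1.meas else if t = 1 then W2.meas else nu D (fS M N (Q t)) with hγ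
  have hγ0 : γ 0 = W1.meas := by simp [hγ]
  have hγ1 : γ 1 = W2.meas := by simp [hγ]
  have hγn : ∀ t, t ≠ 0 → t ≠ 1 → γ t = nu D (fS M N (Q t)) := by
    intro t h0 h1
    simp [hγ, h0, h1]
  have hpos : ∀ t : unitInterval, t ≠ 0 → 0 < (t : ℝ) := fun t ht => unitInterval.pos_iff_ne_zero.2 ht
  have hlt : ∀ t : unitInterval, t ≠ 1 → (t : ℝ) < 1 := fun t ht => unitInterval.lt_one_iff_ne_one.2 ht
  have hq1 : ∀ t : unitInterval, ((Q t).1 : ℝ) = ε1 * (t * (1 - t)) := fun t => by simp [hQ]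
  have hq2 : ∀ t : unitInterval, ((Q t).2 : ℝ) = 1 - t := fun t => by simp [hQ]
  have hQpos : ∀ t, t ≠ 0 → t ≠ 1 → 0 < ((Q t).1 : ℝ) := by
    intro t h0 h1
    rw [hq1]
    have := hpos t h0
    have := hlt t h1
    exact mul_pos hε1 (mul_pos (hpos t h0) (by linarith))
  have hQlt : ∀ t, t ≠ 0 → t ≠ 1 → ((Q t).1 : ℝ) < 1 := by
    intro t h0 h1
    rw [hq1]
    have h2 := hpos t h0
    have h3 := hlt t h1
    have h4 := ε1.2.2
    have h5 : (t : ℝ) * (1 - t) < 1 := by nlinarith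
    have h6 : 0 < (t : ℝ) * (1 - t) := mul_pos h2 (by linarith)
    nlinarith
  have hfpos : ∀ t, t ≠ 0 → t ≠ 1 → ∀ a, 0 < (fS M N (Q t)).val a := by
    intro t h0 h1 a
    have h2 := hpos t h0
    have h3 := hlt t h1
    exact fS_pos (hQpos t h0 h1) (hQlt t h0 h1) (by rw [hq2]; linarith) (by rw [hq2]; linarith) a
  have hnV : ∀ t, t ≠ 0 → t ≠ 1 → nu D (fS M N (Q t)) ∈ V := by
    intro t h0 h1
    refine hε (Q t).1 (Q t).2 (hQpos t h0 h1) ?_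
    change ((Q t).1 : ℝ) ≤ ε1
    rw [hq1]
    have h2 := hpos t h0
    have h3 := hlt t h1
    have h5 : (t : ℝ) * (1 - t) ≤ 1 := by nlinarith
    nlinarith
  have hlim : ∀ t0 : unitInterval, (Q t0).1 = 0 → Tendsto (fun t => nu D (fS M N (Q t))) (𝓝[{t | t ≠ 0 ∧ t ≠ 1}] t0)
      (𝓝 (mixP W1.meas W2.meas (Q t0).2)) := by
    intro t0 h0
    refine (nu_limit W1 W2 h (Q t0).2).comp ?_
    rw [tendsto_nhdsWithin_iff]
    refine ⟨?_, ?_⟩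
    · have := hQc.tendsto t0
      rw [show Q t0 = (0, (Q t0).2) from Prod.ext h0 rfl] at this
      exact this.mono_left nhdsWithin_le_nhds
    · filter_upwards [self_mem_nhdsWithin] with t ht
      exact hQpos t ht.1 ht.2
  have hend : ∀ t0 : unitInterval, (t0 = 0 ∨ t0 = 1) → ContinuousAt γ t0 := by
    intro t0 ht0
    have hQ0 : (Q t0).1 = 0 := by
      rcases ht0 with rfl | rfl
      · simp [hQ]
      · simp [hQ]
    have hval : γ t0 = mixP W1.meas W2.meas (Q t0).2 := by
      rcases ht0 with rfl | rfl
      · rw [hγ0]; simp [hQ, mixP_one]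
      · rw [hγ1]; simp [hQ, mixP_zero]
    rw [continuousAt_iff_punctured_nhds, hval]
    have hne : ∀ᶠ t in 𝓝[≠] t0, t ≠ 0 ∧ t ≠ 1 := by
      rcases ht0 with rfl | rfl
      · filter_upwards [self_mem_nhdsWithin, nhdsWithin_le_nhds (isOpen_ne.mem_nhds (show (0 : unitInterval) ≠ 1 from zero_ne_one))] with t h1 h2
        exact ⟨h1, h2⟩
      · filter_upwards [self_mem_nhdsWithin, nhdsWithin_le_nhds (isOpen_ne.mem_nhds (show (1 : unitInterval) ≠ 0 from one_ne_zero))] with t h1 h2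
        exact ⟨h2, h1⟩
    have hle : 𝓝[≠] t0 ≤ 𝓝[{t | t ≠ 0 ∧ t ≠ 1}] t0 := by
      refine le_inf nhdsWithin_le_nhds ?_
      rw [le_principal_iff]
      exact hne
    refine ((hlim t0 hQ0).mono_left hle).congr' ?_
    filter_upwards [hne] with t ht
    exact (hγn t ht.1 ht.2).symm
  refine ⟨γ, ?_, hγ0, hγ1, ?_, ?_, ?_⟩
  · rw [continuous_iff_continuousAt]
    intro t
    by_cases h0 : t = 0
    · exact hend t (Or.inl h0)
    by_cases h1 : t = 1
    · exact hend t (Or.inr h1)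
    have hc : ContinuousAt (fun t => nu D (fS M N (Q t))) t :=
      ContinuousAt.comp (g := nu D) (f := fun t => fS M N (Q t))
        (nu_continuousAt D (hfpos t h0 h1 _) (hVD (hnV t h0 h1))) (fS_continuous.comp hQc).continuousAt
    refine hc.congr ?_
    filter_upwards [isOpen_ne.mem_nhds h0, isOpen_ne.mem_nhds h1] with s h2 h3
    exact (hγn s h2 h3).symm
  · intro t
    by_cases h0 : t = 0
    · rw [h0, hγ0]
      exact ⟨by have := hmix 1; rwa [mixP_one] at this, W1.mem_MeAl⟩
    by_cases h1 : t = 1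
    · rw [h1, hγ1]
      exact ⟨by have := hmix 0; rwa [mixP_zero] at this, W2.mem_MeAl⟩
    rw [hγn t h0 h1]
    exact ⟨hnV t h0 h1, mem_MeAl_of_drift (nu_ergodic D _) (hVD (hnV t h0 h1))⟩
  · intro t h0 h1
    rw [hγn t h0 h1]
    exact ⟨nu_fullSupp D (b1 := 1) rfl (hfpos t h0 h1), nu_bernoulli D (hVD (hnV t h0 h1))⟩
  · intro μ
    by_cases hex : ∃ t0, t0 ≠ 0 ∧ t0 ≠ 1 ∧ γ t0 = μ
    · obtain ⟨t0, h0, h1, rfl⟩ := hex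
      refine (((cubic_finite ((t0 : ℝ) ^ 2 * (1 - t0))).insert 0).insert 1).mono fun t ht => ?_
      by_cases ht0 : t = 0
      · simp [ht0]
      by_cases ht1 : t = 1
      · simp [ht1]
      refine Or.inr (Or.inr ?_)
      have ht' : γ t = γ t0 := ht
      rw [hγn t ht0 ht1, hγn t0 h0 h1] at ht'
      have e1 := nu_bw D (fS M N (Q t))
      rw [ht', nu_bw D (fS M N (Q t0))] at e1
      have e2 := (pow_left_inj₀ ((fS M N (Q t0)).2.1 _) ((fS M N (Q t)).2.1 _) (by omega)).1 e1
      have hval : ∀ s : unitInterval, (fS M N (Q s)).val D.b = ε1 * (s * (1 - s)) * (1 - (1 - s)) / KK M N := by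
        intro s
        change fV (Q s).1 (Q s).2 (.la 1) = _
        rw [fV, if_neg (by simp), if_neg (by simp), hq1, hq2]
      rw [hval, hval] at e2
      have hK := KK_pos (M := M) (N := N)
      rw [div_left_inj' hK.ne'] at e2
      have e3 : (ε1 : ℝ) * ((t : ℝ) ^ 2 * (1 - t)) = ε1 * ((t0 : ℝ) ^ 2 * (1 - t0)) := by linarith
      exact mul_left_cancel₀ hε1.ne' e3
    · push Not at hex
      refine ((Set.countable_singleton (0 : unitInterval)).insert 1).mono fun t ht => ?_
      by_cases ht0 : t = 0
      · simp [ht0]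
      by_cases ht1 : t = 1
      · simp [ht1]
      exact absurd ht (hex t ht0 ht1)

lemma dm_segment (W1 W2 : PerW M N) {V : Set (ProbabilityMeasure ↥(SigmaD (M + 2) N))}
    (hV : IsOpen V) (hmix : ∀ θ, mixP W1.meas W2.meas θ ∈ V) (hVD : V ⊆ Dpos (M + 2) N) :
    ∃ γ : unitInterval → ProbabilityMeasure ↥(SigmaD (M + 2) N), Continuous γ ∧ γ 0 = W1.meas ∧ γ 1 = W2.meas ∧
      (∀ t, γ t ∈ V ∧ γ t ∈ MeAl (M + 2) N) ∧
      (∀ t, t ≠ 0 → t ≠ 1 → FullSupp (γ t) ∧ IsBernoulli (shiftD (M + 2) N) (γ t).toMeasure) ∧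
      ∀ μ, {t | γ t = μ}.Countable := by
  have h := segment_eq (W1.mul W2.p W2.hp) (W2.mul W1.p W1.hp) (mul_comm _ _) (V := V) hV
    (by simpa only [PerW.mul_meas] using hmix) hVD
  simpa only [PerW.mul_meas] using h

end Segment

section Glue

noncomputable def frI (s : ℝ) : unitInterval := ⟨Int.fract s, Int.fract_nonneg s, (Int.fract_lt_one s).le⟩

noncomputable def phI (t : unitInterval) : ℝ := (1 - (t : ℝ))⁻¹ - (t : ℝ)⁻¹

lemma arcs_continuous {X : Type*} [TopologicalSpace X] {γ : ℤ → unitInterval → X} (hc : ∀ k, Continuous (γ k))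
    (hm : ∀ k, γ k 1 = γ (k + 1) 0) : Continuous (fun s : ℝ => γ ⌊s⌋ (frI s)) := by
  have hlf : LocallyFinite (fun k : ℤ => Set.Icc (k : ℝ) (k + 1)) := by
    intro x
    refine ⟨Set.Ioo (x - 1) (x + 1), Ioo_mem_nhds (by linarith) (by linarith), ?_⟩
    refine (Set.finite_Icc (⌊x⌋ - 3) (⌊x⌋ + 3)).subset ?_
    rintro k ⟨y, ⟨h1, h2⟩, h3, h4⟩
    have h5 := Int.floor_le x
    have h6 := Int.lt_floor_add_one x
    constructor
    · have : ((⌊x⌋ - 3 : ℤ) : ℝ) ≤ k := by push_cast; linarith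
      exact_mod_cast this
    · have : (k : ℝ) ≤ ((⌊x⌋ + 3 : ℤ) : ℝ) := by push_cast; linarith
      exact_mod_cast this
  refine hlf.continuous ?_ (fun k => isClosed_Icc) ?_
  · ext x
    simp only [Set.mem_iUnion, Set.mem_univ, iff_true]
    exact ⟨⌊x⌋, Int.floor_le x, (Int.lt_floor_add_one x).le⟩
  · intro k
    have : ContinuousOn (fun s : ℝ => γ k (Set.projIcc 0 1 zero_le_one (s - k))) (Set.Icc (k : ℝ) (k + 1)) :=
      ((hc k).comp (continuous_projIcc.comp (continuous_id.sub continuous_const))).continuousOn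
    refine this.congr fun s hs => ?_
    rcases hs.2.lt_or_eq with h | h
    · have hf : ⌊s⌋ = k := Int.floor_eq_iff.2 ⟨hs.1, h⟩
      simp only [hf]
      congr 1
      apply Subtype.ext
      rw [Set.projIcc_of_mem zero_le_one ⟨by linarith [hs.1], by linarith⟩]
      change Int.fract s = s - k
      rw [Int.fract, hf]
    · have hf : ⌊s⌋ = k + 1 := by rw [h]; simp [Int.floor_add_one]
      have h2 : frI s = 0 := by
        apply Subtype.ext
        change Int.fract s = 0
        rw [Int.fract, hf, h]; push_cast; ring
      have h3 : Set.projIcc (0 : ℝ) 1 zero_le_one (s - k) = 1 := by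
        apply Set.projIcc_of_right_le
        rw [h]; linarith
      simp only [hf, h2]
      rw [h3]
      exact (hm k).symm

lemma phI_inj : Set.InjOn phI {t | t ≠ 0 ∧ t ≠ 1} := by
  have key : ∀ s t : unitInterval, s ≠ 0 → t ≠ 1 → s < t → phI s < phI t := by
    intro s t h0 h1 hst
    have hs : 0 < (s : ℝ) := unitInterval.pos_iff_ne_zero.2 h0
    have ht : (t : ℝ) < 1 := unitInterval.lt_one_iff_ne_one.2 h1
    have hst' : (s : ℝ) < t := hst
    have a1 : (t : ℝ)⁻¹ < (s : ℝ)⁻¹ := inv_strictAnti₀ hs hst'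
    have a2 : (1 - (s : ℝ))⁻¹ < (1 - (t : ℝ))⁻¹ := inv_strictAnti₀ (by linarith) (by linarith)
    unfold phI
    linarith
  intro s hs t ht h
  rcases lt_trichotomy s t with h1 | h1 | h1
  · exact absurd h (key s t hs.1 ht.2 h1).ne
  · exact h1
  · exact absurd h (key t s ht.1 hs.2 h1).ne'

lemma phI_cont {t : unitInterval} (h0 : t ≠ 0) (h1 : t ≠ 1) : ContinuousAt phI t := by
  have hs : 0 < (t : ℝ) := unitInterval.pos_iff_ne_zero.2 h0
  have ht : (t : ℝ) < 1 := unitInterval.lt_one_iff_ne_one.2 h1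
  unfold phI
  refine ContinuousAt.sub (ContinuousAt.inv₀ (by fun_prop) (by linarith)) (ContinuousAt.inv₀ (by fun_prop) hs.ne')

lemma phI_zero : Tendsto phI (𝓝[≠] 0) atBot := by
  have h1 : Tendsto (fun t : unitInterval => (t : ℝ)) (𝓝[≠] 0) (𝓝[>] 0) := by
    rw [tendsto_nhdsWithin_iff]
    refine ⟨?_, ?_⟩
    · have : Continuous (fun t : unitInterval => (t : ℝ)) := continuous_subtype_val
      have := (this.tendsto 0).mono_left (nhdsWithin_le_nhds (s := {0}ᶜ))
      simpa using this
    · filter_upwards [self_mem_nhdsWithin] with t ht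
      exact unitInterval.pos_iff_ne_zero.2 ht
  have h2 := tendsto_inv_nhdsGT_zero.comp h1
  have h3 : Tendsto (fun t : unitInterval => (1 - (t : ℝ))⁻¹) (𝓝[≠] 0) (𝓝 1) := by
    have : ContinuousAt (fun t : unitInterval => (1 - (t : ℝ))⁻¹) 0 := ContinuousAt.inv₀ (by fun_prop) (by simp)
    have := this.tendsto.mono_left (nhdsWithin_le_nhds (s := {0}ᶜ))
    simpa using this
  have := h3.add_atBot (tendsto_neg_atTop_atBot.comp h2)
  refine this.congr fun t => ?_
  simp [phI, sub_eq_add_neg]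

lemma phI_symm (t : unitInterval) : phI (unitInterval.symm t) = - phI t := by
  simp [phI]

lemma phI_one : Tendsto phI (𝓝[≠] 1) atTop := by
  have h1 : Tendsto unitInterval.symm (𝓝[≠] 1) (𝓝[≠] 0) := by
    rw [tendsto_nhdsWithin_iff]
    refine ⟨?_, ?_⟩
    · have := (unitInterval.continuous_symm.tendsto 1).mono_left (nhdsWithin_le_nhds (s := {1}ᶜ))
      simpa using this
    · filter_upwards [self_mem_nhdsWithin] with t ht
      intro h
      apply ht
      have := congrArg unitInterval.symm h
      simpa using this
  have h2 := tendsto_neg_atBot_atTop.comp (phI_zero.comp h1)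
  refine h2.congr fun t => ?_
  simp [phI_symm]

lemma glue {X : Type*} [TopologicalSpace X] {γ : ℤ → unitInterval → X} (hc : ∀ k, Continuous (γ k))
    (hm : ∀ k, γ k 1 = γ (k + 1) 0) (a b : X)
    (ha : ∀ V ∈ 𝓝 a, ∃ K : ℤ, ∀ k ≤ K, ∀ t, γ k t ∈ V)
    (hb : ∀ V ∈ 𝓝 b, ∃ K : ℤ, ∀ k ≥ K, ∀ t, γ k t ∈ V) :
    ∃ F : unitInterval → X, Continuous F ∧ F 0 = a ∧ F 1 = b ∧
      (∀ t, F t = a ∨ F t = b ∨ ∃ k s, F t = γ k s) ∧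
      ∀ S : Set X, (∀ k, {t | γ k t ∈ S}.Countable) → {t | F t ∈ S}.Countable := by
  classical
  set f : ℝ → X := fun s => γ ⌊s⌋ (frI s) with hf
  have hfc : Continuous f := arcs_continuous hc hm
  set F : unitInterval → X := fun t => if t = 0 then a else if t = 1 then b else f (phI t) with hF
  have hF0 : F 0 = a := by simp [hF]
  have hF1 : F 1 = b := by simp [hF]
  have hFn : ∀ t, t ≠ 0 → t ≠ 1 → F t = f (phI t) := by
    intro t h0 h1
    simp [hF, h0, h1]
  refine ⟨F, ?_, hF0, hF1, ?_, ?_⟩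
  · rw [continuous_iff_continuousAt]
    intro t
    by_cases h0 : t = 0
    · subst h0
      rw [continuousAt_iff_punctured_nhds, hF0]
      intro V hV
      obtain ⟨K, hK⟩ := ha V hV
      rw [Filter.mem_map]
      filter_upwards [phI_zero.eventually (eventually_le_atBot (K : ℝ)), self_mem_nhdsWithin,
        nhdsWithin_le_nhds (isOpen_ne.mem_nhds (show (0 : unitInterval) ≠ 1 from zero_ne_one))] with t h1 h2 h3
      change F t ∈ V
      rw [hFn t h2 h3]
      refine hK _ ?_ _
      have := (Int.floor_le (phI t)).trans h1
      exact_mod_cast this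
    by_cases h1 : t = 1
    · subst h1
      rw [continuousAt_iff_punctured_nhds, hF1]
      intro V hV
      obtain ⟨K, hK⟩ := hb V hV
      rw [Filter.mem_map]
      filter_upwards [phI_one.eventually (eventually_ge_atTop (K : ℝ)), self_mem_nhdsWithin,
        nhdsWithin_le_nhds (isOpen_ne.mem_nhds (show (1 : unitInterval) ≠ 0 from one_ne_zero))] with t h1 h2 h3
      change F t ∈ V
      rw [hFn t h3 h2]
      exact hK _ (Int.le_floor.2 h1) _
    have h2 : ContinuousAt (fun t => f (phI t)) t := ContinuousAt.comp (g := f) hfc.continuousAt (phI_cont h0 h1)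
    refine h2.congr ?_
    filter_upwards [isOpen_ne.mem_nhds h0, isOpen_ne.mem_nhds h1] with s h2 h3
    exact (hFn s h2 h3).symm
  · intro t
    by_cases h0 : t = 0
    · left; rw [h0, hF0]
    by_cases h1 : t = 1
    · right; left; rw [h1, hF1]
    exact Or.inr (Or.inr ⟨_, _, hFn t h0 h1⟩)
  · intro S hS
    have h1 : {t | (t ≠ 0 ∧ t ≠ 1) ∧ F t ∈ S}.Countable := by
      refine Set.countable_of_injective_of_countable_image (phI_inj.mono fun t ht => ht.1) ?_
      have h2 : (⋃ k : ℤ, (fun t : unitInterval => (k : ℝ) + t) '' {t | γ k t ∈ S}).Countable :=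
        Set.countable_iUnion fun k => (hS k).image _
      refine h2.mono ?_
      rintro _ ⟨t, ⟨ht, h3⟩, rfl⟩
      rw [hFn t ht.1 ht.2] at h3
      refine Set.mem_iUnion.2 ⟨⌊phI t⌋, frI (phI t), h3, ?_⟩
      exact Int.floor_add_fract _
    refine ((h1.insert 0).insert 1).mono fun t ht => ?_
    by_cases h0 : t = 0
    · simp [h0]
    by_cases h1 : t = 1
    · simp [h1]
    exact Or.inr (Or.inr ⟨⟨h0, h1⟩, ht⟩)

end Glue

section MainAlpha
variable {M N : ℕ}

lemma mixP_mem {V : Set (ProbabilityMeasure ↥(SigmaD (M + 2) N))} (hV : ConvexMeasSet V) {μ ν} (h1 : μ ∈ V) (h2 : ν ∈ V) (θ) :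
    mixP μ ν θ ∈ V := hV μ h1 ν h2 _ (ENNReal.ofReal_le_one.2 θ.2.2) _ rfl

lemma main_alpha (U : Set (ProbabilityMeasure ↥(SigmaD (M + 2) N)))
    (hU2 : ∃ V, IsOpen V ∧ U = V ∩ MinvD (M + 2) N)
    (hU3 : ConvexMeasSet U)
    (μp μm : ProbabilityMeasure ↥(SigmaD (M + 2) N))
    (hμp : μp ∈ U ∩ (Me0 (M + 2) N ∪ MeAl (M + 2) N)) (hμm : μm ∈ U ∩ (Me0 (M + 2) N ∪ MeAl (M + 2) N)) :
    ∃ p : unitInterval → ProbabilityMeasure ↥(SigmaD (M + 2) N),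
      HCPath (M + 2) N p ∧ p 0 = μp ∧ p 1 = μm ∧ ∀ t, p t ∈ U ∩ (Me0 (M + 2) N ∪ MeAl (M + 2) N) := by
  classical
  obtain ⟨V, hVo, rfl⟩ := hU2
  obtain ⟨jp, hjp⟩ := NB_basis hVo hμp.1.1
  obtain ⟨jm, hjm⟩ := NB_basis hVo hμm.1.1
  have hinv : ∀ W : PerW M N, W.meas ∈ MinvD (M + 2) N := fun W => W.ergodic.toMeasurePreserving
  have hW : ∀ k : ℤ, ∃ W : PerW M N, (k ≤ 0 → W.meas ∈ NB μp (jp + k.natAbs)) ∧ (1 ≤ k → W.meas ∈ NB μm (jm + k.natAbs)) := by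
    intro k
    by_cases hk : k ≤ 0
    · obtain ⟨W, h⟩ := approx hμp.2 (jp + k.natAbs)
      exact ⟨W, fun _ => h, fun h => by omega⟩
    · obtain ⟨W, h⟩ := approx hμm.2 (jm + k.natAbs)
      exact ⟨W, fun h => by omega, fun _ => h⟩
  choose W hW1 hW2 using hW
  have hWV : ∀ k, (W k).meas ∈ V ∩ MinvD (M + 2) N := by
    intro k
    refine ⟨?_, hinv _⟩
    by_cases hk : k ≤ 0
    · exact hjp (NB_anti _ (by omega) (hW1 k hk))
    · exact hjm (NB_anti _ (by omega) (hW2 k (by omega)))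
  have hseg : ∀ k : ℤ, ∃ γ : unitInterval → ProbabilityMeasure ↥(SigmaD (M + 2) N), Continuous γ ∧
      γ 0 = (W k).meas ∧ γ 1 = (W (k + 1)).meas ∧ (∀ t, γ t ∈ V ∧ γ t ∈ MeAl (M + 2) N) ∧
      (∀ t, t ≠ 0 → t ≠ 1 → FullSupp (γ t) ∧ IsBernoulli (shiftD (M + 2) N) (γ t).toMeasure) ∧
      (∀ μ, {t | γ t = μ}.Countable) ∧ (k < 0 → ∀ t, γ t ∈ NB μp (k + 1).natAbs) ∧
      (1 ≤ k → ∀ t, γ t ∈ NB μm k.natAbs) := by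
    intro k
    have hD := Dpos_convex (M := M + 2) (N := N)
    rcases lt_trichotomy k 0 with hk | hk | hk
    · obtain ⟨γ, h1, h2, h3, h4, h5, h6⟩ := dm_segment (W k) (W (k + 1))
        (V := NB μp (jp + (k + 1).natAbs) ∩ Dpos (M + 2) N) ((NB_open _ _).inter Dpos_open)
        (fun θ => ⟨mixP_mem (NB_convex _ _) (NB_anti _ (by omega) (hW1 k (by omega))) (hW1 (k + 1) (by omega)) θ,
          mixP_mem hD (W k).mem_Dpos (W (k + 1)).mem_Dpos θ⟩) Set.inter_subset_right
      exact ⟨γ, h1, h2, h3, fun t => ⟨hjp (NB_anti _ (by omega) (h4 t).1.1), (h4 t).2⟩, h5, h6,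
        fun _ t => NB_anti _ (by omega) (h4 t).1.1, fun h => by omega⟩
    · obtain ⟨γ, h1, h2, h3, h4, h5, h6⟩ := dm_segment (W k) (W (k + 1))
        (V := V ∩ Dpos (M + 2) N) (hVo.inter Dpos_open)
        (fun θ => ⟨(mixP_mem hU3 (hWV k) (hWV (k + 1)) θ).1,
          mixP_mem hD (W k).mem_Dpos (W (k + 1)).mem_Dpos θ⟩) Set.inter_subset_right
      exact ⟨γ, h1, h2, h3, fun t => ⟨(h4 t).1.1, (h4 t).2⟩, h5, h6, fun h => by omega, fun h => by omega⟩
    · obtain ⟨γ, h1, h2, h3, h4, h5, h6⟩ := dm_segment (W k) (W (k + 1))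
        (V := NB μm (jm + k.natAbs) ∩ Dpos (M + 2) N) ((NB_open _ _).inter Dpos_open)
        (fun θ => ⟨mixP_mem (NB_convex _ _) (hW2 k (by omega)) (NB_anti _ (by omega) (hW2 (k + 1) (by omega))) θ,
          mixP_mem hD (W k).mem_Dpos (W (k + 1)).mem_Dpos θ⟩) Set.inter_subset_right
      exact ⟨γ, h1, h2, h3, fun t => ⟨hjm (NB_anti _ (by omega) (h4 t).1.1), (h4 t).2⟩, h5, h6,
        fun h => by omega, fun _ t => NB_anti _ (by omega) (h4 t).1.1⟩
  choose γ h1 h2 h3 h4 h5 h6 h7 h8 using hseg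
  obtain ⟨F, hF, hF0, hF1, hFm, hFc⟩ := glue h1 (fun k => by rw [h2, h3]) μp μm
    (by
      intro V' hV'
      obtain ⟨O, hO1, hO2, hO3⟩ := mem_nhds_iff.1 hV'
      obtain ⟨j, hj⟩ := NB_basis hO2 hO3
      refine ⟨-(j : ℤ) - 1, fun k hk t => hO1 (hj (NB_anti _ ?_ (h7 k (by omega) t)))⟩
      omega)
    (by
      intro V' hV'
      obtain ⟨O, hO1, hO2, hO3⟩ := mem_nhds_iff.1 hV'
      obtain ⟨j, hj⟩ := NB_basis hO2 hO3
      refine ⟨(j : ℤ) + 1, fun k hk t => hO1 (hj (NB_anti _ ?_ (h8 k (by omega) t)))⟩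
      omega)
  have hmem : ∀ t, F t ∈ (V ∩ MinvD (M + 2) N) ∩ (Me0 (M + 2) N ∪ MeAl (M + 2) N) := by
    intro t
    rcases hFm t with h | h | ⟨k, s, h⟩
    · rw [h]; exact hμp
    · rw [h]; exact hμm
    · rw [h]
      exact ⟨⟨(h4 k s).1, (h4 k s).2.1.toMeasurePreserving⟩, Or.inr (h4 k s).2⟩
  refine ⟨F, ⟨hF, ?_, ?_, ?_⟩, hF0, hF1, hmem⟩
  · intro t
    rcases (hmem t).2 with h | h
    · exact h.1
    · exact h.1
  · refine hFc {μ | ¬(FullSupp μ ∧ IsBernoulli (shiftD (M + 2) N) μ.toMeasure)} fun k => ?_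
    refine ((Set.countable_singleton (0 : unitInterval)).insert 1).mono fun t ht => ?_
    by_cases h0 : t = 0
    · simp [h0]
    by_cases h1 : t = 1
    · simp [h1]
    exact absurd (h5 k t h0 h1) ht
  · intro t
    exact hFc {F t} fun k => h6 k (F t)

end MainAlpha

section Reflect
variable {M N : ℕ}

def flipS : DMSym M N → DMSym M N
  | .la k => .ra k
  | .u k => .u k
  | .ra k => .la k

lemma flipS_flipS (c : DMSym M N) : flipS (flipS c) = c := by cases c <;> rfl

/-- left multiplication by a generator -/
def lStep : DMSym M N → DyckElem M → DyckElem M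
  | _, none => none
  | .ra k, some (bs, as) => some (k :: bs, as)
  | .u _, some (bs, as) => some (bs, as)
  | .la k, some ([], as) => some ([], k :: as)
  | .la k, some (j :: bs, as) => if j = k then some (bs, as) else none

lemma dyck_ra_nil (bs : List (Fin M)) (k : Fin M) :
    dyckStep (some (bs, [])) (DMSym.ra k : DMSym M N) = some (bs ++ [k], []) := rfl

lemma dyck_ra_app (bs as : List (Fin M)) (j k : Fin M) :
    dyckStep (some (bs, as ++ [j])) (DMSym.ra k : DMSym M N) = if j = k then some (bs, as) else none := by
  simp [dyckStep]

lemma step_comm (c d : DMSym M N) (e : DyckElem M) : lStep c (dyckStep e d) = dyckStep (lStep c e) d := by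
  rcases e with _ | ⟨bs, as⟩
  · cases c <;> cases d <;> rfl
  · rcases List.eq_nil_or_concat as with rfl | ⟨a, j, rfl⟩
    · cases d with
      | la k =>
        cases c with
        | la l =>
          rcases bs with _ | ⟨b, bs⟩
          · rfl
          · simp only [dyckStep, lStep]; split_ifs <;> rfl
        | u l => rfl
        | ra l => rfl
      | u k =>
        cases c with
        | la l =>
          rcases bs with _ | ⟨b, bs⟩
          · rfl
          · simp only [dyckStep, lStep]; split_ifs <;> rfl
        | u l => rfl
        | ra l => rfl
      | ra k =>
        cases c with
        | la l =>
          rcases bs with _ | ⟨b, bs⟩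
          · simp only [dyckStep, lStep, List.getLast?_nil, List.nil_append, List.getLast?_singleton, List.dropLast_singleton]
            by_cases h : k = l
            · simp [h]
            · rw [if_neg h, if_neg (Ne.symm h)]
          · rw [dyck_ra_nil]
            simp only [lStep, List.cons_append]; split_ifs <;> rfl
        | u l => rfl
        | ra l => rfl
    · rw [List.concat_eq_append]
      cases d with
      | la k =>
        cases c with
        | la l =>
          rcases bs with _ | ⟨b, bs⟩
          · rfl
          · simp only [dyckStep, lStep]; split_ifs <;> rfl
        | u l => rfl
        | ra l => rfl
      | u k =>
        cases c with
        | la l =>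
          rcases bs with _ | ⟨b, bs⟩
          · rfl
          · simp only [dyckStep, lStep]; split_ifs <;> rfl
        | u l => rfl
        | ra l => rfl
      | ra k =>
        rw [dyck_ra_app]
        cases c with
        | la l =>
          rcases bs with _ | ⟨b, bs⟩
          · simp only [lStep]
            rw [← List.cons_append, dyck_ra_app]
            split_ifs <;> rfl
          · simp only [lStep]
            by_cases h : b = l
            · rw [if_pos h, dyck_ra_app]
              split_ifs <;> simp [lStep, h]
            · rw [if_neg h]
              split_ifs <;> simp [lStep, h, dyckStep]
        | u l => simp only [lStep]; rw [dyck_ra_app]; split_ifs <;> rfl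
        | ra l => simp only [lStep]; rw [dyck_ra_app]; split_ifs <;> rfl

lemma red_cons (c : DMSym M N) (l : List (DMSym M N)) : red (c :: l) = lStep c (red l) := by
  induction l using List.reverseRecOn with
  | nil => cases c <;> rfl
  | append_singleton l d ih =>
    rw [← List.cons_append, red_append_single, red_append_single, ih, step_comm]

def eRev : DyckElem M → DyckElem M := Option.map fun q => (q.2.reverse, q.1.reverse)

lemma eRev_step (e : DyckElem M) (d : DMSym M N) : eRev (dyckStep e d) = lStep (flipS d) (eRev e) := by
  rcases e with _ | ⟨bs, as⟩
  · cases d <;> rfl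
  · cases d with
    | la k => simp [dyckStep, eRev, flipS, lStep]
    | u k => simp [dyckStep, eRev, flipS, lStep]
    | ra k =>
      rcases List.eq_nil_or_concat as with rfl | ⟨a, j, rfl⟩
      · simp [dyckStep, eRev, flipS, lStep]
      · rw [List.concat_eq_append, dyck_ra_app]
        simp only [eRev, flipS, Option.map_some, List.reverse_append, List.reverse_cons, List.reverse_nil, List.nil_append,
          List.cons_append, lStep]
        split_ifs <;> rfl

lemma red_rev (l : List (DMSym M N)) : red ((l.map flipS).reverse) = eRev (red l) := by
  induction l using List.reverseRecOn with
  | nil => rfl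
  | append_singleton l d ih =>
    rw [List.map_append, List.reverse_append, List.map_singleton, List.reverse_singleton, List.singleton_append,
      red_cons, ih, red_append_single, eRev_step]

def rho (x : ℤ → DMSym M N) : ℤ → DMSym M N := fun i => flipS (x (-i))

lemma rho_rho (x : ℤ → DMSym M N) : rho (rho x) = x := by
  funext i; simp [rho, flipS_flipS]

lemma seg_rho (x : ℤ → DMSym M N) (i : ℤ) (n : ℕ) : seg (rho x) i n = ((seg x (1 - i - n) n).map flipS).reverse := by
  apply List.ext_getElem
  · simp [seg]
  · intro k h1 h2
    simp only [seg, List.length_map, List.length_range] at h1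
    simp only [seg, List.getElem_map, List.getElem_range, List.getElem_reverse, List.length_map, List.length_range, rho]
    congr 2
    omega

lemma rho_mem {x : ℤ → DMSym M N} (hx : x ∈ SigmaD M N) : rho x ∈ SigmaD M N := by
  rw [mem_SigmaD_iff] at *
  intro i n h
  rw [seg_rho, red_rev] at h
  apply hx (1 - i - n) n
  cases hr : red (seg x (1 - i - n) n) with
  | none => rfl
  | some q => rw [hr] at h; simp [eRev] at h

lemma rho_cont : Continuous (rho : (ℤ → DMSym M N) → (ℤ → DMSym M N)) :=
  continuous_pi fun i => continuous_of_discreteTopology.comp (continuous_apply (-i))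

def rhoD (M N : ℕ) : ↥(SigmaD M N) → ↥(SigmaD M N) := fun x => ⟨rho x.val, rho_mem x.2⟩

lemma rhoD_rhoD (x : ↥(SigmaD M N)) : rhoD M N (rhoD M N x) = x := Subtype.ext (rho_rho _)

lemma rhoD_cont : Continuous (rhoD M N) := (rho_cont.comp continuous_subtype_val).subtype_mk _

lemma rhoD_meas : Measurable (rhoD M N) :=
  (Measurable.subtype_mk (measurable_pi_lambda _ fun i =>
    (measurable_from_top (f := (flipS : DMSym M N → DMSym M N))).comp ((measurable_pi_apply (-i)).comp measurable_subtype_coe)))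

def rhoE (M N : ℕ) : ↥(SigmaD M N) ≃ᵐ ↥(SigmaD M N) where
  toFun := rhoD M N
  invFun := rhoD M N
  left_inv := rhoD_rhoD
  right_inv := rhoD_rhoD
  measurable_toFun := rhoD_meas
  measurable_invFun := rhoD_meas

lemma rhoD_shift (x : ↥(SigmaD M N)) : rhoD M N ((shiftDE M N).symm x) = shiftD M N (rhoD M N x) := by
  apply Subtype.ext
  funext i
  change flipS (x.val (-i - 1)) = flipS (x.val (-(i + 1)))
  congr 2
  ring

lemma Gfun_rho (x : ℤ → DMSym M N) (j : ℤ) : Gfun (rho x) j = - Gfun x (-j) := by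
  simp only [Gfun, rho]
  cases x (-j) <;> rfl

lemma Hfun_rho (x : ℤ → DMSym M N) (i : ℤ) : Hfun (rho x) i = Hfun x (1 - i) - Hfun x 1 := by
  have key : ∀ i, Hfun x (1 - i) = Hfun x (1 - (i + 1)) + Gfun x (-i) := by
    intro i
    have := Hfun_succ x (-i)
    rw [show 1 - i = -i + 1 by ring, show 1 - (i + 1) = -i by ring]
    exact this
  induction i using Int.induction_on with
  | zero => simp [Hfun_zero]
  | succ i ih =>
    rw [Hfun_succ, ih, Gfun_rho]
    have := key i
    linarith
  | pred i ih =>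
    have h1 := Hfun_succ (rho x) (-i - 1)
    rw [sub_add_cancel, ih, Gfun_rho] at h1
    have := key (-i - 1)
    rw [sub_add_cancel] at this
    linarith

lemma rho_A0 {x : ℤ → DMSym M N} (hx : x ∈ A0set M N) : rho x ∈ A0set M N := by
  refine ⟨rho_mem hx.1, fun i => ?_⟩
  obtain ⟨⟨j, h1, h2⟩, ⟨j', h3, h4⟩⟩ := hx.2 (1 - i)
  refine ⟨⟨j', h3, ?_⟩, ⟨j, h1, ?_⟩⟩
  · rw [Hfun_rho, Hfun_rho, ← h4]
    congr 2; ring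
  · rw [Hfun_rho, Hfun_rho, ← h2]
    congr 2; ring

lemma one_sub_top : Tendsto (fun i : ℤ => 1 - i) atTop atBot := by
  refine tendsto_atBot.2 fun b => ?_
  filter_upwards [eventually_ge_atTop (1 - b)] with i hi
  linarith

lemma one_sub_bot : Tendsto (fun i : ℤ => 1 - i) atBot atTop := by
  refine tendsto_atTop.2 fun b => ?_
  filter_upwards [eventually_le_atBot (1 - b)] with i hi
  linarith

lemma rho_Abe {x : ℤ → DMSym M N} (hx : x ∈ AbetaSet M N) : rho x ∈ AalphaSet M N := by
  refine ⟨rho_mem hx.1, ?_, ?_⟩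
  · have : Hfun (rho x) = fun i => Hfun x (1 - i) + (- Hfun x 1) := by
      funext i; rw [Hfun_rho]; ring
    rw [this]
    exact tendsto_atTop_add_const_right _ _ (hx.2.2.comp one_sub_top)
  · have : Hfun (rho x) = fun i => Hfun x (1 - i) + (- Hfun x 1) := by
      funext i; rw [Hfun_rho]; ring
    rw [this]
    exact tendsto_atBot_add_const_right _ _ (hx.2.1.comp one_sub_bot)

lemma rho_Aal {x : ℤ → DMSym M N} (hx : x ∈ AalphaSet M N) : rho x ∈ AbetaSet M N := by
  refine ⟨rho_mem hx.1, ?_, ?_⟩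
  · have : Hfun (rho x) = fun i => Hfun x (1 - i) + (- Hfun x 1) := by
      funext i; rw [Hfun_rho]; ring
    rw [this]
    exact tendsto_atBot_add_const_right _ _ (hx.2.2.comp one_sub_top)
  · have : Hfun (rho x) = fun i => Hfun x (1 - i) + (- Hfun x 1) := by
      funext i; rw [Hfun_rho]; ring
    rw [this]
    exact tendsto_atTop_add_const_right _ _ (hx.2.1.comp one_sub_bot)

noncomputable def RM (μ : ProbabilityMeasure ↥(SigmaD M N)) : ProbabilityMeasure ↥(SigmaD M N) :=
  μ.map (f := rhoD M N) rhoD_meas.aemeasurable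

lemma RM_apply (μ : ProbabilityMeasure ↥(SigmaD M N)) (s : Set ↥(SigmaD M N)) :
    (RM μ).toMeasure s = μ.toMeasure (rhoD M N ⁻¹' s) :=
  (rhoE M N).map_apply s

lemma RM_RM (μ : ProbabilityMeasure ↥(SigmaD M N)) : RM (RM μ) = μ := by
  apply Subtype.ext
  refine Measure.ext fun s _ => ?_
  change (RM (RM μ)).toMeasure s = μ.toMeasure s
  rw [RM_apply, RM_apply, ← Set.preimage_comp]
  have : rhoD M N ∘ rhoD M N = id := funext rhoD_rhoD
  rw [this]; rfl

lemma RM_cont : Continuous (RM : ProbabilityMeasure ↥(SigmaD M N) → _) :=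
  ProbabilityMeasure.continuous_map rhoD_cont

lemma RM_mp (μ : ProbabilityMeasure ↥(SigmaD M N)) : MeasurePreserving (rhoD M N) μ.toMeasure (RM μ).toMeasure :=
  ⟨rhoD_meas, rfl⟩

lemma RM_inv {μ : ProbabilityMeasure ↥(SigmaD M N)} (h : μ ∈ MinvD M N) : RM μ ∈ MinvD M N := by
  have h1 : MeasurePreserving (shiftDE M N) μ.toMeasure μ.toMeasure := h
  exact (RM_mp μ).of_semiconj (h1.symm) rhoD_shift measurable_shiftD

lemma RM_erg {μ : ProbabilityMeasure ↥(SigmaD M N)} (h : μ ∈ MergD M N) : RM μ ∈ MergD M N := by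
  have h1 : Ergodic (shiftDE M N) μ.toMeasure := h
  exact (RM_mp μ).ergodic_of_ergodic_semiconj (h1.symm) measurable_shiftD rhoD_shift

lemma RM_one {μ : ProbabilityMeasure ↥(SigmaD M N)} {A B : Set (ℤ → DMSym M N)} (hAB : ∀ x ∈ A, rho x ∈ B)
    (h : μ.toMeasure (Subtype.val ⁻¹' A) = 1) : (RM μ).toMeasure (Subtype.val ⁻¹' B) = 1 := by
  rw [RM_apply]
  refine le_antisymm prob_le_one ?_
  rw [← h]
  exact measure_mono fun x hx => hAB _ hx

lemma RM_Me0 {μ : ProbabilityMeasure ↥(SigmaD M N)} (h : μ ∈ Me0 M N) : RM μ ∈ Me0 M N :=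
  ⟨RM_erg h.1, RM_one (fun _ => rho_A0) h.2⟩

lemma RM_MeBe {μ : ProbabilityMeasure ↥(SigmaD M N)} (h : μ ∈ MeBe M N) : RM μ ∈ MeAl M N :=
  ⟨RM_erg h.1, RM_one (fun _ => rho_Abe) h.2⟩

lemma RM_MeAl {μ : ProbabilityMeasure ↥(SigmaD M N)} (h : μ ∈ MeAl M N) : RM μ ∈ MeBe M N :=
  ⟨RM_erg h.1, RM_one (fun _ => rho_Aal) h.2⟩

lemma RM_fs {μ : ProbabilityMeasure ↥(SigmaD M N)} (h : FullSupp μ) : FullSupp (RM μ) := by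
  intro O hO ⟨x, hx⟩
  rw [RM_apply]
  exact h _ (hO.preimage rhoD_cont) ⟨rhoD M N x, by rw [Set.mem_preimage, rhoD_rhoD]; exact hx⟩

def rvZ : (ℤ → ℕ) → (ℤ → ℕ) := fun y i => y (-i)

lemma rvZ_rvZ (y : ℤ → ℕ) : rvZ (rvZ y) = y := by funext i; simp [rvZ]

lemma rvZ_meas : Measurable rvZ := measurable_pi_lambda _ fun i => measurable_pi_apply (-i)

lemma RM_bern {μ : ProbabilityMeasure ↥(SigmaD M N)} (he : μ ∈ MinvD M N) (h : IsBernoulli (shiftD M N) μ.toMeasure) :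
    IsBernoulli (shiftD M N) (RM μ).toMeasure := by
  obtain ⟨p, ν, hp, hν, hcyl, φ, ψ, hφ, hψ, h1, h2, h3, h4, h5⟩ := h
  have hrr : rvZ ∘ rvZ = id := funext rvZ_rvZ
  have hρρ : rhoD M N ∘ rhoD M N = id := funext rhoD_rhoD
  have hR : (RM μ).toMeasure = μ.toMeasure.map (rhoD M N) := rfl
  have hinv : MeasurePreserving (shiftDE M N).symm μ.toMeasure μ.toMeasure := by
    have h1 : MeasurePreserving (shiftDE M N) μ.toMeasure μ.toMeasure := he
    exact h1.symm
  refine ⟨p, ν.map rvZ, hp, Measure.isProbabilityMeasure_map rvZ_meas.aemeasurable, ?_, rvZ ∘ φ ∘ rhoD M N,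
    rhoD M N ∘ ψ ∘ rvZ, rvZ_meas.comp (hφ.comp rhoD_meas), rhoD_meas.comp (hψ.comp rvZ_meas), ?_, ?_, ?_, ?_, ?_⟩
  · intro n w j
    rw [Measure.map_apply rvZ_meas]
    · have h6 := hcyl n (fun i => w (Fin.rev i)) (1 - j - n)
      rw [← Equiv.prod_comp Fin.revPerm (fun i => p (w i))]
      refine Eq.trans ?_ h6
      congr 1
      ext y
      simp only [Set.mem_preimage, Set.mem_ofPred_eq, rvZ]
      rw [← Fin.revPerm.forall_congr_right]
      refine forall_congr' fun i => ?_
      have : -(j + ((Fin.revPerm i : Fin n) : ℕ) : ℤ) = 1 - j - n + (i : ℕ) := by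
        simp only [Fin.revPerm_apply, Fin.val_rev]
        have := i.2
        omega
      rw [this]; rfl
    · have : {y : ℤ → ℕ | ∀ i : Fin n, y (j + (i : ℕ)) = w i} = ⋂ i : Fin n, (fun y : ℤ → ℕ => y (j + (i : ℕ))) ⁻¹' {w i} := by
        ext y; simp
      rw [this]
      exact MeasurableSet.iInter fun i => measurable_pi_apply _ (MeasurableSet.singleton _)
  · rw [hR, Measure.map_map (rvZ_meas.comp (hφ.comp rhoD_meas)) rhoD_meas, Function.comp_assoc, Function.comp_assoc, hρρ,
      Function.comp_id, ← Measure.map_map rvZ_meas hφ, h1]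
  · rw [Measure.map_map (rhoD_meas.comp (hψ.comp rvZ_meas)) rvZ_meas, Function.comp_assoc, Function.comp_assoc, hrr,
      Function.comp_id, ← Measure.map_map rhoD_meas hψ, h2, hR]
  · rw [hR]
    change ∀ᵐ x ∂(μ.toMeasure.map (rhoE M N)), _
    rw [(rhoE M N).measurableEmbedding.ae_map_iff]
    filter_upwards [h3] with x hx
    change rhoD M N (ψ (rvZ (rvZ (φ (rhoD M N (rhoD M N x)))))) = rhoD M N x
    rw [rvZ_rvZ, rhoD_rhoD, hx]
  · have hme : MeasurableEmbedding rvZ :=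
      (MeasurableEquiv.mk ⟨rvZ, rvZ, rvZ_rvZ, rvZ_rvZ⟩ rvZ_meas rvZ_meas : (ℤ → ℕ) ≃ᵐ (ℤ → ℕ)).measurableEmbedding
    rw [hme.ae_map_iff]
    filter_upwards [h4] with y hy
    change rvZ (φ (rhoD M N (rhoD M N (ψ (rvZ (rvZ y)))))) = rvZ y
    rw [rvZ_rvZ, rhoD_rhoD, hy]
  · rw [hR]
    change ∀ᵐ x ∂(μ.toMeasure.map (rhoE M N)), _
    rw [(rhoE M N).measurableEmbedding.ae_map_iff]
    filter_upwards [hinv.quasiMeasurePreserving.ae h5] with x hx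
    change rvZ (φ (rhoD M N (shiftD M N (rhoD M N x)))) = shift (rvZ (φ (rhoD M N (rhoD M N x))))
    rw [← rhoD_shift, rhoD_rhoD, rhoD_rhoD]
    have h6 : shiftD M N ((shiftDE M N).symm x) = x := (shiftDE M N).apply_symm_apply x
    rw [h6] at hx
    rw [hx]
    funext i
    simp only [rvZ, shift]
    congr 1
    ring

lemma RM_convex {U : Set (ProbabilityMeasure ↥(SigmaD M N))} (h : ConvexMeasSet U) : ConvexMeasSet (RM ⁻¹' U) := by
  intro μ hμ ν hν t ht ρ hρ
  refine h _ hμ _ hν t ht _ ?_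
  refine Measure.ext fun s _ => ?_
  rw [RM_apply, hρ]
  simp only [Measure.add_apply, Measure.smul_apply, RM_apply]

end Reflect

lemma main_beta {M N : ℕ} (U : Set (ProbabilityMeasure ↥(SigmaD (M + 2) N)))
    (hU2 : ∃ V, IsOpen V ∧ U = V ∩ MinvD (M + 2) N)
    (hU3 : ConvexMeasSet U)
    (μp μm : ProbabilityMeasure ↥(SigmaD (M + 2) N))
    (hμp : μp ∈ U ∩ (Me0 (M + 2) N ∪ MeBe (M + 2) N)) (hμm : μm ∈ U ∩ (Me0 (M + 2) N ∪ MeBe (M + 2) N)) :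
    ∃ p : unitInterval → ProbabilityMeasure ↥(SigmaD (M + 2) N),
      HCPath (M + 2) N p ∧ p 0 = μp ∧ p 1 = μm ∧ ∀ t, p t ∈ U ∩ (Me0 (M + 2) N ∪ MeBe (M + 2) N) := by
  have htr : ∀ μ ∈ U ∩ (Me0 (M + 2) N ∪ MeBe (M + 2) N), RM μ ∈ (RM ⁻¹' U) ∩ (Me0 (M + 2) N ∪ MeAl (M + 2) N) := by
    rintro μ ⟨h1, h2⟩
    refine ⟨by rw [Set.mem_preimage, RM_RM]; exact h1, ?_⟩
    rcases h2 with h2 | h2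
    · exact Or.inl (RM_Me0 h2)
    · exact Or.inr (RM_MeBe h2)
  have hU2' : ∃ V, IsOpen V ∧ RM ⁻¹' U = V ∩ MinvD (M + 2) N := by
    obtain ⟨V, hV, rfl⟩ := hU2
    refine ⟨RM ⁻¹' V, hV.preimage RM_cont, ?_⟩
    ext μ
    constructor
    · rintro ⟨h1, h2⟩
      refine ⟨h1, ?_⟩
      have := RM_inv h2
      rwa [RM_RM] at this
    · rintro ⟨h1, h2⟩
      exact ⟨h1, RM_inv h2⟩
  obtain ⟨p, ⟨hc, he, hb, hf⟩, h0, h1, hmem⟩ := main_alpha (RM ⁻¹' U) hU2' (RM_convex hU3) (RM μp) (RM μm)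
    (htr _ hμp) (htr _ hμm)
  refine ⟨fun t => RM (p t), ⟨RM_cont.comp hc, fun t => RM_erg (he t), ?_, ?_⟩, ?_, ?_, ?_⟩
  · refine hb.mono fun t ht => ?_
    have ht' : ¬(FullSupp (RM (p t)) ∧ IsBernoulli (shiftD (M + 2) N) (RM (p t)).toMeasure) := ht
    change ¬(FullSupp (p t) ∧ IsBernoulli (shiftD (M + 2) N) (p t).toMeasure)
    exact fun h => ht' ⟨RM_fs h.1, RM_bern (he t).toMeasurePreserving h.2⟩
  · intro t
    refine (hf t).mono fun s hs => ?_
    have h2 : RM (p s) = RM (p t) := hs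
    have := congrArg RM h2
    rwa [RM_RM, RM_RM] at this
  · change RM (p 0) = μp
    rw [h0, RM_RM]
  · change RM (p 1) = μm
    rw [h1, RM_RM]
  · intro t
    refine ⟨(hmem t).1, ?_⟩
    rcases (hmem t).2 with h | h
    · exact Or.inl (RM_Me0 h)
    · exact Or.inr (RM_MeAl h)

/-- Proposition 3.1 (abundance of high complexity paths): for any convex open subset `U` of
`M(Σ_D)`, any `γ ∈ {α, β}` and any pair of distinct measures in
`U ∩ (M^e_0(Σ_D) ∪ M^e_γ(Σ_D))`, there is a high complexity path lying in
`U ∩ (M^e_0(Σ_D) ∪ M^e_γ(Σ_D))` joining them. -/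
theorem abundance_high_complexity_paths (M N : ℕ) (hM : 2 ≤ M)
    (U : Set (ProbabilityMeasure ↥(SigmaD M N)))
    (hU1 : U ⊆ MinvD M N) (hU2 : ∃ V, IsOpen V ∧ U = V ∩ MinvD M N)
    (hU3 : ConvexMeasSet U)
    (Mg : Set (ProbabilityMeasure ↥(SigmaD M N)))
    (hMg : Mg = MeAl M N ∨ Mg = MeBe M N)
    (μp μm : ProbabilityMeasure ↥(SigmaD M N))
    (hμp : μp ∈ U ∩ (Me0 M N ∪ Mg)) (hμm : μm ∈ U ∩ (Me0 M N ∪ Mg))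
    (hne : μp ≠ μm) :
    ∃ p : unitInterval → ProbabilityMeasure ↥(SigmaD M N),
      HCPath M N p ∧ p 0 = μp ∧ p 1 = μm ∧ ∀ t, p t ∈ U ∩ (Me0 M N ∪ Mg) := by
  obtain ⟨M', rfl⟩ : ∃ M', M = M' + 2 := ⟨M - 2, by omega⟩
  rcases hMg with rfl | rfl
  · exact main_alpha U hU2 hU3 μp μm hμp hμm
  · exact main_beta U hU2 hU3 μp μm hμp hμm
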